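/- arXiv:math/0405267 — 7 statements merged into one kernel-verified Lean document; each statement's English description precedes it below -/
import Mathlib

section
/- For every positive integer n, the sum over j = 0, 1, …, ⌊n/2⌋ of the squares (C(n,j) − C(n,j−1))² equals the n-th Catalan number C(2n,n)/(n+1), where C(n,j) denotes the binomial coefficient and C(n,−1) = 0 by convention. -/
theorem aux_cross (n : ℕ) :
    ∑ j ∈ Finset.range (n + 1), n.choose (j + 1) * n.choose j = (2 * n).choose (n + 1) := by
  rw [two_mul, Nat.add_choose_eq, Finset.Nat.sum_antidiagonal_eq_sum_range_succ_mk,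
    Finset.sum_range_succ' _ (n + 1)]
  simp only [Nat.sub_zero, Nat.choose_succ_self, mul_zero, add_zero]
  refine Finset.sum_congr rfl fun j hj => ?_
  have hj' : j ≤ n := by simpa [Nat.lt_succ_iff] using hj
  rw [Nat.add_sub_add_right, Nat.choose_symm hj']

theorem aux_full (n : ℕ) :
    (∑ j ∈ Finset.range (n + 2),
        ((n.choose j : ℤ) - (if j = 0 then 0 else (n.choose (j - 1) : ℤ))) ^ 2)
      = 2 * ((2 * n).choose n : ℤ) - 2 * ((2 * n).choose (n + 1) : ℤ) := by
  have h1 : ∑ j ∈ Finset.range (n + 1), (n.choose j : ℤ) ^ 2 = ((2 * n).choose n : ℤ) := by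
    exact_mod_cast Nat.sum_range_choose_sq n
  have h2 : ∑ j ∈ Finset.range (n + 1), (n.choose (j + 1) : ℤ) ^ 2 + 1
      = ((2 * n).choose n : ℤ) := by
    rw [← h1]
    have e1 := Finset.sum_range_succ (fun j => (n.choose j : ℤ) ^ 2) (n + 1)
    have e2 := Finset.sum_range_succ' (fun j => (n.choose j : ℤ) ^ 2) (n + 1)
    simp at e1 e2
    linarith
  have h3 : ∑ j ∈ Finset.range (n + 1), (n.choose (j + 1) : ℤ) * (n.choose j : ℤ)
      = ((2 * n).choose (n + 1) : ℤ) := by exact_mod_cast aux_cross n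
  rw [Finset.sum_range_succ' _ (n + 1)]
  have h4 : ∑ j ∈ Finset.range (n + 1), ((n.choose (j + 1) : ℤ) - (n.choose j : ℤ)) ^ 2
      = ∑ j ∈ Finset.range (n + 1), (n.choose (j + 1) : ℤ) ^ 2
        + ∑ j ∈ Finset.range (n + 1), (n.choose j : ℤ) ^ 2
        - 2 * ∑ j ∈ Finset.range (n + 1), (n.choose (j + 1) : ℤ) * (n.choose j : ℤ) := by
    rw [Finset.mul_sum, ← Finset.sum_add_distrib, ← Finset.sum_sub_distrib]
    exact Finset.sum_congr rfl fun j _ => by ring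
  simp only [Nat.add_sub_cancel, Nat.add_eq_zero_iff, one_ne_zero, and_false, if_false, if_true,
    Nat.choose_zero_right]
  rw [h4]
  push_cast
  linarith

theorem aux_symm (n k : ℕ) (hk : k ≤ n + 1) :
    ((n.choose (n + 1 - k) : ℤ)
        - (if n + 1 - k = 0 then 0 else (n.choose (n + 1 - k - 1) : ℤ)))
      = -((n.choose k : ℤ) - (if k = 0 then 0 else (n.choose (k - 1) : ℤ))) := by
  rcases Nat.eq_zero_or_pos k with rfl | hk0
  · simp
  rcases Nat.eq_or_lt_of_le hk with rfl | hk1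
  · simp
  obtain ⟨m, rfl⟩ : ∃ m, k = m + 1 := ⟨k - 1, by omega⟩
  have e1 : n + 1 - (m + 1) = n - m := by omega
  have e2 : n - m - 1 = n - (m + 1) := by omega
  have e3 : n - m ≠ 0 := by omega
  rw [e1, e2, if_neg e3, if_neg (Nat.succ_ne_zero m), Nat.choose_symm (by omega : m ≤ n),
    Nat.choose_symm (by omega : m + 1 ≤ n)]
  simp

theorem aux_half (n : ℕ) (f : ℕ → ℤ) (hf : ∀ k ≤ n + 1, f (n + 1 - k) = - f k) :
    ∑ j ∈ Finset.range (n + 2), f j ^ 2 = 2 * ∑ j ∈ Finset.range (n / 2 + 1), f j ^ 2 := by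
  have key : ∀ h m, h + m = n + 2 →
      ∑ j ∈ Finset.range (n + 2), f j ^ 2
        = ∑ j ∈ Finset.range h, f j ^ 2 + ∑ j ∈ Finset.range m, f j ^ 2 := by
    intro h m e
    rw [← e, Finset.sum_range_add, ← Finset.sum_range_reflect (fun x => f (h + x) ^ 2)]
    congr 1
    refine Finset.sum_congr rfl fun j hj => ?_
    have hj' := Finset.mem_range.mp hj
    rw [show h + (m - 1 - j) = n + 1 - j by omega, hf j (by omega)]
    ring
  rcases Nat.even_or_odd' n with ⟨m, hm | hm⟩
  · rw [key (n / 2 + 1) (n / 2 + 1) (by omega)]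
    ring
  · rw [key (n / 2 + 1) (n / 2 + 1 + 1) (by omega), Finset.sum_range_succ _ (n / 2 + 1)]
    have h0 := hf (n / 2 + 1) (by omega)
    rw [show n + 1 - (n / 2 + 1) = n / 2 + 1 by omega] at h0
    have h1 : f (n / 2 + 1) = 0 := by linarith
    rw [h1]
    ring

/-- For every positive integer `n`, the sum over `j = 0, …, ⌊n/2⌋` of the squares
`(C(n,j) − C(n,j−1))²` equals the `n`-th Catalan number `C(2n,n)/(n+1)`,
with the convention `C(n,−1) = 0`. -/
theorem stmt0 (n : ℕ) (hn : 1 ≤ n) :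
    (∑ j ∈ Finset.range (n / 2 + 1),
        ((n.choose j : ℤ) - (if j = 0 then 0 else (n.choose (j - 1) : ℤ))) ^ 2)
      = (((2 * n).choose n / (n + 1) : ℕ) : ℤ) := by
  have h1 := aux_half n
    (fun j => (n.choose j : ℤ) - (if j = 0 then 0 else (n.choose (j - 1) : ℤ)))
    (fun k hk => aux_symm n k hk)
  have h2 := aux_full n
  have h3 := Nat.choose_succ_right_eq (2 * n) n
  rw [show 2 * n - n = n by omega] at h3
  have h3' : ((2 * n).choose (n + 1) : ℤ) * (n + 1) = (2 * n).choose n * n := by exact_mod_cast h3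
  have h4 : (n + 1) * ((2 * n).choose n / (n + 1)) = (2 * n).choose n :=
    Nat.mul_div_cancel' (Nat.succ_dvd_centralBinom n)
  have h4' : ((n : ℤ) + 1) * (((2 * n).choose n / (n + 1) : ℕ) : ℤ) = (2 * n).choose n := by
    exact_mod_cast h4
  have hpos : (n : ℤ) + 1 ≠ 0 := by positivity
  apply mul_left_cancel₀ hpos
  rw [h4']
  have h5 : (∑ j ∈ Finset.range (n / 2 + 1),
        ((n.choose j : ℤ) - (if j = 0 then 0 else (n.choose (j - 1) : ℤ))) ^ 2)
      = ((2 * n).choose n : ℤ) - ((2 * n).choose (n + 1) : ℤ) := by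
    linarith
  rw [h5]
  linear_combination -h3'
end

section
/- For every positive integer n, the number of pairs of strictly increasing finite sequences (i_1 < i_2 < … < i_k) and (j_1 < j_2 < … < j_k) of elements of {1, 2, …, n−1}, with k ≥ 0 arbitrary and satisfying j_t ≤ i_t for every t = 1, …, k, equals the n-th Catalan number C(2n,n)/(n+1). (The case k = 0, the pair of empty sequences, is counted once.) -/
/-- Prefix dominance with final height `h`. -/
def JDom (m : ℕ) (h : ℤ) (A B : Finset ℕ) : Prop :=
  (∀ x ≤ m, (A.filter (· ≤ x)).card ≤ (B.filter (· ≤ x)).card) ∧ (B.card : ℤ) = A.card + h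

open Classical in
/-- The number of dominated pairs of subsets of `{1, …, m}`. -/
noncomputable def JN (m : ℕ) (h : ℤ) : ℤ :=
  ∑ A ∈ (Finset.Icc 1 m).powerset, ∑ B ∈ (Finset.Icc 1 m).powerset,
    if JDom m h A B then 1 else 0

lemma jfilter_full (m : ℕ) (A : Finset ℕ) (hA : A ⊆ Finset.Icc 1 m) (x : ℕ) (hx : m ≤ x) :
    A.filter (· ≤ x) = A := by
  apply Finset.filter_true_of_mem
  intro a ha
  have := Finset.mem_Icc.1 (hA ha)
  omega

lemma jfilter_insert (m : ℕ) (A : Finset ℕ) (x : ℕ) (hx : x ≤ m) :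
    (insert (m+1) A).filter (· ≤ x) = A.filter (· ≤ x) := by
  rw [Finset.filter_insert, if_neg (by omega)]

lemma jnotmem (m : ℕ) (A : Finset ℕ) (hA : A ⊆ Finset.Icc 1 m) : m + 1 ∉ A := by
  intro h
  have := Finset.mem_Icc.1 (hA h)
  omega

lemma jdom_succ (m : ℕ) (h : ℤ) (h0 : 0 ≤ h) (A B A' B' : Finset ℕ) (h' : ℤ)
    (hA' : A' ⊆ Finset.Icc 1 (m+1)) (hB' : B' ⊆ Finset.Icc 1 (m+1))
    (hA : ∀ x ≤ m, A'.filter (· ≤ x) = A.filter (· ≤ x))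
    (hB : ∀ x ≤ m, B'.filter (· ≤ x) = B.filter (· ≤ x))
    (hc : (B'.card : ℤ) - A'.card - h = B.card - A.card - h') :
    JDom (m+1) h A' B' ↔ JDom m h' A B := by
  unfold JDom
  constructor
  · rintro ⟨h1, h2⟩
    refine ⟨fun x hx => ?_, by omega⟩
    rw [← hA x hx, ← hB x hx]
    exact h1 x (by omega)
  · rintro ⟨h1, h2⟩
    refine ⟨fun x hx => ?_, by omega⟩
    rcases Nat.lt_or_ge m x with hx' | hx'
    · rw [jfilter_full (m+1) A' hA' x hx', jfilter_full (m+1) B' hB' x hx']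
      omega
    · rw [hA x hx', hB x hx']
      exact h1 x hx'

lemma jN_succ (m : ℕ) (h : ℤ) (h0 : 0 ≤ h) :
    JN (m+1) h = JN m (h-1) + 2 * JN m h + JN m (h+1) := by
  classical
  have hI : Finset.Icc 1 (m+1) = insert (m+1) (Finset.Icc 1 m) := by
    ext x; simp only [Finset.mem_Icc, Finset.mem_insert]; omega
  have hn : m + 1 ∉ Finset.Icc 1 m := by simp
  have key : ∀ A ∈ (Finset.Icc 1 m).powerset, ∀ B ∈ (Finset.Icc 1 m).powerset,
      (JDom (m+1) h A B ↔ JDom m h A B) ∧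
      (JDom (m+1) h A (insert (m+1) B) ↔ JDom m (h-1) A B) ∧
      (JDom (m+1) h (insert (m+1) A) B ↔ JDom m (h+1) A B) ∧
      (JDom (m+1) h (insert (m+1) A) (insert (m+1) B) ↔ JDom m h A B) := by
    intro A hA B hB
    rw [Finset.mem_powerset] at hA hB
    have hs : Finset.Icc 1 m ⊆ Finset.Icc 1 (m+1) := by rw [hI]; exact Finset.subset_insert _ _
    have hA2 : insert (m+1) A ⊆ Finset.Icc 1 (m+1) := by
      rw [hI]; exact Finset.insert_subset_insert _ hA
    have hB2 : insert (m+1) B ⊆ Finset.Icc 1 (m+1) := by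
      rw [hI]; exact Finset.insert_subset_insert _ hB
    have cA := Finset.card_insert_of_notMem (jnotmem m A hA)
    have cB := Finset.card_insert_of_notMem (jnotmem m B hB)
    refine ⟨?_, ?_, ?_, ?_⟩
    · exact jdom_succ m h h0 _ _ _ _ _ (hA.trans hs) (hB.trans hs) (fun _ _ => rfl)
        (fun _ _ => rfl) (by omega)
    · exact jdom_succ m h h0 _ _ _ _ _ (hA.trans hs) hB2 (fun _ _ => rfl)
        (jfilter_insert m B) (by omega)
    · exact jdom_succ m h h0 _ _ _ _ _ hA2 (hB.trans hs) (jfilter_insert m A)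
        (fun _ _ => rfl) (by omega)
    · exact jdom_succ m h h0 _ _ _ _ _ hA2 hB2 (jfilter_insert m A)
        (jfilter_insert m B) (by omega)
  have e1 : JN (m+1) h = ∑ A ∈ (Finset.Icc 1 m).powerset, ∑ B ∈ (Finset.Icc 1 m).powerset,
      (((if JDom m h A B then (1:ℤ) else 0) + (if JDom m (h-1) A B then 1 else 0)) +
       ((if JDom m (h+1) A B then 1 else 0) + (if JDom m h A B then 1 else 0))) := by
    unfold JN
    rw [hI, Finset.sum_powerset_insert hn, ← Finset.sum_add_distrib]
    apply Finset.sum_congr rfl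
    intro A hA
    rw [Finset.sum_powerset_insert hn, Finset.sum_powerset_insert hn,
      ← Finset.sum_add_distrib, ← Finset.sum_add_distrib, ← Finset.sum_add_distrib]
    apply Finset.sum_congr rfl
    intro B hB
    obtain ⟨k1, k2, k3, k4⟩ := key A hA B hB
    simp only [k1, k2, k3, k4]
  rw [e1]
  unfold JN
  simp only [Finset.sum_add_distrib]
  ring

lemma jN_neg (m : ℕ) : JN m (-1) = 0 := by
  classical
  unfold JN
  apply Finset.sum_eq_zero
  intro A hA
  apply Finset.sum_eq_zero
  intro B hB
  rw [Finset.mem_powerset] at hA hB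
  rw [if_neg]
  rintro ⟨h1, h2⟩
  have := h1 m le_rfl
  rw [jfilter_full m A hA m le_rfl, jfilter_full m B hB m le_rfl] at this
  omega

lemma jchoose (a k : ℕ) : (a+2).choose (k+2) = a.choose (k+2) + 2 * a.choose (k+1) + a.choose k := by
  rw [Nat.choose_succ_succ (a+1) (k+1), Nat.choose_succ_succ a (k+1), Nat.choose_succ_succ a k]
  simp only [Nat.succ_eq_add_one, add_assoc, Nat.reduceAdd]
  ring

lemma jN_eq (m : ℕ) : ∀ h : ℕ, JN m h =
    ((2*m+1).choose (m+1+h) : ℤ) - (2*m+1).choose (m+2+h) := by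
  induction m with
  | zero =>
    intro h
    rcases h with _ | h
    · simp [JN, JDom, Finset.filter_singleton]
    · have : ¬ ((0:ℤ) = h + 1) := by omega
      rw [Nat.choose_eq_zero_of_lt (by omega), Nat.choose_eq_zero_of_lt (by omega)]
      simp [JN, JDom]
      exact this
  | succ m ih =>
    intro h
    rw [jN_succ m h (by omega)]
    have c1 := jchoose (2*m+1) (m+h)
    have c2 := jchoose (2*m+1) (m+1+h)
    have i1 := ih h
    have i2 := ih (h+1)
    have e1 : 2*(m+1)+1 = 2*m+1+2 := by ring
    have e2 : m+1+1+h = m+h+2 := by ring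
    have e3 : m+1+2+h = m+1+h+2 := by ring
    rw [e1, e2, e3, c1, c2]
    have i0 : JN m ((h:ℤ) - 1) = ((2*m+1).choose (m+h) : ℤ) - (2*m+1).choose (m+h+1) := by
      rcases h with _ | h
      · have := Nat.choose_symm_half m
        simp [jN_neg, this]
      · have := ih h
        push_cast
        rw [add_sub_cancel_right, this]
        rw [show m+1+h = m+(h+1) by ring, show m+2+h = m+(h+1)+1 by ring]
    push_cast at i2 ⊢
    rw [i0, i1, i2]
    rw [show m+1+h = m+h+1 by ring, show m+2+h = m+h+2 by ring, show m+1+(h+1) = m+h+2 by ring,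
      show m+2+(h+1) = m+h+3 by ring, show m+h+1+2 = m+h+3 by ring, show m+h+1+1 = m+h+2 by ring]
    ring

lemma jfilter_card {k : ℕ} (f : Fin k → ℕ) (hf : StrictMono f) (x : ℕ) :
    ((Finset.univ.image f).filter (· ≤ x)).card = (Finset.univ.filter (fun t => f t ≤ x)).card := by
  rw [Finset.filter_image, Finset.card_image_of_injective _ hf.injective]

lemma jdom_iff {k : ℕ} (m : ℕ) (f g : Fin k → ℕ) (hf : StrictMono f) (hg : StrictMono g)
    (hfm : ∀ t, f t ≤ m) :
    JDom m 0 (Finset.univ.image f) (Finset.univ.image g) ↔ ∀ t, g t ≤ f t := by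
  unfold JDom
  simp only [jfilter_card f hf, jfilter_card g hg, Finset.card_image_of_injective _ hf.injective,
    Finset.card_image_of_injective _ hg.injective]
  constructor
  · rintro ⟨h, -⟩ t
    by_contra hlt
    have h1 := h (f t) (hfm t)
    have h2 : Finset.univ.filter (fun s => f s ≤ f t) = Finset.Iic t := by
      ext s; simp [hf.le_iff_le]
    have h3 : Finset.univ.filter (fun s => g s ≤ f t) ⊆ Finset.Iio t := by
      intro s hs
      simp only [Finset.mem_filter, Finset.mem_univ, true_and] at hs
      rw [Finset.mem_Iio, ← hg.lt_iff_lt]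
      omega
    have h4 := Finset.card_le_card h3
    rw [h2, Fin.card_Iic] at h1
    rw [Fin.card_Iio] at h4
    omega
  · intro h
    refine ⟨fun x _ => Finset.card_le_card ?_, by simp⟩
    intro s hs
    simp only [Finset.mem_filter, Finset.mem_univ, true_and] at hs ⊢
    exact (h s).trans hs

lemma jinj {k : ℕ} (f g : Fin k → ℕ) (hf : StrictMono f) (hg : StrictMono g)
    (h : Finset.univ.image f = Finset.univ.image g) : f = g := by
  apply (StrictMono.range_inj hf hg).1
  have := congrArg (fun s : Finset ℕ => (s : Set ℕ)) h
  simpa using this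

lemma jimage (A : Finset ℕ) (k : ℕ) (h : A.card = k) :
    Finset.univ.image (A.orderEmbOfFin h) = A := by
  apply Finset.coe_injective
  simp

open Classical in
lemma jcard (m : ℕ) : Nat.card {p : Σ k : ℕ, (Fin k → ℕ) × (Fin k → ℕ) //
      StrictMono p.2.1 ∧ StrictMono p.2.2 ∧
      (∀ t, 1 ≤ p.2.1 t ∧ p.2.1 t ≤ m) ∧
      (∀ t, 1 ≤ p.2.2 t ∧ p.2.2 t ≤ m) ∧
      (∀ t, p.2.2 t ≤ p.2.1 t)} =
    (((Finset.Icc 1 m).powerset ×ˢ (Finset.Icc 1 m).powerset).filter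
      (fun q => JDom m 0 q.1 q.2)).card := by
  rw [← Fintype.card_coe, ← Nat.card_eq_fintype_card]
  refine Nat.card_eq_of_bijective (fun p => ⟨(Finset.univ.image p.1.2.1,
    Finset.univ.image p.1.2.2), ?_⟩) ⟨?_, ?_⟩
  · obtain ⟨⟨k, f, g⟩, hf, hg, hfm, hgm, hfg⟩ := p
    simp only [Finset.mem_filter, Finset.mem_product, Finset.mem_powerset]
    refine ⟨⟨?_, ?_⟩, (jdom_iff m f g hf hg (fun t => (hfm t).2)).2 hfg⟩
    · intro x hx
      obtain ⟨t, -, rfl⟩ := Finset.mem_image.1 hx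
      exact Finset.mem_Icc.2 (hfm t)
    · intro x hx
      obtain ⟨t, -, rfl⟩ := Finset.mem_image.1 hx
      exact Finset.mem_Icc.2 (hgm t)
  · rintro ⟨⟨k, f, g⟩, hf, hg, h1⟩ ⟨⟨k', f', g'⟩, hf', hg', h1'⟩ h
    simp only [Subtype.mk.injEq, Prod.mk.injEq] at h hf hg hf' hg'
    obtain ⟨e1, e2⟩ := h
    have hk : k = k' := by
      have := congrArg Finset.card e1
      rw [Finset.card_image_of_injective _ hf.injective,
        Finset.card_image_of_injective _ hf'.injective] at this
      simpa using this
    subst hk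
    obtain rfl := jinj f f' hf hf' e1
    obtain rfl := jinj g g' hg hg' e2
    rfl
  · rintro ⟨⟨A, B⟩, hq⟩
    have hq' := hq
    simp only [Finset.mem_filter, Finset.mem_product, Finset.mem_powerset] at hq'
    obtain ⟨⟨hA, hB⟩, hD⟩ := hq'
    have hc : B.card = A.card := by
      have := hD.2
      omega
    have hfm : ∀ t, 1 ≤ A.orderEmbOfFin rfl t ∧ A.orderEmbOfFin rfl t ≤ m := fun t =>
      Finset.mem_Icc.1 (hA (Finset.orderEmbOfFin_mem A rfl t))
    have hgm : ∀ t, 1 ≤ B.orderEmbOfFin hc t ∧ B.orderEmbOfFin hc t ≤ m := fun t =>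
      Finset.mem_Icc.1 (hB (Finset.orderEmbOfFin_mem B hc t))
    refine ⟨⟨⟨A.card, A.orderEmbOfFin rfl, B.orderEmbOfFin hc⟩,
      (A.orderEmbOfFin rfl).strictMono, (B.orderEmbOfFin hc).strictMono, hfm, hgm, ?_⟩, ?_⟩
    · refine (jdom_iff m _ _ (A.orderEmbOfFin rfl).strictMono (B.orderEmbOfFin hc).strictMono
        (fun t => (hfm t).2)).1 ?_
      rw [jimage, jimage]
      exact hD
    · apply Subtype.ext
      exact Prod.ext (jimage A _ rfl) (jimage B _ hc)

theorem stmt2 (n : ℕ) (hn : 1 ≤ n) :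
    Nat.card {p : Σ k : ℕ, (Fin k → ℕ) × (Fin k → ℕ) //
      StrictMono p.2.1 ∧ StrictMono p.2.2 ∧
      (∀ t, 1 ≤ p.2.1 t ∧ p.2.1 t ≤ n - 1) ∧
      (∀ t, 1 ≤ p.2.2 t ∧ p.2.2 t ≤ n - 1) ∧
      (∀ t, p.2.2 t ≤ p.2.1 t)}
      = (2 * n).choose n / (n + 1) := by
  classical
  obtain ⟨m, rfl⟩ : ∃ m, n = m + 1 := ⟨n - 1, by omega⟩
  rw [Nat.add_sub_cancel, jcard]
  have h1 : JN m 0 = ((((Finset.Icc 1 m).powerset ×ˢ (Finset.Icc 1 m).powerset).filter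
      (fun q => JDom m 0 q.1 q.2)).card : ℤ) := by
    rw [Finset.card_filter, Finset.sum_product]
    push_cast
    rfl
  have h2 := jN_eq m 0
  rw [Nat.cast_zero, h1] at h2
  generalize (((Finset.Icc 1 m).powerset ×ˢ (Finset.Icc 1 m).powerset).filter
      (fun q => JDom m 0 q.1 q.2)).card = c at h2 ⊢
  symm
  apply Nat.div_eq_of_eq_mul_right (by omega)
  simp only [add_zero] at h2
  have h3 : (2*(m+1)).choose (m+1) = 2 * (2*m+1).choose (m+1) := by
    have := Nat.choose_symm_half m
    rw [show 2*(m+1) = 2*m+1+1 by ring, Nat.choose_succ_succ, this.symm]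
    simp only [Nat.succ_eq_add_one]
    omega
  have h4 := Nat.choose_succ_right_eq (2*m+1) (m+1)
  rw [show 2*m+1-(m+1) = m by omega] at h4
  rw [h3]
  zify at h4 ⊢
  rw [h2]
  rw [show m+1+1 = m+2 by ring] at h4
  linarith
end

section
/- For n ≥ 1 and any d ∈ ℂ, the Temperley-Lieb algebra TL_n(d) is spanned as a ℂ-vector space by the Jones normal-form words (h_{i_1}h_{i_1−1}⋯h_{j_1})(h_{i_2}h_{i_2−1}⋯h_{j_2})⋯(h_{i_k}h_{i_k−1}⋯h_{j_k}), where k ≥ 0, the indices satisfy 1 ≤ i_1 < i_2 < … < i_k ≤ n−1, 1 ≤ j_1 < j_2 < … < j_k ≤ n−1, and j_t ≤ i_t for all t (the empty product being the unit 1). In particular the ℂ-dimension of TL_n(d) is at most the n-th Catalan number. -/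
/-- The Temperley-Lieb relations on the free algebra on `m` generators
`h_1, …, h_m` (0-indexed as `FreeAlgebra.ι ℂ i`, `i : Fin m`, standing for `h_{i+1}`):
`h_i² = d·h_i`, `h_i h_j = h_j h_i` for `|i−j| ≥ 2`, and `h_i h_{i±1} h_i = h_i`. -/
inductive TLRel (d : ℂ) (m : ℕ) :
    FreeAlgebra ℂ (Fin m) → FreeAlgebra ℂ (Fin m) → Prop
  | sq (i : Fin m) :
      TLRel d m (FreeAlgebra.ι ℂ i * FreeAlgebra.ι ℂ i) (d • FreeAlgebra.ι ℂ i)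
  | comm (i j : Fin m) (h : (i : ℕ) + 2 ≤ (j : ℕ) ∨ (j : ℕ) + 2 ≤ (i : ℕ)) :
      TLRel d m (FreeAlgebra.ι ℂ i * FreeAlgebra.ι ℂ j)
        (FreeAlgebra.ι ℂ j * FreeAlgebra.ι ℂ i)
  | hook (i j : Fin m) (h : (i : ℕ) + 1 = (j : ℕ) ∨ (j : ℕ) + 1 = (i : ℕ)) :
      TLRel d m (FreeAlgebra.ι ℂ i * FreeAlgebra.ι ℂ j * FreeAlgebra.ι ℂ i)
        (FreeAlgebra.ι ℂ i)

/-- The Temperley-Lieb algebra `TL_n(d)`: the unital associative `ℂ`-algebra with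
generators `h_1, …, h_{n−1}` and the Temperley-Lieb relations, realized as a
`RingQuot` of the free algebra on `n − 1` generators. -/
abbrev TL (d : ℂ) (n : ℕ) : Type := RingQuot (TLRel d (n - 1))

/-- The generator of `TL_n(d)` indexed by `i : Fin (n-1)` (representing `h_{i+1}`). -/
noncomputable def TLgen (d : ℂ) (n : ℕ) (i : Fin (n - 1)) : TL d n :=
  RingQuot.mkAlgHom ℂ (TLRel d (n - 1)) (FreeAlgebra.ι ℂ i)

/-- The generator `h_i` of `TL_n(d)` in its 1-based labelling (`1 ≤ i ≤ n−1`),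
with junk value `0` outside that range. -/
noncomputable def TLh (d : ℂ) (n : ℕ) (i : ℕ) : TL d n :=
  if h : 1 ≤ i ∧ i ≤ n - 1 then TLgen d n ⟨i - 1, by omega⟩ else 0

/-- The quantum integer `[k]_q`, equal to `(q^k − q^{−k})/(q − q^{−1})` when `q² ≠ 1`
and to `k·q^{k−1}` when `q = ±1`. -/
noncomputable def qInt (q : ℂ) (k : ℕ) : ℂ :=
  if q ^ 2 = 1 then (k : ℂ) * q ^ (k - 1) else (q ^ k - q⁻¹ ^ k) / (q - q⁻¹)


namespace TLaux

/-- The descending word `i, i-1, …, j`. -/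
def D (i j : ℕ) : List ℕ := (List.range (i + 1 - j)).map (fun s => i - s)

lemma D_length (i j : ℕ) : (D i j).length = i + 1 - j := by simp [D]

lemma mem_D {i j b : ℕ} (h : b ∈ D i j) : j ≤ b ∧ b ≤ i := by
  simp only [D, List.mem_map, List.mem_range] at h
  obtain ⟨s, hs, rfl⟩ := h
  omega

lemma D_split {i j a : ℕ} (h1 : j ≤ a + 1) (h2 : a ≤ i) :
    D i j = D i (a + 1) ++ D a j := by
  apply List.ext_getElem
  · simp only [List.length_append, D_length]; omega
  · intro n hn hn'
    simp only [D_length] at hn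
    rw [List.getElem_append]
    split_ifs with h
    · simp [D]
    · simp only [D_length] at h
      simp only [D, List.getElem_map, List.getElem_range, List.length_map, List.length_range]
      omega

lemma D_self (a : ℕ) : D a a = [a] := by simp [D]

/-- Jones normal form words (all `i ≤ m`, all `j ≤ l`). -/
inductive NF : ℕ → ℕ → List ℕ → Prop
  | nil (m l : ℕ) : NF m l []
  | snoc (m l i j : ℕ) (w : List ℕ) (h1 : 1 ≤ j) (h2 : j ≤ i) (h3 : i ≤ m) (h4 : j ≤ l)
      (hw : NF (i - 1) (j - 1) w) : NF m l (w ++ D i j)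

lemma NF.letters {m l : ℕ} {w : List ℕ} (h : NF m l w) : ∀ b ∈ w, 1 ≤ b ∧ b ≤ m := by
  induction h with
  | nil => simp
  | snoc m l i j w h1 h2 h3 h4 hw ih =>
    intro b hb
    rcases List.mem_append.1 hb with hb | hb
    · have := ih b hb; omega
    · have := mem_D hb; omega

section
variable {A : Type*} [Ring A] [Algebra ℂ A] (h : ℕ → A)

/-- Value of a word. -/
def P (w : List ℕ) : A := (w.map h).prod

lemma P_append (u v : List ℕ) : P h (u ++ v) = P h u * P h v := by simp [P]

lemma P_single (a : ℕ) : P h [a] = h a := by simp [P]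

lemma P_nil : P h [] = 1 := by simp [P]

variable (d : ℂ) (M : ℕ)
  (hsq : ∀ i, h i * h i = d • h i)
  (hcomm : ∀ i j, i + 2 ≤ j → h i * h j = h j * h i)
  (hhook : ∀ i j, 1 ≤ i → i ≤ M → 1 ≤ j → j ≤ M → (i + 1 = j ∨ j + 1 = i) →
    h i * h j * h i = h i)

include hcomm in
lemma comm_words (u v : List ℕ) (huv : ∀ a ∈ u, ∀ b ∈ v, a + 2 ≤ b) :
    P h u * P h v = P h v * P h u := by
  have : Commute (P h u) (P h v) := by
    apply Commute.list_prod_left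
    intro x hx
    apply Commute.list_prod_right
    intro y hy
    obtain ⟨a, ha, rfl⟩ := List.mem_map.1 hx
    obtain ⟨b, hb, rfl⟩ := List.mem_map.1 hy
    exact hcomm a b (huv a ha b hb)
  exact this

include hcomm hhook in
/-- `D i j * h_a` with `j < a ≤ i`. Here `a = c + 1`. -/
lemma red1 {i j c : ℕ} (hj : 1 ≤ j) (hjc : j ≤ c) (hc : c + 1 ≤ i) (hi : i ≤ M) :
    P h (D i j) * h (c + 1) = P h (D i (c + 1) ++ D (c - 1) j) := by
  have e1 : D i j = D i (c + 1) ++ D c j := D_split (by omega) (by omega)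
  have e2 : D c j = D c c ++ D (c - 1) j := by
    have := D_split (i := c) (j := j) (a := c - 1) (by omega) (by omega)
    rwa [Nat.sub_add_cancel (by omega)] at this
  have e3 : D i (c + 1) = D i (c + 2) ++ [c + 1] := by
    rw [← D_self]; exact D_split (a := c + 1) (by omega) (by omega)
  have hc1 : P h (D (c - 1) j) * h (c + 1) = h (c + 1) * P h (D (c - 1) j) := by
    rw [← P_single h (c + 1)]
    apply comm_words h hcomm
    intro a ha b hb
    have := mem_D ha
    simp at hb
    omega
  have hh := hhook (c + 1) c (by omega) (by omega) (by omega) (by omega) (by omega)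
  rw [e1, e2, e3, D_self]
  simp only [P_append, P_single, mul_assoc] at *
  rw [hc1, ← mul_assoc (h c), ← mul_assoc (h (c + 1)), hh]

include hcomm hhook in
/-- Product of two descending runs whose lower ends fail to increase. -/
lemma red2 {i j i' j' : ℕ} (hj : 1 ≤ j) (hjj : j ≤ j') (hj' : j' ≤ i') (hii : i' < i)
    (hi : i ≤ M) :
    P h (D i' j') * P h (D i j) = P h (D i' j ++ D i (j' + 2)) := by
  have e1 : D i j = D i (j' + 2) ++ ([j' + 1] ++ D j' j) := by
    rw [← D_self, ← D_split (i := j' + 1) (by omega) (by omega)]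
    exact D_split (by omega) (by omega)
  have e2 : D j' j = [j'] ++ D (j' - 1) j := by
    have := D_split (i := j') (j := j) (a := j' - 1) (by omega) (by omega)
    rwa [Nat.sub_add_cancel (by omega), D_self] at this
  have e3 : D i' j' = D i' (j' + 1) ++ [j'] := by
    rw [← D_self]; exact D_split (by omega) (by omega)
  have e4 : D i' j = D i' (j' + 1) ++ D j' j := D_split (by omega) (by omega)
  have c1 : P h [j'] * P h (D i (j' + 2)) = P h (D i (j' + 2)) * P h [j'] := by
    apply comm_words h hcomm
    intro a ha b hb
    have := mem_D hb
    simp at ha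
    omega
  have c2 : P h (D j' j) * P h (D i (j' + 2)) = P h (D i (j' + 2)) * P h (D j' j) := by
    apply comm_words h hcomm
    intro a ha b hb
    have := mem_D hb
    have := mem_D ha
    omega
  have hh := hhook j' (j' + 1) (by omega) (by omega) (by omega) (by omega) (by omega)
  have k1 : P h [j'] * (P h [j' + 1] * P h (D j' j)) = P h (D j' j) := by
    rw [e2]
    simp only [P_append, P_single]
    rw [← mul_assoc, ← mul_assoc, hh]
  calc P h (D i' j') * P h (D i j)
      = P h (D i' (j' + 1)) * ((P h [j'] * P h (D i (j' + 2))) *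
          (P h [j' + 1] * P h (D j' j))) := by
        rw [e3, e1]; simp only [P_append, mul_assoc]
    _ = P h (D i' (j' + 1)) * (P h (D i (j' + 2)) * P h (D j' j)) := by
        rw [c1, mul_assoc, k1]
    _ = _ := by rw [← c2, e4]; simp only [P_append, mul_assoc]

/-- `x` is a scalar multiple of a normal word of length at most `L` and letters at most `m`. -/
def Good (L m : ℕ) (x : A) : Prop :=
  ∃ (c : ℂ) (v : List ℕ), NF m m v ∧ v.length ≤ L ∧ x = c • P h v

include hcomm hhook in
lemma stepT {L m : ℕ} (hm : m ≤ M)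
    (S : ∀ w : List ℕ, (∀ b ∈ w, 1 ≤ b ∧ b ≤ m) → w.length ≤ L → Good h L m (P h w))
    {i j : ℕ} {v : List ℕ} (hv : NF (i - 1) (i - 1) v) (hj : 1 ≤ j) (hji : j ≤ i) (hi : i ≤ m)
    (hlen : v.length + (i + 1 - j) ≤ L + 1) :
    Good h (L + 1) m (P h v * P h (D i j)) := by
  have hlet := hv.letters
  cases hv with
  | nil =>
    refine ⟨1, [] ++ D i j, NF.snoc m m i j [] hj hji hi (by omega) (NF.nil _ _), ?_, ?_⟩
    · simpa [D_length] using hlen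
    · rw [one_smul, P_append]
  | snoc _ _ i' j' v' h1 h2 h3 h4 hw =>
    by_cases hlt : j' < j
    · refine ⟨1, (v' ++ D i' j') ++ D i j, NF.snoc m m i j _ hj hji hi (by omega)
        (NF.snoc _ _ i' j' v' h1 h2 h3 (by omega) hw), ?_, ?_⟩
      · rw [List.length_append, D_length]; exact hlen
      · rw [one_smul, P_append h (v' ++ D i' j')]
    · have key := S (v' ++ (D i' j ++ D i (j' + 2))) (by
        intro b hb
        rcases List.mem_append.1 hb with hb | hb
        · have := hlet b (List.mem_append_left _ hb); omega
        rcases List.mem_append.1 hb with hb | hb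
        · have := mem_D hb; omega
        · have := mem_D hb; omega) (by
        simp only [List.length_append, D_length] at hlen ⊢
        omega)
      obtain ⟨c, u, hu, hul, he⟩ := key
      refine ⟨c, u, hu, by omega, ?_⟩
      rw [← he, P_append, mul_assoc, red2 h M hcomm hhook hj (by omega) h2 (by omega) (by omega),
        ← P_append]

include hsq hcomm hhook in
lemma main (L : ℕ) : ∀ m, m ≤ M → ∀ w : List ℕ, (∀ b ∈ w, 1 ≤ b ∧ b ≤ m) → w.length ≤ L →
    Good h w.length m (P h w) := by
  induction L with
  | zero =>
    intro m hm w hw hl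
    have : w = [] := List.length_eq_zero_iff.1 (by omega)
    subst this
    exact ⟨1, [], NF.nil _ _, by simp, by simp⟩
  | succ L S =>
    intro m hm w hw hl
    rcases List.eq_nil_or_concat w with rfl | ⟨w0, a, rfl⟩
    · exact ⟨1, [], NF.nil _ _, by simp, by simp⟩
    rw [List.concat_eq_append] at *
    by_cases hl' : (w0 ++ [a]).length ≤ L
    · exact S m hm _ hw hl'
    have hl2 : (w0 ++ [a]).length = L + 1 := by omega
    have S' : ∀ w : List ℕ, (∀ b ∈ w, 1 ≤ b ∧ b ≤ m) → w.length ≤ L → Good h L m (P h w) := by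
      intro w hw hl
      obtain ⟨c, v, hv, hvl, he⟩ := S m hm w hw hl
      exact ⟨c, v, hv, by omega, he⟩
    rw [hl2]
    have ha : 1 ≤ a ∧ a ≤ m := hw a (by simp)
    obtain ⟨c, v, hv, hvl, he⟩ := S' w0 (fun b hb => hw b (by simp [hb]))
      (by simpa using hl)
    rw [P_append, P_single, he, smul_mul_assoc]
    suffices hG : Good h (L + 1) m (P h v * h a) by
      obtain ⟨c', u, hu, hul, he'⟩ := hG
      exact ⟨c * c', u, hu, hul, by rw [he', smul_smul]⟩
    have hlet := hv.letters
    cases hv with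
    | nil =>
      refine ⟨1, [] ++ D a a, NF.snoc m m a a [] ha.1 le_rfl ha.2 ha.2 (NF.nil _ _), ?_, ?_⟩
      · simp [D_length]
      · rw [one_smul, P_append, D_self, P_single]
    | snoc _ _ i j v' h1 h2 h3 h4 hw' =>
      simp only [List.length_append, D_length] at hvl
      have hlet' := hw'.letters
      have hmono : NF (i - 1) (i - 1) v' := by
        cases hw' with
        | nil => exact NF.nil _ _
        | snoc _ _ i' j' v'' g1 g2 g3 g4 gw =>
          exact NF.snoc _ _ i' j' v'' g1 g2 g3 (by omega) gw
      rcases lt_trichotomy a j with haj | haj | haj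
      · by_cases hajs : a + 1 = j
        · have := stepT h M hcomm hhook hm S' hmono ha.1 (by omega : a ≤ i) h3
            (by omega)
          rwa [D_split (i := i) (j := a) (a := a) (by omega) (by omega), hajs, D_self,
            P_append, P_single, ← mul_assoc, ← P_append] at this
        · have hc : P h (D i j) * h a = h a * P h (D i j) := by
            rw [← P_single h a]
            symm
            apply comm_words h hcomm
            intro x hx y hy
            have := mem_D hy
            simp at hx
            omega
          obtain ⟨c', u, hu, hul, he'⟩ := S (i - 1) (by omega) (v' ++ [a]) (by
            intro b hb
            rcases List.mem_append.1 hb with hb | hb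
            · exact hlet' b hb
            · simp at hb; omega) (by simp; omega)
          have hul' : u.length ≤ v'.length + 1 := by simpa using hul
          obtain ⟨c2, u2, hu2, hul2, he2⟩ := stepT h M hcomm hhook hm S' hu h1 h2 h3
            (by omega)
          refine ⟨c' * c2, u2, hu2, hul2, ?_⟩
          rw [P_append, mul_assoc, hc, ← mul_assoc, ← P_single h a, ← P_append, he',
            smul_mul_assoc, he2, smul_smul]
      · subst haj
        refine ⟨d, v' ++ D i a, NF.snoc _ _ i a v' h1 h2 h3 h4 hw', ?_, ?_⟩
        · simp only [List.length_append, D_length]; omega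
        · rw [P_append, D_split (i := i) (j := a) (a := a) (by omega) (by omega), D_self,
            P_append, P_single, mul_assoc, mul_assoc, hsq]
          simp only [mul_smul_comm]
      · by_cases hai : a ≤ i
        · obtain ⟨b, rfl⟩ : ∃ b, a = b + 1 := ⟨a - 1, by omega⟩
          obtain ⟨c', u, hu, hul, he'⟩ := S' (v' ++ (D i (b + 1) ++ D (b - 1) j)) (by
            intro x hx
            rcases List.mem_append.1 hx with hx | hx
            · have := hlet' x hx; omega
            rcases List.mem_append.1 hx with hx | hx
            · have := mem_D hx; omega
            · have := mem_D hx; omega) (by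
            simp only [List.length_append, D_length]; omega)
          refine ⟨c', u, hu, by omega, ?_⟩
          rw [← he', P_append, mul_assoc,
            red1 h M hcomm hhook h1 (by omega) (by omega) (by omega), ← P_append]
        · refine ⟨1, (v' ++ D i j) ++ D a a, NF.snoc m m a a _ ha.1 le_rfl ha.2 ha.2
            (NF.snoc _ _ i j v' h1 h2 (by omega) (by omega) hw'), ?_, ?_⟩
          · simp only [List.length_append, D_length]; omega
          · rw [one_smul, P_append h (v' ++ D i j), D_self, P_single]

end

/-- Explicit list of all normal words. -/
def F : ℕ → ℕ → List (List ℕ)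
  | 0, _ => [[]]
  | m + 1, l => F m (min l m) ++
      (List.range (min l (m + 1))).flatMap (fun j => (F m j).map (fun w => w ++ D (m + 1) (j + 1)))

lemma mem_F {m l : ℕ} {w : List ℕ} (h : NF m l w) : w ∈ F m l := by
  induction m generalizing l w with
  | zero =>
    cases h with
    | nil => simp [F]
    | snoc _ _ i j v h1 h2 h3 h4 hw => omega
  | succ m ih =>
    rw [F, List.mem_append]
    cases h with
    | nil => exact Or.inl (ih (NF.nil _ _))
    | snoc _ _ i j v h1 h2 h3 h4 hw =>
      by_cases him : i ≤ m
      · exact Or.inl (ih (NF.snoc _ _ i j v h1 h2 him (by omega) hw))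
      · right
        have : i = m + 1 := by omega
        subst this
        rw [List.mem_flatMap]
        refine ⟨j - 1, by rw [List.mem_range]; omega, ?_⟩
        rw [List.mem_map]
        exact ⟨v, ih hw, by rw [Nat.sub_add_cancel h1]⟩

/-- Ballot numbers. -/
def g (m : ℕ) : ℕ → ℤ
  | 0 => 1
  | l + 1 => ((m + l + 2).choose (l + 1) : ℤ) - ((m + l + 2).choose l : ℤ)

lemma g_rec (m l : ℕ) : g (m + 1) (l + 1) = g (m + 1) l + g m (l + 1) := by
  cases l with
  | zero =>
    simp [g]; ring
  | succ l =>
    simp only [g]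
    have e1 : m + 1 + (l + 1) + 2 = (m + l + 3) + 1 := by ring
    have e2 : m + 1 + l + 2 = m + l + 3 := by ring
    have e3 : m + (l + 1) + 2 = m + l + 3 := by ring
    rw [e1, e2, e3, Nat.choose_succ_succ (m + l + 3) (l + 1), Nat.choose_succ_succ (m + l + 3) l]
    push_cast
    ring

lemma g_sum (m l : ℕ) : g (m + 1) l = ∑ j ∈ Finset.range (l + 1), g m j := by
  induction l with
  | zero => simp [g]
  | succ l ih => rw [Finset.sum_range_succ, ← ih, g_rec]

lemma g_diag (m : ℕ) : g m (m + 1) = g m m := by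
  cases m with
  | zero => simp [g]
  | succ m =>
    simp only [g]
    have e1 : m + 1 + (m + 1) + 2 = (2 * m + 3) + 1 := by ring
    have e2 : m + 1 + m + 2 = 2 * m + 3 := by ring
    have e3 : (2 * m + 3).choose (m + 2) = (2 * m + 3).choose (m + 1) :=
      Nat.choose_symm_of_eq_add (by ring)
    rw [e1, e2, Nat.choose_succ_succ (2 * m + 3) (m + 1), Nat.choose_succ_succ (2 * m + 3) m]
    have : (m + 1).succ = m + 2 := rfl
    rw [this, e3]
    push_cast
    ring

lemma F_length (m l : ℕ) (hl : l ≤ m) : ((F m l).length : ℤ) = g m l := by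
  induction m generalizing l with
  | zero =>
    obtain rfl : l = 0 := by omega
    simp [F, g]
  | succ m ih =>
    have e : min l (m + 1) = l := by omega
    rw [F, List.length_append, List.length_flatMap, e, g_sum, Finset.sum_range_succ]
    push_cast
    have h1 : ((F m (min l m)).length : ℤ) = g m l := by
      rw [ih _ (by omega)]
      rcases Nat.lt_or_ge m l with h | h
      · have : l = m + 1 := by omega
        subst this
        rw [g_diag]; congr 1; omega
      · congr 1; omega
    rw [h1, add_comm]
    congr 1
    simp only [List.length_map, List.map_map]
    rw [Finset.sum_congr rfl (fun j hj => (ih j (by have := Finset.mem_range.1 hj; omega)).symm)]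
    rw [Finset.sum, Finset.range_val, Multiset.range, Multiset.map_coe, Multiset.sum_coe]
    norm_cast

lemma F_length_diag (m : ℕ) :
    (F m m).length = (2 * (m + 1)).choose (m + 1) / (m + 1 + 1) := by
  symm
  apply Nat.div_eq_of_eq_mul_right (by omega)
  have h1 := F_length m m le_rfl
  rw [← g_diag] at h1
  simp only [g] at h1
  have h2 := Nat.choose_succ_right_eq (2 * (m + 1)) m
  have e : 2 * (m + 1) - m = m + 2 := by omega
  have e2 : m + m + 2 = 2 * (m + 1) := by ring
  rw [e] at h2
  rw [e2] at h1
  zify at h2 ⊢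
  rw [h1]
  linarith

lemma NF.toFin {A : Type*} [Ring A] [Algebra ℂ A] (h : ℕ → A) {m l : ℕ} {w : List ℕ} (hw : NF m l w) :
    ∃ (k : ℕ) (i j : Fin k → ℕ), StrictMono i ∧ StrictMono j ∧
        (∀ t, 1 ≤ j t) ∧ (∀ t, i t ≤ m) ∧ (∀ t, j t ≤ l) ∧ (∀ t, j t ≤ i t) ∧
        P h w = (List.ofFn (fun t : Fin k =>
          ((List.range (i t + 1 - j t)).map (fun s => h (i t - s))).prod)).prod := by
  induction hw with
  | nil m l =>
    exact ⟨0, Fin.elim0, Fin.elim0, fun a => a.elim0, fun a => a.elim0, fun a => a.elim0,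
      fun a => a.elim0, fun a => a.elim0, fun a => a.elim0, by simp [P]⟩
  | snoc m l a b w h1 h2 h3 h4 hw ih =>
    obtain ⟨k, i, j, hi, hj, hj1, him, hjl, hji, he⟩ := ih
    refine ⟨k + 1, Fin.snoc i a, Fin.snoc j b, ?_, ?_, ?_, ?_, ?_, ?_, ?_⟩
    · intro x y hxy
      induction y using Fin.lastCases with
      | last =>
        induction x using Fin.lastCases with
        | last => exact absurd hxy (lt_irrefl _)
        | cast x => simp only [Fin.snoc_castSucc, Fin.snoc_last]; have := him x; omega
      | cast y =>
        induction x using Fin.lastCases with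
        | last => exact absurd hxy (not_lt.2 (Fin.le_last _))
        | cast x => simp only [Fin.snoc_castSucc]; exact hi (by simpa using hxy)
    · intro x y hxy
      induction y using Fin.lastCases with
      | last =>
        induction x using Fin.lastCases with
        | last => exact absurd hxy (lt_irrefl _)
        | cast x => simp only [Fin.snoc_castSucc, Fin.snoc_last]; have := hjl x; omega
      | cast y =>
        induction x using Fin.lastCases with
        | last => exact absurd hxy (not_lt.2 (Fin.le_last _))
        | cast x => simp only [Fin.snoc_castSucc]; exact hj (by simpa using hxy)
    · intro t
      induction t using Fin.lastCases with
      | last => simpa using h1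
      | cast t => simpa using hj1 t
    · intro t
      induction t using Fin.lastCases with
      | last => simpa using h3
      | cast t => simp only [Fin.snoc_castSucc]; have := him t; omega
    · intro t
      induction t using Fin.lastCases with
      | last => simpa using h4
      | cast t => simp only [Fin.snoc_castSucc]; have := hjl t; omega
    · intro t
      induction t using Fin.lastCases with
      | last => simpa using h2
      | cast t => simpa using hji t
    · rw [P_append, he, List.ofFn_succ', List.concat_eq_append, List.prod_append]
      simp only [Fin.snoc_castSucc, Fin.snoc_last, List.prod_singleton]
      congr 1
      simp [P, D, Function.comp_def]

lemma TLgen_eq (d : ℂ) (n i : ℕ) (h : 1 ≤ i ∧ i ≤ n - 1) :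
    TLh d n i = RingQuot.mkAlgHom ℂ (TLRel d (n - 1)) (FreeAlgebra.ι ℂ ⟨i - 1, by omega⟩) := by
  rw [TLh, dif_pos h]; rfl

lemma TL_sq (d : ℂ) (n i : ℕ) : TLh d n i * TLh d n i = d • TLh d n i := by
  by_cases h : 1 ≤ i ∧ i ≤ n - 1
  · rw [TLgen_eq d n i h, ← map_mul, RingQuot.mkAlgHom_rel ℂ (TLRel.sq _), map_smul]
  · simp [TLh, h]

lemma TL_comm (d : ℂ) (n i j : ℕ) (hij : i + 2 ≤ j) :
    TLh d n i * TLh d n j = TLh d n j * TLh d n i := by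
  by_cases h : 1 ≤ i ∧ i ≤ n - 1
  · by_cases h' : 1 ≤ j ∧ j ≤ n - 1
    · rw [TLgen_eq d n i h, TLgen_eq d n j h', ← map_mul, ← map_mul,
        RingQuot.mkAlgHom_rel ℂ (TLRel.comm _ _ _)]
      left; simp only; omega
    · simp [TLh, h']
  · simp [TLh, h]

lemma TL_hook (d : ℂ) (n i j : ℕ) (h1 : 1 ≤ i) (h2 : i ≤ n - 1) (h3 : 1 ≤ j) (h4 : j ≤ n - 1)
    (hij : i + 1 = j ∨ j + 1 = i) :
    TLh d n i * TLh d n j * TLh d n i = TLh d n i := by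
  rw [TLgen_eq d n i ⟨h1, h2⟩, TLgen_eq d n j ⟨h3, h4⟩, ← map_mul, ← map_mul,
    RingQuot.mkAlgHom_rel ℂ (TLRel.hook _ _ _)]
  simp only; omega

lemma span_words (d : ℂ) (n : ℕ) :
    Submodule.span ℂ {x : TL d n | ∃ w : List ℕ, (∀ b ∈ w, 1 ≤ b ∧ b ≤ n - 1) ∧
      x = P (TLh d n) w} = ⊤ := by
  rw [eq_top_iff]
  rintro x -
  obtain ⟨y, rfl⟩ := RingQuot.mkAlgHom_surjective ℂ (TLRel d (n - 1)) x
  induction y using FreeAlgebra.induction with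
  | grade0 r =>
    rw [AlgHom.commutes, Algebra.algebraMap_eq_smul_one]
    exact Submodule.smul_mem _ _ (Submodule.subset_span ⟨[], by simp, by simp [P]⟩)
  | grade1 i =>
    apply Submodule.subset_span
    refine ⟨[i + 1], by simp, ?_⟩
    rw [P_single, TLgen_eq d n _ ⟨by omega, by omega⟩]
    simp
  | mul a b ha hb =>
    rw [map_mul]
    have := Submodule.mul_mem_mul ha hb
    rw [Submodule.span_mul_span] at this
    refine Submodule.span_mono ?_ this
    rintro _ ⟨_, ⟨u, hu, rfl⟩, _, ⟨v, hv, rfl⟩, rfl⟩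
    refine ⟨u ++ v, ?_, by simp [P]⟩
    intro b hb
    rcases List.mem_append.1 hb with hb | hb
    · exact hu b hb
    · exact hv b hb
  | add a b ha hb => rw [map_add]; exact Submodule.add_mem _ ha hb

lemma span_NF (d : ℂ) (n : ℕ) :
    Submodule.span ℂ {x : TL d n | ∃ w : List ℕ, NF (n - 1) (n - 1) w ∧
      x = P (TLh d n) w} = ⊤ := by
  rw [eq_top_iff, ← span_words, Submodule.span_le]
  rintro _ ⟨w, hw, rfl⟩
  obtain ⟨c, v, hv, -, he⟩ := main (TLh d n) d (n - 1) (TL_sq d n) (TL_comm d n) (TL_hook d n)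
    w.length (n - 1) le_rfl w hw le_rfl
  rw [he]
  exact Submodule.smul_mem _ _ (Submodule.subset_span ⟨v, hv, rfl⟩)

end TLaux

/-- For `n ≥ 1` and any `d ∈ ℂ`, the Temperley-Lieb algebra `TL_n(d)` is spanned as a
`ℂ`-vector space by the Jones normal-form words
`(h_{i₁}⋯h_{j₁})(h_{i₂}⋯h_{j₂})⋯(h_{i_k}⋯h_{j_k})` with
`1 ≤ i₁ < … < i_k ≤ n−1`, `1 ≤ j₁ < … < j_k ≤ n−1` and `j_t ≤ i_t` for all `t`
(each inner factor being the descending product `h_{i_t} h_{i_t−1} ⋯ h_{j_t}`, and the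
empty product being `1`).  In particular `dim_ℂ TL_n(d)` is at most the `n`-th Catalan
number `C(2n,n)/(n+1)`. -/
theorem stmt4 (n : ℕ) (hn : 1 ≤ n) (d : ℂ) :
    Submodule.span ℂ
      {x : TL d n | ∃ (k : ℕ) (i j : Fin k → ℕ),
        StrictMono i ∧ StrictMono j ∧
        (∀ t, 1 ≤ j t) ∧ (∀ t, i t ≤ n - 1) ∧ (∀ t, j t ≤ i t) ∧
        x = (List.ofFn (fun t : Fin k =>
          ((List.range (i t + 1 - j t)).map (fun s => TLh d n (i t - s))).prod)).prod}
      = ⊤ ∧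
    Module.rank ℂ (TL d n) ≤ (((2 * n).choose n / (n + 1) : ℕ) : Cardinal) := by
  constructor
  · rw [eq_top_iff, ← TLaux.span_NF, Submodule.span_le]
    rintro _ ⟨w, hw, rfl⟩
    obtain ⟨k, i, j, hi, hj, hj1, him, -, hji, he⟩ := hw.toFin (TLh d n)
    exact Submodule.subset_span ⟨k, i, j, hi, hj, hj1, him, hji, he⟩
  · classical
    set s : Finset (TL d n) :=
      ((TLaux.F (n - 1) (n - 1)).map (TLaux.P (TLh d n))).toFinset with hs
    have htop : Submodule.span ℂ (s : Set (TL d n)) = ⊤ := by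
      rw [eq_top_iff, ← TLaux.span_NF]
      apply Submodule.span_mono
      rintro _ ⟨w, hw, rfl⟩
      simp only [hs, List.coe_toFinset, Set.mem_setOf_eq]
      exact List.mem_map_of_mem (TLaux.mem_F hw)
    have hcard : s.card ≤ (2 * n).choose n / (n + 1) := by
      refine (List.toFinset_card_le _).trans ?_
      have := TLaux.F_length_diag (n - 1)
      rw [Nat.sub_add_cancel hn] at this
      rw [List.length_map, this]
    rw [← rank_top, ← htop]
    exact (rank_span_finset_le s).trans (by exact_mod_cast hcard)
end

section
/- For every n ≥ 1 and every d ∈ ℂ, the Temperley-Lieb algebra TL_n(d) is a finite-dimensional ℂ-vector space whose dimension equals the n-th Catalan number C(2n,n)/(n+1). -/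
namespace TLProof

/-- Fixed-point free involutions of `ℤ` (points `x ≥ 0` are top, `x < 0` bottom). -/
def Mat : Type := {f : ℤ → ℤ // (∀ x, f (f x) = x) ∧ ∀ x, f x ≠ x}

/-- Underlying function of the hook operation. -/
def eFun (k : ℤ) (f : ℤ → ℤ) (x : ℤ) : ℤ :=
  if x = k then k + 1 else if x = k + 1 then k
  else if x = f k then f (k + 1) else if x = f (k + 1) then f k else f x

def eMat (k : ℤ) (s : Mat) : Mat :=
  ⟨eFun k s.1, by
    obtain ⟨f, h1, h2⟩ := s
    constructor
    · intro x
      have := h1 x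
      have := h1 k
      have := h1 (k+1)
      simp only [eFun]
      grind
    · intro x
      have := h1 x
      have := h1 k
      have := h1 (k+1)
      have := h2 x
      simp only [eFun]
      grind⟩

noncomputable def coef (d : ℂ) (k : ℤ) (s : Mat) : ℂ := if s.1 k = k + 1 then d else 1

lemma eMat_sq (k : ℤ) (s : Mat) : eMat k (eMat k s) = eMat k s := by
  apply Subtype.ext
  funext x
  simp only [eMat, eFun]
  grind

lemma coef_sq (d : ℂ) (k : ℤ) (s : Mat) : coef d k (eMat k s) = d := by
  simp [coef, eMat, eFun]

lemma eMat_comm (k j : ℤ) (hkj : k + 2 ≤ j) (s : Mat) :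
    eMat k (eMat j s) = eMat j (eMat k s) := by
  obtain ⟨f, h1, h2⟩ := s
  apply Subtype.ext
  funext x
  have a1 := h1 x
  have a2 := h1 k
  have a3 := h1 (k+1)
  have a4 := h1 j
  have a5 := h1 (j+1)
  have b1 := h2 x
  have b2 := h2 k
  have b3 := h2 (k+1)
  have b4 := h2 j
  have b5 := h2 (j+1)
  simp only [eMat, eFun]
  grind (splits := 30)

lemma coef_comm (d : ℂ) (k j : ℤ) (hkj : k + 2 ≤ j) (s : Mat) :
    coef d j s * coef d k (eMat j s) = coef d k s * coef d j (eMat k s) := by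
  obtain ⟨f, h1, h2⟩ := s
  have a2 := h1 k
  have a3 := h1 (k+1)
  have a4 := h1 j
  have a5 := h1 (j+1)
  simp only [coef, eMat, eFun]
  grind

lemma eMat_hook (k j : ℤ) (hkj : k + 1 = j ∨ j + 1 = k) (s : Mat) :
    eMat k (eMat j (eMat k s)) = eMat k s := by
  obtain ⟨f, h1, h2⟩ := s
  apply Subtype.ext
  funext x
  have a1 := h1 x
  have a2 := h1 k
  have a3 := h1 (k+1)
  have a4 := h1 j
  have a5 := h1 (j+1)
  have b1 := h2 x
  have b2 := h2 k
  have b3 := h2 (k+1)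
  have b4 := h2 j
  have b5 := h2 (j+1)
  simp only [eMat, eFun]
  rcases hkj with rfl | rfl
  · grind
  · grind

lemma coef_hook (d : ℂ) (k j : ℤ) (hkj : k + 1 = j ∨ j + 1 = k) (s : Mat) :
    coef d j (eMat k s) * coef d k (eMat j (eMat k s)) = 1 := by
  obtain ⟨f, h1, h2⟩ := s
  have a2 := h1 k
  have a3 := h1 (k+1)
  have b2 := h2 k
  have b3 := h2 (k+1)
  simp only [coef, eMat, eFun]
  rcases hkj with rfl | rfl
  · grind
  · grind

/-- Linear operator of the hook. -/
noncomputable def hop (d : ℂ) (k : ℤ) : Module.End ℂ (Mat →₀ ℂ) :=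
  Finsupp.lift (Mat →₀ ℂ) ℂ Mat (fun s => Finsupp.single (eMat k s) (coef d k s))

lemma hop_single (d : ℂ) (k : ℤ) (s : Mat) (c : ℂ) :
    hop d k (Finsupp.single s c) = Finsupp.single (eMat k s) (c * coef d k s) := by
  simp [hop]

/-- The representation on matchings. -/
noncomputable def rep (d : ℂ) (m : ℕ) :
    RingQuot (TLRel d m) →ₐ[ℂ] Module.End ℂ (Mat →₀ ℂ) :=
  RingQuot.liftAlgHom ℂ ⟨FreeAlgebra.lift ℂ (fun i : Fin m => hop d ((i : ℕ) : ℤ)), by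
    intro x y hxy
    cases hxy with
    | sq i =>
      simp only [map_mul, FreeAlgebra.lift_ι_apply, map_smul]
      refine Finsupp.lhom_ext fun s c => ?_
      simp only [Module.End.mul_apply, hop_single, eMat_sq, coef_sq, LinearMap.smul_apply,
        Finsupp.smul_single, smul_eq_mul]
      rw [mul_comm d]
    | comm i j h =>
      simp only [map_mul, FreeAlgebra.lift_ι_apply]
      refine Finsupp.lhom_ext fun s c => ?_
      simp only [Module.End.mul_apply, hop_single]
      rcases h with h | h
      · rw [eMat_comm _ _ (by exact_mod_cast h), mul_assoc, mul_assoc,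
          coef_comm _ _ _ (by exact_mod_cast h)]
      · rw [← eMat_comm _ _ (by exact_mod_cast h), mul_assoc, mul_assoc,
          ← coef_comm _ _ _ (by exact_mod_cast h)]
    | hook i j h =>
      simp only [map_mul, FreeAlgebra.lift_ι_apply]
      refine Finsupp.lhom_ext fun s c => ?_
      simp only [Module.End.mul_apply, hop_single]
      have h' : ((i : ℕ) : ℤ) + 1 = ((j : ℕ) : ℤ) ∨ ((j : ℕ) : ℤ) + 1 = ((i : ℕ) : ℤ) := by
        exact_mod_cast h
      rw [eMat_hook _ _ h', mul_assoc, mul_assoc, coef_hook _ _ _ h', mul_one]⟩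

lemma rep_gen (d : ℂ) (m : ℕ) (i : Fin m) :
    rep d m (RingQuot.mkAlgHom ℂ (TLRel d m) (FreeAlgebra.ι ℂ i)) = hop d ((i : ℕ) : ℤ) := by
  simp [rep]

end TLProof

namespace TLProof

/-- Normal forms. -/
def NF : ℕ → Finset (List ℕ)
  | 0 => {[]}
  | n + 1 => (NF n).biUnion fun L => (Finset.Icc (L.headD 0) (n + 1)).image (· :: L)

lemma mem_NF_succ (n : ℕ) (L' : List ℕ) : L' ∈ NF (n + 1) ↔
    ∃ L ∈ NF n, ∃ b, L.headD 0 ≤ b ∧ b ≤ n + 1 ∧ L' = b :: L := by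
  simp only [NF, Finset.mem_biUnion, Finset.mem_image, Finset.mem_Icc]
  constructor
  · rintro ⟨L, hL, b, ⟨h1, h2⟩, rfl⟩; exact ⟨L, hL, b, h1, h2, rfl⟩
  · rintro ⟨L, hL, b, h1, h2, rfl⟩; exact ⟨L, hL, b, ⟨h1, h2⟩, rfl⟩

lemma NF_length (n : ℕ) : ∀ L ∈ NF n, L.length = n ∧ L.headD 0 ≤ n := by
  induction n with
  | zero => intro L hL; simp [NF] at hL; simp [hL]
  | succ n ih =>
    intro L hL
    obtain ⟨L, hL', b, h1, h2, rfl⟩ := (mem_NF_succ _ _).1 hL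
    simp [(ih L hL').1, h2]

/-- Ballot numbers. -/
def bal (n : ℕ) : ℕ → ℤ
  | 0 => 1
  | b + 1 => ((n + b + 1).choose (b + 1) : ℤ) - ((n + b + 1).choose b : ℤ)

lemma bal_diag (n : ℕ) : bal n (n + 1) = 0 := by
  simp only [bal]
  rw [show n + n + 1 = 2 * n + 1 by ring, Nat.choose_symm_half]; simp

lemma bal_rec (n b : ℕ) : bal (n + 1) (b + 1) = bal (n + 1) b + bal n (b + 1) := by
  cases b with
  | zero => simp [bal]; ring
  | succ b =>
    simp only [bal]
    have e1 := Nat.choose_succ_succ (n + b + 2) (b + 1)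
    have e2 := Nat.choose_succ_succ (n + b + 2) b
    rw [show n + 1 + (b + 1) + 1 = n + b + 2 + 1 by ring, show n + 1 + b + 1 = n + b + 2 by ring,
      show n + (b + 1) + 1 = n + b + 2 by ring]
    simp only [Nat.succ_eq_add_one] at e1 e2
    rw [e1, e2]; push_cast; ring

lemma bal_sum (n b : ℕ) : ∑ i ∈ Finset.range (b + 1), bal n i = bal (n + 1) b := by
  induction b with
  | zero => simp [bal]
  | succ b ih => rw [Finset.sum_range_succ, ih, bal_rec]

lemma NF_sum (n : ℕ) : ∀ g : ℕ → ℤ, ∑ L ∈ NF n, g (L.headD 0) =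
    ∑ b ∈ Finset.range (n + 1), bal n b * g b := by
  induction n with
  | zero => intro g; simp [NF, bal]
  | succ n ih =>
    intro g
    simp only [NF]
    rw [Finset.sum_biUnion]
    · have : ∀ L ∈ NF n, ∑ x ∈ (Finset.Icc (L.headD 0) (n + 1)).image (· :: L), g (x.headD 0)
          = (fun h => ∑ b ∈ Finset.Icc h (n + 1), g b) (L.headD 0) := by
        intro L _
        rw [Finset.sum_image (by intro a _ b _ h; simpa using h)]
        simp
      rw [Finset.sum_congr rfl this, ih (fun h => ∑ b ∈ Finset.Icc h (n + 1), g b)]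
      have e : ∑ b ∈ Finset.range (n + 1), bal n b * ∑ b ∈ Finset.Icc b (n + 1), g b
          = ∑ b ∈ Finset.range (n + 1 + 1), bal n b * ∑ b ∈ Finset.Icc b (n + 1), g b := by
        rw [Finset.sum_range_succ _ (n + 1), bal_diag]; simp
      rw [e]
      simp only [Finset.mul_sum]
      rw [Finset.sum_comm' (t' := Finset.range (n + 1 + 1)) (s' := fun b => Finset.range (b + 1))]
      · apply Finset.sum_congr rfl
        intro b _
        rw [← Finset.sum_mul, bal_sum]
      · intro x y; simp only [Finset.mem_range, Finset.mem_Icc]; omega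
    · intro L _ L' _ hne
      simp only [Function.onFun]
      rw [Finset.disjoint_left]
      intro x hx hx'
      simp only [Finset.mem_image] at hx hx'
      obtain ⟨a, _, rfl⟩ := hx
      obtain ⟨a', _, h⟩ := hx'
      simp at h
      exact hne h.2.symm

lemma NF_card (n : ℕ) : (NF n).card = (2 * (n + 1)).choose (n + 1) / (n + 1 + 1) := by
  have h := NF_sum n (fun _ => 1)
  simp only [Finset.sum_const, mul_one, bal_sum] at h
  have h2 : bal (n + 1) n = bal (n + 1) (n + 1) := by rw [bal_rec, bal_diag]; simp
  rw [h2] at h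
  simp only [bal, nsmul_eq_mul, mul_one] at h
  rw [show n + 1 + n + 1 = 2 * (n + 1) by ring] at h
  have h3 := Nat.choose_succ_right_eq (2 * (n + 1)) n
  rw [show 2 * (n + 1) - n = n + 2 by omega] at h3
  symm
  apply Nat.div_eq_of_eq_mul_right (by omega)
  zify at h3 ⊢
  rw [h]
  linear_combination -h3

end TLProof

namespace TLProof

section Span

set_option linter.unusedSectionVars false

variable {A : Type*} [Ring A] [Algebra ℂ A]

/-- The product `h k * h (k+1) * ... * h (k+l-1)`. -/
def chain (h : ℕ → A) : ℕ → ℕ → A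
  | _, 0 => 1
  | k, l + 1 => h k * chain h (k + 1) l

lemma chain_add (h : ℕ → A) (l₁ : ℕ) : ∀ k l₂ : ℕ,
    chain h k (l₁ + l₂) = chain h k l₁ * chain h (k + l₁) l₂ := by
  induction l₁ with
  | zero => intro k l₂; simp [chain]
  | succ l ih =>
    intro k l₂
    rw [show l + 1 + l₂ = (l + l₂) + 1 by ring]
    simp only [chain]
    rw [ih, mul_assoc, show k + 1 + l = k + (l + 1) by ring]

/-- The element attached to a normal form. -/
def nfElt (h : ℕ → A) : List ℕ → A
  | [] => 1
  | b :: L => if b = L.headD 0 then nfElt h L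
      else chain h (b - 1) (L.length + 2 - b) * nfElt h L

/-- Temperley-Lieb relations for generators `h 0, ..., h (m-1)`. -/
structure IsTL (d : ℂ) (m : ℕ) (h : ℕ → A) : Prop where
  sq : ∀ i < m, h i * h i = d • h i
  comm : ∀ i j, i < m → j < m → i + 2 ≤ j → h i * h j = h j * h i
  hook : ∀ i, i + 1 < m → h i * h (i + 1) * h i = h i
  hook' : ∀ i, i + 1 < m → h (i + 1) * h i * h (i + 1) = h (i + 1)

/-- The span of the normal forms. -/
def nfSpan (h : ℕ → A) (n : ℕ) : Submodule ℂ A :=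
  Submodule.span ℂ (nfElt h '' (NF n : Set (List ℕ)))

variable {d : ℂ} {m : ℕ} {h : ℕ → A}

lemma comm_chain (H : IsTL d m h) (j : ℕ) (l : ℕ) : ∀ k, j + 2 ≤ k → k + l ≤ m →
    h j * chain h k l = chain h k l * h j := by
  induction l with
  | zero => intro k _ _; simp [chain]
  | succ l ih =>
    intro k hk hm
    simp only [chain]
    rw [← mul_assoc, H.comm j k (by omega) (by omega) hk, mul_assoc, ih (k + 1) (by omega) (by omega),
      mul_assoc]

lemma comm_chain' (H : IsTL d m h) (j : ℕ) (hj : j < m) (l : ℕ) : ∀ k, k + l + 1 ≤ j →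
    h j * chain h k l = chain h k l * h j := by
  induction l with
  | zero => intro k _; simp [chain]
  | succ l ih =>
    intro k hk
    simp only [chain]
    rw [← mul_assoc, ← H.comm k j (by omega) (by omega) (by omega), mul_assoc,
      ih (k + 1) (by omega), mul_assoc]

lemma chain_comm_chain (H : IsTL d m h) (k' l' : ℕ) (hm : k' + l' ≤ m) (l : ℕ) : ∀ k,
    k + l + 1 ≤ k' →
    chain h k l * chain h k' l' = chain h k' l' * chain h k l := by
  induction l with
  | zero => intro k _; simp [chain]
  | succ l ih =>
    intro k hk
    simp only [chain]
    rw [mul_assoc, ih (k + 1) (by omega), ← mul_assoc, comm_chain H k l' k' (by omega) hm, mul_assoc]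

lemma nfElt_head (n : ℕ) : ∀ L ∈ NF n, L.headD 0 ≠ 0 →
    ∃ z, nfElt h L = h (L.headD 0 - 1) * z := by
  induction n with
  | zero => intro L hL; simp [NF] at hL; simp [hL]
  | succ n ih =>
    intro L hL hb
    obtain ⟨L, hL', b, h1, h2, rfl⟩ := (mem_NF_succ _ _).1 hL
    simp only [List.headD_cons] at hb ⊢
    by_cases hbb : b = L.headD 0
    · simp only [nfElt, if_pos hbb]
      rw [hbb]
      exact ih L hL' (by omega)
    · simp only [nfElt, if_neg hbb]
      have := (NF_length n L hL').1
      rw [show L.length + 2 - b = (L.length + 1 - b) + 1 by omega]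
      simp only [chain, mul_assoc]
      exact ⟨_, rfl⟩

lemma chain_mem (n : ℕ) (hP : ∀ j < n, ∀ x ∈ nfSpan h n, h j * x ∈ nfSpan h n) (l : ℕ) :
    ∀ k, k + l ≤ n → ∀ x ∈ nfSpan h n, chain h k l * x ∈ nfSpan h n := by
  induction l with
  | zero => intro k _ x hx; simpa [chain] using hx
  | succ l ih =>
    intro k hk x hx
    simp only [chain, mul_assoc]
    exact hP k (by omega) _ (ih (k + 1) (by omega) x hx)

lemma mem_of_gens (n : ℕ) (S : Submodule ℂ A) (a : A)
    (hg : ∀ L ∈ NF n, a * nfElt h L ∈ S) : ∀ x ∈ nfSpan h n, a * x ∈ S := by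
  intro x hx
  induction hx using Submodule.span_induction with
  | mem x hx => obtain ⟨L, hL, rfl⟩ := hx; exact hg L hL
  | zero => simp
  | add x y _ _ hx hy => rw [mul_add]; exact S.add_mem hx hy
  | smul c x _ hx => rw [mul_smul_comm]; exact S.smul_mem c hx

lemma chain_top_mem (H : IsTL d m h) (n : ℕ) (hn : n < m)
    (hP : ∀ j < n, ∀ x ∈ nfSpan h n, h j * x ∈ nfSpan h n) :
    ∀ l, l ≤ n + 1 → ∀ x ∈ nfSpan h n, chain h (n + 1 - l) l * x ∈ nfSpan h (n + 1) := by
  intro l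
  induction l using Nat.strong_induction_on with
  | _ l ih =>
  intro hl
  apply mem_of_gens
  intro L hL
  obtain ⟨hlen, hhead⟩ := NF_length n L hL
  by_cases hk : L.headD 0 ≤ n + 1 - l
  · apply Submodule.subset_span
    rcases Nat.eq_zero_or_pos l with rfl | hl0
    · refine ⟨L.headD 0 :: L, ?_, ?_⟩
      · exact (mem_NF_succ _ _).2 ⟨L, hL, _, le_rfl, by omega, rfl⟩
      · simp [nfElt, chain]
    · refine ⟨(n + 1 - l + 1) :: L, ?_, ?_⟩
      · exact (mem_NF_succ _ _).2 ⟨L, hL, _, by omega, by omega, rfl⟩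
      · simp only [nfElt]
        rw [if_neg (by omega), hlen, show n + 1 - l + 1 - 1 = n + 1 - l by omega,
          show n + 2 - (n + 1 - l + 1) = l by omega]
  · obtain ⟨a, ha⟩ : ∃ a, L.headD 0 = a + 1 := ⟨L.headD 0 - 1, by omega⟩
    obtain ⟨z, hz⟩ := nfElt_head (h := h) n L hL (by omega)
    rw [ha, Nat.add_sub_cancel] at hz
    set k := n + 1 - l with hkdef
    have e : l = (a - k) + ((n - 1 - a) + 1 + 1) := by omega
    have key : chain h k l * nfElt h L =
        chain h (n + 1 - (n - 1 - a)) (n - 1 - a) * (chain h k (a - k) * nfElt h L) := by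
      rw [e, chain_add, show k + (a - k) = a by omega,
        show n + 1 - (n - 1 - a) = a + 1 + 1 by omega]
      simp only [chain]
      have c1 := comm_chain H a (n - 1 - a) (a + 1 + 1) (by omega) (by omega)
      have c2 := chain_comm_chain H (a + 1 + 1) (n - 1 - a) (by omega) (a - k) k (by omega)
      have c3 := H.hook a (by omega)
      rw [hz]
      set X := chain h (a + 1 + 1) (n - 1 - a)
      set Y := chain h k (a - k)
      calc Y * (h a * (h (a + 1) * X)) * (h a * z)
          = Y * (h a * h (a + 1) * (X * h a) * z) := by noncomm_ring
        _ = Y * ((h a * h (a + 1) * h a) * X * z) := by rw [← c1]; noncomm_ring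
        _ = Y * (h a * X) * z := by rw [c3]; noncomm_ring
        _ = (Y * X) * (h a * z) := by rw [c1]; noncomm_ring
        _ = X * (Y * (h a * z)) := by rw [c2]; noncomm_ring
    rw [key]
    refine ih (n - 1 - a) (by omega) (by omega) _ ?_
    apply chain_mem n hP _ _ (by omega)
    exact Submodule.subset_span ⟨L, hL, rfl⟩

lemma step_mem (H : IsTL d m h) (n : ℕ) (hn : n < m)
    (hP : ∀ j < n, ∀ x ∈ nfSpan h n, h j * x ∈ nfSpan h n)
    (j : ℕ) (hj : j ≤ n) (l : ℕ) (hl : l ≤ n + 1) (x : A) (hx : x ∈ nfSpan h n) :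
    h j * (chain h (n + 1 - l) l * x) ∈ nfSpan h (n + 1) := by
  have Q := chain_top_mem H n hn hP
  rcases lt_trichotomy (j + 1) (n + 1 - l) with hlt | heq | hgt
  · rw [← mul_assoc, comm_chain H j l _ (by omega) (by omega), mul_assoc]
    exact Q l hl _ (hP j (by omega) x hx)
  · rw [← heq, ← mul_assoc]
    have := Q (l + 1) (by omega) x hx
    rw [show n + 1 - (l + 1) = j by omega] at this
    exact this
  · rcases Nat.eq_or_lt_of_le (show n + 1 - l ≤ j by omega) with he | hlt
    · obtain ⟨l, rfl⟩ : ∃ l', l = l' + 1 := ⟨l - 1, by omega⟩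
      have := Q (l + 1) hl x hx
      rw [he] at this ⊢
      simp only [chain] at this ⊢
      rw [← mul_assoc, ← mul_assoc, H.sq j (by omega), smul_mul_assoc, smul_mul_assoc]
      exact Submodule.smul_mem _ _ this
    · set k := n + 1 - l with hkdef
      obtain ⟨i, rfl⟩ : ∃ i, j = i + 1 := ⟨j - 1, by omega⟩
      have e : l = (i - k) + ((n - 1 - i) + 1 + 1) := by omega
      have key : h (i + 1) * (chain h k l * x) =
          chain h (n + 1 - (n - i)) (n - i) * (chain h k (i - k) * x) := by
        have c1 := comm_chain' H (i + 1) (by omega) (i - k) k (by omega)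
        have c2 := chain_comm_chain H (i + 1) (n - i) (by omega) (i - k) k (by omega)
        have c3 := H.hook' i (by omega)
        rw [e, chain_add, show k + (i - k) = i by omega,
          show n + 1 - (n - i) = i + 1 by omega]
        rw [show n - i = (n - 1 - i) + 1 by omega] at c2 ⊢
        simp only [chain] at c2 ⊢
        set X := chain h (i + 1 + 1) (n - 1 - i)
        set Y := chain h k (i - k)
        calc h (i + 1) * (Y * (h i * (h (i + 1) * X)) * x)
            = (h (i + 1) * Y) * (h i * (h (i + 1) * X)) * x := by noncomm_ring
          _ = Y * ((h (i + 1) * h i * h (i + 1)) * X) * x := by rw [c1]; noncomm_ring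
          _ = (Y * (h (i + 1) * X)) * x := by rw [c3]
          _ = h (i + 1) * X * (Y * x) := by rw [c2]; noncomm_ring
      rw [key]
      exact Q _ (by omega) _ (chain_mem n hP _ _ (by omega) x hx)

lemma nfSpan_closed (H : IsTL d m h) (n : ℕ) (hn : n ≤ m) :
    ∀ j < n, ∀ x ∈ nfSpan h n, h j * x ∈ nfSpan h n := by
  induction n with
  | zero => intro j hj; omega
  | succ n ih =>
    intro j hj
    have hP := ih (by omega)
    apply mem_of_gens
    intro L' hL'
    obtain ⟨L, hL, b, h1, h2, rfl⟩ := (mem_NF_succ _ _).1 hL'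
    have hx : nfElt h L ∈ nfSpan h n := Submodule.subset_span ⟨L, hL, rfl⟩
    have hlen := (NF_length n L hL).1
    simp only [nfElt]
    split_ifs with hb
    · have := step_mem H n (by omega) hP j (by omega) 0 (by omega) _ hx
      simpa [chain] using this
    · have := step_mem H n (by omega) hP j (by omega) (n + 2 - b) (by omega) _ hx
      rw [show n + 1 - (n + 2 - b) = b - 1 by omega] at this
      rw [hlen]
      exact this

lemma one_mem_nfSpan (H : IsTL d m h) (n : ℕ) (hn : n ≤ m) : (1 : A) ∈ nfSpan h n := by
  induction n with
  | zero => exact Submodule.subset_span ⟨[], by simp [NF], rfl⟩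
  | succ n ih =>
    have := chain_top_mem H n (by omega) (nfSpan_closed H n (by omega)) 0 (by omega) 1
      (ih (by omega))
    simpa [chain] using this

end Span

/-- Generators indexed by naturals. -/
noncomputable def gen (d : ℂ) (m : ℕ) (i : ℕ) : RingQuot (TLRel d m) :=
  if hi : i < m then RingQuot.mkAlgHom ℂ (TLRel d m) (FreeAlgebra.ι ℂ ⟨i, hi⟩) else 0

lemma gen_isTL (d : ℂ) (m : ℕ) : IsTL d m (gen d m) where
  sq i hi := by
    simp only [gen, dif_pos hi, ← map_mul, ← map_smul]
    exact RingQuot.mkAlgHom_rel ℂ (TLRel.sq _)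
  comm i j hi hj hij := by
    simp only [gen, dif_pos hi, dif_pos hj, ← map_mul]
    exact RingQuot.mkAlgHom_rel ℂ (TLRel.comm _ _ (Or.inl hij))
  hook i hi := by
    simp only [gen, dif_pos hi, dif_pos (show i < m by omega), ← map_mul]
    exact RingQuot.mkAlgHom_rel ℂ (TLRel.hook _ _ (Or.inl rfl))
  hook' i hi := by
    simp only [gen, dif_pos hi, dif_pos (show i < m by omega), ← map_mul]
    exact RingQuot.mkAlgHom_rel ℂ (TLRel.hook _ _ (Or.inr rfl))

lemma nfSpan_top (d : ℂ) (m : ℕ) : nfSpan (gen d m) m = ⊤ := by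
  have H := gen_isTL d m
  rw [eq_top_iff]
  intro x _
  obtain ⟨y, rfl⟩ := RingQuot.mkAlgHom_surjective ℂ (TLRel d m) x
  suffices ∀ z ∈ nfSpan (gen d m) m, RingQuot.mkAlgHom ℂ (TLRel d m) y * z ∈ nfSpan (gen d m) m by
    simpa using this 1 (one_mem_nfSpan H m le_rfl)
  induction y using FreeAlgebra.induction with
  | grade0 r =>
    intro z hz
    rw [AlgHom.commutes, ← Algebra.smul_def]
    exact Submodule.smul_mem _ _ hz
  | grade1 i =>
    intro z hz
    have := nfSpan_closed H m le_rfl i i.2 z hz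
    simpa [gen] using this
  | mul a b ha hb =>
    intro z hz
    rw [map_mul, mul_assoc]
    exact ha trivial _ (hb trivial _ hz)
  | add a b ha hb =>
    intro z hz
    rw [map_add, add_mul]
    exact Submodule.add_mem _ (ha trivial _ hz) (hb trivial _ hz)

end TLProof

namespace TLProof

/-- Iterated hooks. -/
def eChain : ℕ → ℕ → Mat → Mat
  | _, 0, s => s
  | k, l + 1, s => eMat k (eChain (k + 1) l s)

lemma eChain_succ (k l : ℕ) (s : Mat) :
    eChain k (l + 1) s = eMat k (eChain (k + 1) l s) := rfl

/-- The identity diagram. -/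
def idMat : Mat := ⟨fun x => -1 - x, by intro x; ring, by intro x; show -1 - x ≠ x; omega⟩

/-- The diagram of a normal form. -/
def nfMat : List ℕ → Mat
  | [] => idMat
  | b :: L => if b = L.headD 0 then nfMat L
      else eChain (b - 1) (L.length + 2 - b) (nfMat L)

/-- Invariant of the diagrams of normal forms with `n` generators and state `b`. -/
structure Good (n b : ℕ) (s : Mat) : Prop where
  out : ∀ x : ℤ, (n : ℤ) < x → s.1 x = -1 - x
  cup : 0 < b → s.1 ((b : ℤ) - 1) = b
  nocup : ∀ p : ℤ, (b : ℤ) ≤ p → s.1 p ≠ p + 1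

/-- Invariant of the intermediate diagrams. -/
structure Mid (n b : ℕ) (k : ℤ) (s : Mat) : Prop where
  out : ∀ x : ℤ, (n : ℤ) + 1 < x → s.1 x = -1 - x
  cup : s.1 k = k + 1
  hi : ∀ p : ℤ, k < p → s.1 p ≠ p + 1
  lo : ∀ p : ℤ, (b : ℤ) ≤ p → p < k - 1 → s.1 p ≠ p + 1
  mid : (b : ℤ) ≤ k - 1 → s.1 (k - 1) ≠ k + 2
  top : s.1 (n + 1) ≠ -n - 2
  top' : k = n → (b : ℤ) ≤ n - 1 → s.1 (n - 1) ≠ -n - 2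

lemma mid_base (n b : ℕ) (s : Mat) (hb : b ≤ n) (hs : Good n b s) : Mid n b n (eMat n s) := by
  obtain ⟨f, h1, h2⟩ := s
  obtain ⟨g1, g2, g3⟩ := hs
  have a1 := h1 n
  have a2 := h1 (n + 1)
  have a3 := g1 (n + 1) (by omega)
  simp only at *
  have a4 : f n ≠ n + 1 := by intro h; rw [h] at a1; omega
  have a5 : ∀ p : ℤ, b ≤ p → p < n → f p ≠ p + 1 := fun p hp _ => g3 p hp
  refine ⟨?_, ?_, ?_, ?_, ?_, ?_, ?_⟩
  · intro x hx
    have := g1 x (by omega)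
    have := h1 x
    simp only [eMat, eFun]
    grind
  · simp [eMat, eFun]
  · intro p hp
    have b1 := g1 p (by omega)
    have b2 := h1 p
    have b3 := h1 (p + 1)
    have b4 := g1 (p + 1) (by omega)
    simp only [eMat, eFun]
    grind
  · intro p hp hp'
    have b1 := a5 p hp (by omega)
    have b2 := h1 p
    simp only [eMat, eFun]
    grind
  · intro hb'
    have b1 := h1 (n - 1)
    have b2 := g1 (n + 2) (by omega)
    have b3 := h1 (n + 2)
    simp only [eMat, eFun]
    grind
  · simp only [eMat, eFun]
    grind
  · intro _ hb'
    have b1 := h1 (n - 1)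
    have b2 := g3 (n - 1) hb'
    simp only [eMat, eFun]
    grind

lemma mid_step (n b : ℕ) (k : ℤ) (s : Mat) (hk : b ≤ k) (hkn : k + 1 ≤ n) (hs : Mid n b (k + 1) s) :
    Mid n b k (eMat k s) := by
  obtain ⟨f, h1, h2⟩ := s
  obtain ⟨g1, g2, g3, g4, g5, g6, g7⟩ := hs
  have a1 := h1 k
  have a2 := h1 (k + 1)
  have e1 : k + 1 - 1 = k := by ring
  have e2 : k + 1 + 2 = k + 3 := by ring
  simp only [e1, e2] at *
  have a4 : f k ≠ k + 1 := by intro h; rw [h] at a1; omega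
  refine ⟨?_, ?_, ?_, ?_, ?_, ?_, ?_⟩
  · intro x hx
    have := g1 x (by omega)
    have := h1 x
    simp only [eMat, eFun]
    grind
  · simp [eMat, eFun]
  · intro p hp
    have b1 := g3 p
    have b2 := h1 p
    have b3 := h1 (p + 1)
    simp only [eMat, eFun]
    grind
  · intro p hp hp'
    have b1 := g4 p hp (by omega)
    have b2 := h1 p
    simp only [eMat, eFun]
    grind
  · intro hb'
    have b1 := h1 (k - 1)
    have b2 := g4 (k - 1) hb' (by omega)
    simp only [eMat, eFun]
    grind
  · simp only [eMat, eFun]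
    have b1 := h1 (n + 1)
    grind
  · intro hh; omega

lemma mid_chain (n b : ℕ) (s : Mat) (hb : b ≤ n) (hs : Good n b s) (l : ℕ) :
    ∀ k, k + l = n → b ≤ k → Mid n b k (eChain k (l + 1) s) := by
  induction l with
  | zero =>
    intro k hk hbk
    obtain rfl : k = n := by omega
    simpa [eChain] using mid_base k b s hb hs
  | succ l ih =>
    intro k hk hbk
    have := ih (k + 1) (by omega) (by omega)
    rw [eChain]
    apply mid_step
    · omega
    · omega
    · simpa using this

lemma mid_good (n b k : ℕ) (s : Mat) (h : Mid n b k s) : Good (n + 1) (k + 1) s where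
  out x hx := h.out x (by push_cast at hx; omega)
  cup _ := by simpa using h.cup
  nocup p hp := h.hi p (by push_cast at hp; omega)

lemma good_skip (n b : ℕ) (s : Mat) (h : Good n b s) : Good (n + 1) b s where
  out x hx := h.out x (by push_cast at hx; omega)
  cup := h.cup
  nocup := h.nocup

lemma nfMat_good (n : ℕ) : ∀ L ∈ NF n, Good n (L.headD 0) (nfMat L) := by
  induction n with
  | zero =>
    intro L hL
    simp only [NF, Finset.mem_singleton] at hL
    subst hL
    refine ⟨?_, ?_, ?_⟩
    · intro x _; simp [nfMat, idMat]
    · simp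
    · intro p hp
      simp only [nfMat, idMat]
      simp at hp
      omega
  | succ n ih =>
    intro L' hL'
    obtain ⟨L, hL, b, h1, h2, rfl⟩ := (mem_NF_succ _ _).1 hL'
    obtain ⟨hlen, hh⟩ := NF_length n L hL
    simp only [nfMat, List.headD_cons]
    split_ifs with hb
    · rw [hb]; exact good_skip _ _ _ (ih L hL)
    · obtain ⟨k, rfl⟩ : ∃ k, b = k + 1 := ⟨b - 1, by omega⟩
      have := mid_chain n _ _ hh (ih L hL) (n - k) k (by omega) (by omega)
      rw [hlen, show n + 2 - (k + 1) = n - k + 1 by omega]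
      exact mid_good _ _ _ _ this

lemma good_unique (n b b' : ℕ) (s : Mat) (h : Good n b s) (h' : Good n b' s) : b = b' := by
  rcases lt_trichotomy b b' with hlt | heq | hgt
  · exact absurd (h'.cup (by omega)) (by
      have := h.nocup ((b' : ℤ) - 1) (by omega)
      simpa using this)
  · exact heq
  · exact absurd (h.cup (by omega)) (by
      have := h'.nocup ((b : ℤ) - 1) (by omega)
      simpa using this)

lemma eMat_inj (k : ℤ) (s t : Mat) (h : s.1 (k + 1) = t.1 (k + 1)) (he : eMat k s = eMat k t) :
    s = t := by
  have he' : ∀ x, eFun k s.1 x = eFun k t.1 x := fun x => congrFun (congrArg Subtype.val he) x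
  obtain ⟨f, h1, h2⟩ := s
  obtain ⟨g, h3, h4⟩ := t
  apply Subtype.ext
  funext x
  simp only at *
  have e1 := he' x
  have e2 := he' (f (k + 1))
  have a1 := h1 k
  have a2 := h1 (k + 1)
  have a3 := h1 x
  have a4 := h3 k
  have a5 := h3 (k + 1)
  have a6 := h3 x
  have a7 := h2 (k + 1)
  have a8 := h2 k
  have a9 := h4 k
  simp only [eFun] at e1 e2
  grind (splits := 30)

lemma eChain_inj (n b b' : ℕ) (s t : Mat) (hb : b ≤ n) (hb' : b' ≤ n)
    (hs : Good n b s) (ht : Good n b' t) (l : ℕ) :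
    ∀ k, k + l = n → b ≤ k → b' ≤ k → eChain k (l + 1) s = eChain k (l + 1) t → s = t := by
  induction l with
  | zero =>
    intro k hk _ _ he
    obtain rfl : k = n := by omega
    simp only [eChain] at he
    refine eMat_inj _ _ _ ?_ he
    rw [hs.out _ (by omega), ht.out _ (by omega)]
  | succ l ih =>
    intro k hk h1 h2 he
    apply ih (k + 1) (by omega) (by omega) (by omega)
    rw [eChain_succ, eChain_succ] at he
    refine eMat_inj _ _ _ ?_ he
    have c1 := (mid_chain n b s hb hs l (k + 1) (by omega) (by omega)).cup
    have c2 := (mid_chain n b' t hb' ht l (k + 1) (by omega) (by omega)).cup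
    push_cast at c1 c2
    rw [c1, c2]

lemma nfMat_inj (n : ℕ) : ∀ L ∈ NF n, ∀ L' ∈ NF n, nfMat L = nfMat L' → L = L' := by
  induction n with
  | zero => intro L hL L' hL' _; simp [NF] at hL hL'; simp [hL, hL']
  | succ n ih =>
    intro L₁ hL₁ L₂ hL₂ he
    have g1 := nfMat_good _ _ hL₁
    have g2 := nfMat_good _ _ hL₂
    have hbb := good_unique _ _ _ _ g1 (he ▸ g2)
    obtain ⟨L, hL, b, h1, h2, rfl⟩ := (mem_NF_succ _ _).1 hL₁
    obtain ⟨L', hL', b', h1', h2', rfl⟩ := (mem_NF_succ _ _).1 hL₂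
    simp only [List.headD_cons] at hbb
    subst hbb
    obtain ⟨hlen, hh⟩ := NF_length n L hL
    obtain ⟨hlen', hh'⟩ := NF_length n L' hL'
    have k1 := nfMat_good _ _ hL
    have k2 := nfMat_good _ _ hL'
    congr 1
    apply ih L hL L' hL'
    have o1 := k1.out (n + 1) (by omega)
    have o2 := k2.out (n + 1) (by omega)
    simp only [nfMat] at he
    split_ifs at he with c1 c2 c2
    · exact he
    · exfalso
      obtain ⟨k, rfl⟩ : ∃ k, b = k + 1 := ⟨b - 1, by omega⟩
      have := (mid_chain n _ _ hh' k2 (n - k) k (by omega) (by omega)).top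
      rw [hlen', show n + 2 - (k + 1) = n - k + 1 by omega, Nat.add_sub_cancel] at he
      rw [← he, o1] at this
      omega
    · exfalso
      obtain ⟨k, rfl⟩ : ∃ k, b = k + 1 := ⟨b - 1, by omega⟩
      have := (mid_chain n _ _ hh k1 (n - k) k (by omega) (by omega)).top
      rw [hlen, show n + 2 - (k + 1) = n - k + 1 by omega, Nat.add_sub_cancel] at he
      rw [he, o2] at this
      omega
    · obtain ⟨k, rfl⟩ : ∃ k, b = k + 1 := ⟨b - 1, by omega⟩
      rw [hlen, hlen', show n + 2 - (k + 1) = n - k + 1 by omega, Nat.add_sub_cancel] at he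
      exact eChain_inj n _ _ _ _ hh hh' k1 k2 (n - k) k (by omega) (by omega) (by omega) he

lemma rep_gen' (d : ℂ) (m i : ℕ) (hi : i < m) : rep d m (gen d m i) = hop d (i : ℤ) := by
  rw [gen, dif_pos hi, rep_gen]

lemma rep_chain (d : ℂ) (m n b : ℕ) (hn : n < m) (s : Mat) (hb : b ≤ n) (hs : Good n b s) (l : ℕ) :
    ∀ k, k + l = n → b ≤ k → rep d m (chain (gen d m) k (l + 1)) (Finsupp.single s 1) =
      Finsupp.single (eChain k (l + 1) s) 1 := by
  induction l with
  | zero =>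
    intro k hk hbk
    obtain rfl : k = n := by omega
    simp only [chain, mul_one, eChain]
    rw [rep_gen' _ _ _ (by omega), hop_single, coef, if_neg, mul_one]
    intro hc
    have := hs.out (k + 1) (by omega)
    rw [← hc, s.2.1] at this
    omega
  | succ l ih =>
    intro k hk hbk
    rw [chain, map_mul, Module.End.mul_apply, ih (k + 1) (by omega) (by omega),
      rep_gen' _ _ _ (by omega), hop_single, coef, if_neg, mul_one, eChain_succ k (l + 1)]
    intro hc
    have c1 := (mid_chain n b s hb hs l (k + 1) (by omega) (by omega)).cup
    push_cast at c1
    rw [← hc, (eChain (k + 1) (l + 1) s).2.1] at c1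
    omega

lemma rep_nfElt (d : ℂ) (m n : ℕ) (hn : n ≤ m) : ∀ L ∈ NF n,
    rep d m (nfElt (gen d m) L) (Finsupp.single idMat 1) = Finsupp.single (nfMat L) 1 := by
  induction n with
  | zero =>
    intro L hL
    simp only [NF, Finset.mem_singleton] at hL
    subst hL
    simp [nfElt, nfMat]
  | succ n ih =>
    intro L' hL'
    obtain ⟨L, hL, b, h1, h2, rfl⟩ := (mem_NF_succ _ _).1 hL'
    obtain ⟨hlen, hh⟩ := NF_length n L hL
    have IH := ih (by omega) L hL
    simp only [nfElt, nfMat]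
    split_ifs with hb
    · exact IH
    · obtain ⟨k, rfl⟩ : ∃ k, b = k + 1 := ⟨b - 1, by omega⟩
      rw [map_mul, Module.End.mul_apply, IH, hlen, show n + 2 - (k + 1) = n - k + 1 by omega,
        Nat.add_sub_cancel]
      exact rep_chain d m n _ (by omega) _ hh (nfMat_good _ _ hL) (n - k) k (by omega) (by omega)

lemma nfElt_li (d : ℂ) (m : ℕ) :
    LinearIndependent ℂ (fun L : {L // L ∈ NF m} => nfElt (gen d m) L.1) := by
  let F : RingQuot (TLRel d m) →ₗ[ℂ] (Mat →₀ ℂ) :=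
    (LinearMap.applyₗ (Finsupp.single idMat (1 : ℂ))).comp (rep d m).toLinearMap
  apply LinearIndependent.of_comp F
  have : F ∘ (fun L : {L // L ∈ NF m} => nfElt (gen d m) L.1) =
      fun L => Finsupp.single (nfMat L.1) (1 : ℂ) := by
    funext L
    exact rep_nfElt d m m le_rfl L.1 L.2
  rw [this]
  exact (Finsupp.linearIndependent_single_one ℂ Mat).comp (fun L : {L // L ∈ NF m} => nfMat L.1)
    (fun L L' h => Subtype.ext (nfMat_inj m L.1 L.2 L'.1 L'.2 h))

/-- The basis of normal forms. -/
noncomputable def nfBasis (d : ℂ) (m : ℕ) :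
    Module.Basis {L // L ∈ NF m} ℂ (RingQuot (TLRel d m)) :=
  Module.Basis.mk (nfElt_li d m) (by
    rw [← nfSpan_top d m, nfSpan]
    apply Submodule.span_mono
    rintro _ ⟨L, hL, rfl⟩
    exact ⟨⟨L, hL⟩, rfl⟩)

end TLProof

/-- For every `n ≥ 1` and every `d ∈ ℂ`, the Temperley-Lieb algebra `TL_n(d)` is a
finite-dimensional `ℂ`-vector space whose dimension equals the `n`-th Catalan number
`C(2n,n)/(n+1)`. -/
theorem stmt5 (n : ℕ) (hn : 1 ≤ n) (d : ℂ) :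
    Module.Finite ℂ (TL d n) ∧
    Module.finrank ℂ (TL d n) = (2 * n).choose n / (n + 1) := by
  obtain ⟨m, rfl⟩ : ∃ m, n = m + 1 := ⟨n - 1, by omega⟩
  have B := TLProof.nfBasis d m
  refine ⟨Module.Finite.of_basis B, ?_⟩
  have := Module.finrank_eq_card_basis B
  rw [Fintype.card_coe, TLProof.NF_card] at this
  exact this
end

section
/- For every n ≥ 1 and every d ∈ ℂ, the unital ℂ-algebra homomorphism ι_n : TL_n(d) → TL_{n+1}(d) determined by sending each generator h_i (1 ≤ i ≤ n−1) to the generator of the same name is injective. -/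
open scoped TensorProduct

namespace TLaux

/-- Temperley-Lieb algebra by number of generators. -/
abbrev B (d : ℂ) (m : ℕ) : Type := RingQuot (TLRel d m)

/-- Generators. -/
noncomputable def gen (d : ℂ) (m : ℕ) (i : Fin m) : B d m :=
  RingQuot.mkAlgHom ℂ (TLRel d m) (FreeAlgebra.ι ℂ i)

variable {d : ℂ} {m : ℕ}

lemma gen_sq (i : Fin m) : gen d m i * gen d m i = d • gen d m i := by
  have := RingQuot.mkAlgHom_rel ℂ (TLRel.sq (d := d) i)
  simpa [gen] using this

lemma gen_comm (i j : Fin m) (h : (i : ℕ) + 2 ≤ (j : ℕ) ∨ (j : ℕ) + 2 ≤ (i : ℕ)) :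
    gen d m i * gen d m j = gen d m j * gen d m i := by
  have := RingQuot.mkAlgHom_rel ℂ (TLRel.comm (d := d) i j h)
  simpa [gen] using this

lemma gen_hook (i j : Fin m) (h : (i : ℕ) + 1 = (j : ℕ) ∨ (j : ℕ) + 1 = (i : ℕ)) :
    gen d m i * gen d m j * gen d m i = gen d m i := by
  have := RingQuot.mkAlgHom_rel ℂ (TLRel.hook (d := d) i j h)
  simpa [gen] using this

lemma exists_lift {C : Type*} [Ring C] [Algebra ℂ C] (f : Fin m → C)
    (hsq : ∀ i, f i * f i = d • f i)
    (hcomm : ∀ i j : Fin m, (i : ℕ) + 2 ≤ (j : ℕ) → f i * f j = f j * f i)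
    (hhook : ∀ i j : Fin m, (i : ℕ) + 1 = (j : ℕ) →
      f i * f j * f i = f i ∧ f j * f i * f j = f j) :
    ∃ F : B d m →ₐ[ℂ] C, ∀ i, F (gen d m i) = f i := by
  refine ⟨RingQuot.liftAlgHom ℂ ⟨FreeAlgebra.lift ℂ f, ?_⟩, ?_⟩
  · intro x y hxy
    cases hxy with
    | sq i => simpa using hsq i
    | comm i j h =>
      rcases h with h | h
      · simpa using hcomm i j h
      · simpa using (hcomm j i h).symm
    | hook i j h =>
      rcases h with h | h
      · simpa using (hhook i j h).1
      · simpa using (hhook j i h).2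
  · intro i
    simp [gen]

lemma top_of_gen (W : Submodule ℂ (B d m)) (h1 : (1 : B d m) ∈ W)
    (hg : ∀ i, ∀ w ∈ W, gen d m i * w ∈ W) (x : B d m) : x ∈ W := by
  obtain ⟨a, rfl⟩ := RingQuot.mkAlgHom_surjective ℂ (TLRel d m) x
  have key : ∀ w ∈ W, RingQuot.mkAlgHom ℂ (TLRel d m) a * w ∈ W := by
    induction a using FreeAlgebra.induction with
    | grade0 r =>
      intro w hw
      rw [AlgHom.commutes, ← Algebra.smul_def]
      exact W.smul_mem _ hw
    | grade1 i => exact hg i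
    | mul a b ha hb =>
      intro w hw
      rw [map_mul, mul_assoc]
      exact ha _ (hb _ hw)
    | add a b ha hb =>
      intro w hw
      rw [map_add, add_mul]
      exact W.add_mem (ha _ hw) (hb _ hw)
  simpa using key 1 h1

lemma exists_inc (d : ℂ) (m : ℕ) : ∃ F : B d m →ₐ[ℂ] B d (m + 1),
    ∀ i, F (gen d m i) = gen d (m + 1) i.castSucc := by
  apply exists_lift
  · intro i; exact gen_sq _
  · intro i j h; exact gen_comm _ _ (Or.inl (by simpa using h))
  · intro i j h
    exact ⟨gen_hook _ _ (Or.inl (by simpa using h)), gen_hook _ _ (Or.inr (by simpa using h))⟩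

/-- The inclusion map. -/
noncomputable def inc (d : ℂ) (m : ℕ) : B d m →ₐ[ℂ] B d (m + 1) := (exists_inc d m).choose

lemma inc_gen (i : Fin m) : inc d m (gen d m i) = gen d (m + 1) i.castSucc :=
  (exists_inc d m).choose_spec i

/-- Last generator. -/
noncomputable def lst (d : ℂ) (m : ℕ) : B d (m + 1) := gen d (m + 1) (Fin.last m)

lemma lst_sq : lst d m * lst d m = d • lst d m := gen_sq _

lemma lst_hook1 : lst d (m + 1) * inc d (m + 1) (lst d m) * lst d (m + 1) = lst d (m + 1) := by
  unfold lst; rw [inc_gen]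
  exact gen_hook _ _ (Or.inr (by simp))

lemma lst_comm (x : B d m) : lst d (m + 1) * inc d (m + 1) (inc d m x)
    = inc d (m + 1) (inc d m x) * lst d (m + 1) := by
  let W : Submodule ℂ (B d m) :=
    { carrier := {x | lst d (m + 1) * inc d (m + 1) (inc d m x)
        = inc d (m + 1) (inc d m x) * lst d (m + 1)}
      add_mem' := by
        intro a b ha hb
        simp only [Set.mem_ofPred_eq, map_add, mul_add, add_mul] at *
        rw [ha, hb]
      zero_mem' := by simp
      smul_mem' := by
        intro c a ha
        simp only [Set.mem_ofPred_eq, map_smul, mul_smul_comm, smul_mul_assoc] at *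
        rw [ha] }
  refine top_of_gen W ?_ ?_ x
  · change _ = _
    simp
  · intro i w hw
    change _ = _
    have hw' : lst d (m + 1) * inc d (m + 1) (inc d m w)
        = inc d (m + 1) (inc d m w) * lst d (m + 1) := hw
    have hi : lst d (m + 1) * gen d (m + 2) i.castSucc.castSucc
        = gen d (m + 2) i.castSucc.castSucc * lst d (m + 1) :=
      gen_comm _ _ (Or.inr (by simp))
    rw [map_mul, map_mul, inc_gen, inc_gen, ← mul_assoc, hi, mul_assoc, hw', mul_assoc]

/-- `h z h = w h` with `w` commuting with `h`. -/
def F2 (d : ℂ) (m : ℕ) : Prop := ∀ z : B d m, ∃ w : B d m,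
  lst d m * inc d m z * lst d m = inc d m w * lst d m ∧
  lst d m * inc d m w = inc d m w * lst d m

/-- Spanning. -/
def Sp (d : ℂ) (m : ℕ) : Prop := ∀ W : Submodule ℂ (B d (m + 1)),
  (∀ x, inc d m x ∈ W) → (∀ x y, inc d m x * lst d m * inc d m y ∈ W) → ∀ a, a ∈ W

lemma scalar (z : B d 0) : ∃ c : ℂ, z = algebraMap ℂ _ c := by
  have : z ∈ LinearMap.range (Algebra.linearMap ℂ (B d 0)) := by
    apply top_of_gen
    · exact ⟨1, by simp⟩
    · intro i; exact i.elim0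
  obtain ⟨c, hc⟩ := this
  exact ⟨c, by simpa using hc.symm⟩

lemma F2_zero : F2 d 0 := by
  intro z
  obtain ⟨c, rfl⟩ := scalar z
  refine ⟨algebraMap ℂ _ (c * d), ?_, ?_⟩
  · simp only [AlgHom.commutes, ← Algebra.commutes c (lst d 0), ← Algebra.smul_def]
    rw [smul_mul_assoc, lst_sq, smul_smul]
  · simp only [AlgHom.commutes, Algebra.commutes]

lemma Sp_of_F2 (H : F2 d m) : Sp d m := by
  intro W h1 h2 a
  let V : Submodule ℂ (B d (m + 1)) := Submodule.span ℂ
    (Set.range (inc d m) ∪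
      Set.range (fun p : B d m × B d m => inc d m p.1 * lst d m * inc d m p.2))
  have hVW : V ≤ W := by
    apply Submodule.span_le.2
    rintro _ (⟨x, rfl⟩ | ⟨p, rfl⟩)
    · exact h1 x
    · exact h2 _ _
  have hV1 : ∀ x, inc d m x ∈ V := fun x => Submodule.subset_span (Or.inl ⟨x, rfl⟩)
  have hV2 : ∀ x y, inc d m x * lst d m * inc d m y ∈ V :=
    fun x y => Submodule.subset_span (Or.inr ⟨(x, y), rfl⟩)
  apply hVW
  refine top_of_gen V (by simpa using hV1 1) ?_ a
  intro i w hw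
  induction hw using Submodule.span_induction with
  | zero => simp
  | add a b _ _ ha hb => rw [mul_add]; exact V.add_mem ha hb
  | smul c a _ ha => rw [mul_smul_comm]; exact V.smul_mem _ ha
  | mem w hw =>
    induction i using Fin.lastCases with
    | cast i =>
      rw [← inc_gen]
      rcases hw with ⟨x, rfl⟩ | ⟨⟨x, y⟩, rfl⟩
      · rw [← map_mul]; exact hV1 _
      · simp only []
        rw [← mul_assoc, ← mul_assoc, ← map_mul]; exact hV2 _ _
    | last =>
      change lst d m * w ∈ V
      rcases hw with ⟨x, rfl⟩ | ⟨⟨x, y⟩, rfl⟩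
      · simpa using hV2 1 x
      · obtain ⟨w, hw, -⟩ := H x
        simp only []
        rw [← mul_assoc, ← mul_assoc, hw]
        exact hV2 _ _

lemma F2_succ (H : Sp d m) : F2 d (m + 1) := by
  let W : Submodule ℂ (B d (m + 1)) :=
    { carrier := {z | ∃ w : B d (m + 1),
        lst d (m + 1) * inc d (m + 1) z * lst d (m + 1) = inc d (m + 1) w * lst d (m + 1) ∧
        lst d (m + 1) * inc d (m + 1) w = inc d (m + 1) w * lst d (m + 1)}
      add_mem' := by
        rintro a b ⟨w, h1, h2⟩ ⟨w', h1', h2'⟩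
        refine ⟨w + w', ?_, ?_⟩
        · simp only [map_add, mul_add, add_mul, h1, h1']
        · simp only [map_add, mul_add, add_mul, h2, h2']
      zero_mem' := ⟨0, by simp, by simp⟩
      smul_mem' := by
        rintro c a ⟨w, h1, h2⟩
        refine ⟨c • w, ?_, ?_⟩
        · simp only [map_smul, mul_smul_comm, smul_mul_assoc, h1]
        · simp only [map_smul, mul_smul_comm, smul_mul_assoc, h2] }
  refine H W ?_ ?_
  · intro x
    refine ⟨d • inc d m x, ?_, ?_⟩
    · rw [lst_comm, mul_assoc, lst_sq, map_smul, mul_smul_comm, smul_mul_assoc]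
    · rw [map_smul, mul_smul_comm, lst_comm, smul_mul_assoc]
  · intro x y
    refine ⟨inc d m (x * y), ?_, lst_comm _⟩
    simp only [map_mul]
    calc _ = (lst d (m + 1) * inc d (m + 1) (inc d m x)) * inc d (m + 1) (lst d m) *
          (inc d (m + 1) (inc d m y) * lst d (m + 1)) := by simp only [mul_assoc]
      _ = inc d (m + 1) (inc d m x) * (lst d (m + 1) * inc d (m + 1) (lst d m) *
          lst d (m + 1)) * inc d (m + 1) (inc d m y) := by
            rw [lst_comm, ← lst_comm y]; simp only [mul_assoc]
      _ = _ := by rw [lst_hook1, mul_assoc, lst_comm, ← mul_assoc]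

lemma F2_all (d : ℂ) : ∀ m, F2 d m
  | 0 => F2_zero
  | m + 1 => F2_succ (Sp_of_F2 (F2_all d m))

lemma Sp_all (d : ℂ) (m : ℕ) : Sp d m := Sp_of_F2 (F2_all d m)

section Nmod

variable {A : Type} [Ring A] [Algebra ℂ A]

/-- relations -/
def K (S : Set A) (h : A) : Submodule ℂ (A × (A ⊗[ℂ] A)) := Submodule.span ℂ
  ({p | ∃ x y z, z ∈ S ∧ p = (0, (x * z) ⊗ₜ y - x ⊗ₜ (z * y))} ∪
   {p | ∃ b a, p = (b * h * a, -((b * h) ⊗ₜ (h * a)))})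

/-- the module -/
abbrev N (S : Set A) (h : A) : Type := (A × (A ⊗[ℂ] A)) ⧸ K S h

/-- first part -/
def u (S : Set A) (h : A) : A →ₗ[ℂ] N S h := (K S h).mkQ ∘ₗ LinearMap.inl ℂ _ _

/-- second part -/
def v (S : Set A) (h : A) (x y : A) : N S h := (K S h).mkQ (0, x ⊗ₜ y)

variable {S : Set A} {h : A}

lemma v_bal (x y z : A) (hz : z ∈ S) : v S h (x * z) y = v S h x (z * y) := by
  unfold v
  rw [← sub_eq_zero, ← map_sub, Submodule.mkQ_apply, Submodule.Quotient.mk_eq_zero]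
  exact Submodule.subset_span (Or.inl ⟨x, y, z, hz, by simp⟩)

lemma u_rel (b a : A) : u S h (b * h * a) = v S h (b * h) (h * a) := by
  unfold u v
  rw [← sub_eq_zero, LinearMap.comp_apply, ← map_sub, Submodule.mkQ_apply,
    Submodule.Quotient.mk_eq_zero]
  exact Submodule.subset_span (Or.inr ⟨b, a, by simp⟩)

lemma v_smul (c : ℂ) (x y : A) : v S h (c • x) y = c • v S h x y := by
  unfold v
  rw [← map_smul, Prod.smul_mk, smul_zero, TensorProduct.smul_tmul']

lemma N_ext {P : Type*} [AddCommGroup P] [Module ℂ P] (F G : N S h →ₗ[ℂ] P)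
    (h1 : ∀ a, F (u S h a) = G (u S h a)) (h2 : ∀ x y, F (v S h x y) = G (v S h x y)) :
    F = G := by
  apply Submodule.linearMap_qext
  apply LinearMap.prod_ext
  · ext a; exact h1 a
  · apply TensorProduct.ext'
    intro x y; exact h2 x y

lemma N_lift {P : Type*} [AddCommGroup P] [Module ℂ P] (f : A →ₗ[ℂ] P) (g : A ⊗[ℂ] A →ₗ[ℂ] P)
    (h1 : ∀ x y z, z ∈ S → g ((x * z) ⊗ₜ y) = g (x ⊗ₜ (z * y)))
    (h2 : ∀ b a, f (b * h * a) = g ((b * h) ⊗ₜ (h * a))) :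
    ∃ F : N S h →ₗ[ℂ] P, (∀ a, F (u S h a) = f a) ∧ ∀ x y, F (v S h x y) = g (x ⊗ₜ y) := by
  refine ⟨(K S h).liftQ (f.coprod g) ?_, ?_, ?_⟩
  · apply Submodule.span_le.2
    rintro _ (⟨x, y, z, hz, rfl⟩ | ⟨b, a, rfl⟩)
    · simp [h1 x y z hz]
    · simp [h2 b a]
  · intro a; change f a + g 0 = f a; simp
  · intro x y; change f 0 + g (x ⊗ₜ y) = _; simp

/-- tensor form of `v` -/
lemma exists_vT (S : Set A) (h : A) : ∃ V : A ⊗[ℂ] A →ₗ[ℂ] N S h, ∀ x y, V (x ⊗ₜ y) = v S h x y :=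
  ⟨(K S h).mkQ ∘ₗ LinearMap.inr ℂ _ _, fun _ _ => rfl⟩

lemma exists_L (S : Set A) (h c : A) : ∃ F : Module.End ℂ (N S h),
    (∀ a, F (u S h a) = u S h (c * a)) ∧ ∀ x y, F (v S h x y) = v S h (c * x) y := by
  obtain ⟨V, hV⟩ := exists_vT S h
  obtain ⟨F, h1, h2⟩ := N_lift (S := S) (h := h) (u S h ∘ₗ LinearMap.mulLeft ℂ c)
    (V ∘ₗ TensorProduct.map (LinearMap.mulLeft ℂ c) LinearMap.id)
    (by
      intro x y z hz
      simp only [LinearMap.comp_apply, TensorProduct.map_tmul, LinearMap.mulLeft_apply, hV,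
        LinearMap.id_apply]
      rw [← mul_assoc, v_bal _ _ _ hz])
    (by
      intro b a
      simp only [LinearMap.comp_apply, TensorProduct.map_tmul, LinearMap.mulLeft_apply, hV,
        LinearMap.id_apply]
      rw [← mul_assoc, ← mul_assoc, u_rel])
  exact ⟨F, fun a => by rw [h1]; simp, fun x y => by rw [h2]; simp [hV]⟩

lemma exists_T (E : A →ₗ[ℂ] A) (hES : ∀ a, E a ∈ S) (hEr : ∀ a, ∀ z ∈ S, E (a * z) = E a * z)
    (hEh : ∀ b, E (b * h) * h = b * h) : ∃ F : Module.End ℂ (N S h),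
    (∀ a, F (u S h a) = v S h 1 a) ∧ ∀ x y, F (v S h x y) = v S h (E x) y := by
  obtain ⟨V, hV⟩ := exists_vT S h
  obtain ⟨F, h1, h2⟩ := N_lift (S := S) (h := h) (V ∘ₗ TensorProduct.mk ℂ A A 1)
    (V ∘ₗ TensorProduct.map E LinearMap.id)
    (by
      intro x y z hz
      simp only [LinearMap.comp_apply, TensorProduct.map_tmul, hV, LinearMap.id_apply]
      rw [hEr _ _ hz, v_bal _ _ _ hz])
    (by
      intro b a
      simp only [LinearMap.comp_apply, TensorProduct.map_tmul, hV, LinearMap.id_apply,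
        TensorProduct.mk_apply]
      rw [← one_mul (E (b * h)), v_bal _ _ _ (hES _), ← mul_assoc, hEh])
  exact ⟨F, fun a => by rw [h1]; simp [hV], fun x y => by rw [h2]; simp [hV]⟩

lemma exists_E (hsq : h * h = d • h) : ∃ F : N S h →ₗ[ℂ] A,
    (∀ a, F (u S h a) = d • a) ∧ ∀ x y, F (v S h x y) = x * y := by
  obtain ⟨F, h1, h2⟩ := N_lift (S := S) (h := h) (d • (LinearMap.id : A →ₗ[ℂ] A))
    (LinearMap.mul' ℂ A)
    (by intro x y z hz; simp [mul_assoc])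
    (by
      intro b a
      simp only [LinearMap.smul_apply, LinearMap.id_apply, LinearMap.mul'_apply]
      rw [mul_assoc b h (h * a), ← mul_assoc h h a, hsq]
      simp [mul_assoc])
  exact ⟨F, fun a => by rw [h1]; simp, fun x y => by rw [h2]; simp⟩

end Nmod

/-- Existence of the conditional expectation. -/
def CE (d : ℂ) (m : ℕ) : Prop := ∃ E : B d (m + 1) →ₗ[ℂ] B d m,
  (∀ x, E (inc d m x) = d • x) ∧ ∀ x y, E (inc d m x * lst d m * inc d m y) = x * y

lemma CE_zero : CE d 0 := by
  obtain ⟨F, hF⟩ := exists_lift (d := d) (m := 1) (C := Matrix (Fin 2) (Fin 2) ℂ)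
    (fun _ => !![0, 0; 1, d])
    (by intro i; ext a b; fin_cases a <;> fin_cases b <;> simp [Matrix.mul_apply, Fin.sum_univ_two])
    (by intro i j; omega) (by intro i j; omega)
  refine ⟨Algebra.linearMap ℂ (B d 0) ∘ₗ (d • Matrix.entryLinearMap ℂ ℂ 0 0 +
    Matrix.entryLinearMap ℂ ℂ 1 0) ∘ₗ F.toLinearMap, ?_, ?_⟩
  · intro x
    obtain ⟨c, rfl⟩ := scalar x
    simp [Matrix.algebraMap_matrix_apply, Algebra.smul_def]
  · intro x y
    obtain ⟨c, rfl⟩ := scalar x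
    obtain ⟨c', rfl⟩ := scalar y
    have : inc d 0 (algebraMap ℂ _ c) * lst d 0 * inc d 0 (algebraMap ℂ _ c')
        = (c * c') • lst d 0 := by
      simp only [AlgHom.commutes]
      rw [← Algebra.commutes c', ← Algebra.smul_def, ← Algebra.smul_def, smul_smul, mul_comm]
    rw [this]
    have h2 : F (lst d 0) = !![0, 0; 1, d] := hF _
    simp [h2]
    rw [← map_mul, Algebra.algebraMap_eq_smul_one]

lemma CE_succ (H : CE d m) : CE d (m + 1) := by
  obtain ⟨E0, hE1, hE2⟩ := H
  set h := lst d m with hh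
  set i := inc d m with hi
  -- bilinearity
  have hEl : ∀ x a, E0 (i x * a) = x * E0 a := by
    intro x
    refine Sp_all d m (LinearMap.eqLocus (E0 ∘ₗ LinearMap.mulLeft ℂ (i x))
      (LinearMap.mulLeft ℂ x ∘ₗ E0)) ?_ ?_
    · intro y
      change E0 (i x * i y) = x * E0 (i y)
      rw [← map_mul, hE1, hE1, mul_smul_comm]
    · intro y z
      change E0 (i x * (i y * h * i z)) = x * E0 (i y * h * i z)
      rw [← mul_assoc, ← mul_assoc, ← map_mul, hE2, hE2, mul_assoc]
  have hEr : ∀ x a, E0 (a * i x) = E0 a * x := by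
    intro x
    refine Sp_all d m (LinearMap.eqLocus (E0 ∘ₗ LinearMap.mulRight ℂ (i x))
      (LinearMap.mulRight ℂ x ∘ₗ E0)) ?_ ?_
    · intro y
      change E0 (i y * i x) = E0 (i y) * x
      rw [← map_mul, hE1, hE1, smul_mul_assoc]
    · intro y z
      change E0 (i y * h * i z * i x) = E0 (i y * h * i z) * x
      rw [mul_assoc, ← map_mul, hE2, hE2, mul_assoc]
  have hEhx : ∀ x, E0 (h * i x) = x := by intro x; simpa using hE2 1 x
  have hExh : ∀ x, E0 (i x * h) = x := by intro x; simpa using hE2 x 1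
  have hF3 : ∀ a, h * i (E0 (h * a)) = h * a := by
    refine Sp_all d m (LinearMap.eqLocus
      (LinearMap.mulLeft ℂ h ∘ₗ i.toLinearMap ∘ₗ E0 ∘ₗ LinearMap.mulLeft ℂ h)
      (LinearMap.mulLeft ℂ h)) ?_ ?_
    · intro y
      change h * i (E0 (h * i y)) = h * i y
      rw [hEhx]
    · intro y z
      change h * i (E0 (h * (i y * h * i z))) = h * (i y * h * i z)
      obtain ⟨w, hw1, hw2⟩ := F2_all d m y
      rw [← mul_assoc, ← mul_assoc, hw1, ← hw2, mul_assoc h, ← map_mul, hEhx]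
  have hF3' : ∀ a, i (E0 (a * h)) * h = a * h := by
    refine Sp_all d m (LinearMap.eqLocus
      (LinearMap.mulRight ℂ h ∘ₗ i.toLinearMap ∘ₗ E0 ∘ₗ LinearMap.mulRight ℂ h)
      (LinearMap.mulRight ℂ h)) ?_ ?_
    · intro y
      change i (E0 (i y * h)) * h = i y * h
      rw [hExh]
    · intro y z
      change i (E0 (i y * h * i z * h)) * h = i y * h * i z * h
      obtain ⟨w, hw1, hw2⟩ := F2_all d m z
      rw [mul_assoc, mul_assoc, ← mul_assoc h, hw1, ← mul_assoc, ← map_mul, hExh]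
  let S : Set (B d (m + 1)) := Set.range i
  let E : B d (m + 1) →ₗ[ℂ] B d (m + 1) := i.toLinearMap ∘ₗ E0
  have hEd : ∀ a, E a = i (E0 a) := fun _ => rfl
  obtain ⟨T, hT1, hT2⟩ := exists_T (S := S) (h := h) E (fun a => ⟨E0 a, rfl⟩)
    (by rintro a _ ⟨z, rfl⟩; rw [hEd, hEd, hEr, map_mul]) hF3'
  choose L hL1 hL2 using exists_L S h
  obtain ⟨G, hG1, hG2⟩ := exists_E (S := S) (h := h) (d := d) lst_sq
  have hLmul : ∀ a b, L (a * b) = L a * L b := by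
    intro a b
    apply N_ext
    · intro x; simp only [Module.End.mul_apply, hL1, mul_assoc]
    · intro x y; simp only [Module.End.mul_apply, hL2, mul_assoc]
  have hLsmul : ∀ (c : ℂ) a, L (c • a) = c • L a := by
    intro c a
    apply N_ext
    · intro x; simp only [LinearMap.smul_apply, hL1, smul_mul_assoc, map_smul]
    · intro x y; simp only [LinearMap.smul_apply, hL2, smul_mul_assoc, v_smul]
  -- relations
  have hE_1 : E 1 = d • 1 := by
    rw [hEd, ← map_one i, hE1, map_smul]
  have hE_E : ∀ a, E (E a) = d • E a := by
    intro a; rw [hEd, hEd, hE1, map_smul]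
  have rTT : T * T = d • T := by
    apply N_ext
    · intro x; simp only [Module.End.mul_apply, LinearMap.smul_apply, hT1, hT2, hE_1, v_smul]
    · intro x y; simp only [Module.End.mul_apply, LinearMap.smul_apply, hT2, hE_E, v_smul]
  have rTL : ∀ z, L (i z) * T = T * L (i z) := by
    intro z
    apply N_ext
    · intro x
      simp only [Module.End.mul_apply, hT1, hL1, hL2]
      rw [mul_one, ← v_bal (S := S) _ _ (i z) (Set.mem_range_self z), one_mul]
    · intro x y
      simp only [Module.End.mul_apply, hT2, hL2, hEd, hEl, map_mul]
  have rTLT : T * L h * T = T := by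
    apply N_ext
    · intro x
      simp only [Module.End.mul_apply, hT1, hT2, hL2, mul_one]
      rw [hEd, ← one_mul h, ← map_one i, hExh]
    · intro x y
      simp only [Module.End.mul_apply, hT2, hL2]
      rw [hEd, hEd, hEhx]
  have rLTL : L h * T * L h = L h := by
    apply N_ext
    · intro x
      simp only [Module.End.mul_apply, hT1, hL1, hL2, mul_one]
      have := u_rel (S := S) (h := h) 1 x
      rw [one_mul] at this
      exact this.symm
    · intro x y
      simp only [Module.End.mul_apply, hT2, hL2]
      rw [hEd, hF3]
  obtain ⟨ρ, hρ⟩ := exists_lift (d := d) (m := m + 2) (C := Module.End ℂ (N S h))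
    (fun j => Fin.lastCases (motive := fun _ => Module.End ℂ (N S h)) T
      (fun j => L (gen d (m + 1) j)) j)
    (by
      intro j
      induction j using Fin.lastCases with
      | last => simpa using rTT
      | cast j => simp only [Fin.lastCases_castSucc]; rw [← hLmul, gen_sq, hLsmul])
    (by
      intro j k hjk
      induction j using Fin.lastCases with
      | last => have := k.2; simp at hjk; omega
      | cast j =>
        induction k using Fin.lastCases with
        | last =>
          simp only [Fin.lastCases_castSucc, Fin.lastCases_last]
          simp at hjk
          have hj : j = (⟨j, by omega⟩ : Fin m).castSucc := rfl
          rw [hj, ← inc_gen]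
          exact rTL _
        | cast k =>
          simp only [Fin.lastCases_castSucc]
          rw [← hLmul, ← hLmul, gen_comm _ _ (Or.inl (by simpa using hjk))])
    (by
      intro j k hjk
      induction j using Fin.lastCases with
      | last => have := k.2; simp at hjk; omega
      | cast j =>
        induction k using Fin.lastCases with
        | last =>
          simp only [Fin.lastCases_castSucc, Fin.lastCases_last]
          simp at hjk
          have hj : j = Fin.last m := by ext; simpa using hjk
          subst hj
          exact ⟨rLTL, rTLT⟩
        | cast k =>
          simp only [Fin.lastCases_castSucc]
          rw [← hLmul, ← hLmul, ← hLmul, ← hLmul, gen_hook _ _ (Or.inl (by simpa using hjk)),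
            gen_hook _ _ (Or.inr (by simpa using hjk))]
          exact ⟨rfl, rfl⟩)
  have hρT : ρ (lst d (m + 1)) = T := by
    unfold lst; rw [hρ]; simp
  have hρL : ∀ a, ρ (inc d (m + 1) a) = L a := by
    let LL : B d (m + 1) →ₗ[ℂ] Module.End ℂ (N S h) :=
      { toFun := L
        map_add' := by
          intro a b
          apply N_ext
          · intro x; simp only [LinearMap.add_apply, hL1, add_mul, map_add]
          · intro x y
            simp only [LinearMap.add_apply, hL2, add_mul]
            obtain ⟨V, hV⟩ := exists_vT S h
            simp only [← hV, TensorProduct.add_tmul, map_add]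
        map_smul' := hLsmul }
    refine top_of_gen (LinearMap.eqLocus (ρ.toLinearMap ∘ₗ (inc d (m + 1)).toLinearMap) LL) ?_ ?_
    · change ρ (inc d (m + 1) 1) = L 1
      rw [map_one, map_one]
      apply N_ext
      · intro x; simp [hL1]
      · intro x y; simp [hL2]
    · intro j w hw
      have hw' : ρ (inc d (m + 1) w) = L w := hw
      change ρ (inc d (m + 1) (gen d (m + 1) j * w)) = L (gen d (m + 1) j * w)
      rw [map_mul, map_mul, hw', hLmul, inc_gen, hρ, Fin.lastCases_castSucc]
  refine ⟨G ∘ₗ LinearMap.applyₗ (u S h 1) ∘ₗ ρ.toLinearMap, ?_, ?_⟩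
  · intro x
    change G (ρ (inc d (m + 1) x) (u S h 1)) = _
    rw [hρL, hL1, hG1, mul_one]
  · intro x y
    change G (ρ (inc d (m + 1) x * lst d (m + 1) * inc d (m + 1) y) (u S h 1)) = _
    rw [map_mul, map_mul, hρL, hρL, hρT, Module.End.mul_apply, Module.End.mul_apply, hL1, hT1,
      hL2, hG2, mul_one, mul_one]

lemma CE_all (d : ℂ) : ∀ m, CE d m
  | 0 => CE_zero
  | m + 1 => CE_succ (CE_all d m)

lemma inc_injective (d : ℂ) (m : ℕ) : Function.Injective (inc d m) := by
  obtain ⟨E, -, hE⟩ := CE_all d m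
  intro x y hxy
  have h1 := hE x 1
  have h2 := hE y 1
  rw [hxy, h2] at h1
  simpa using h1.symm

end TLaux

/-- For every `n ≥ 1` and every `d ∈ ℂ`, the unital `ℂ`-algebra homomorphism
`ι_n : TL_n(d) → TL_{n+1}(d)` determined by sending each generator `h_i`
(`1 ≤ i ≤ n−1`) to the generator of the same name is injective. -/
theorem stmt6 (n : ℕ) (hn : 1 ≤ n) (d : ℂ)
    (φ : TL d n →ₐ[ℂ] TL d (n + 1))
    (hφ : ∀ i : Fin (n - 1),
      φ (TLgen d n i) = TLgen d (n + 1) (Fin.castLE (by omega) i)) :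
    Function.Injective φ := by
  obtain ⟨m, rfl⟩ : ∃ m, n = m + 1 := ⟨n - 1, by omega⟩
  have key : ∀ x : TLaux.B d m, (φ x : TLaux.B d (m + 1)) = TLaux.inc d m x := by
    let φ' : TLaux.B d m →ₐ[ℂ] TLaux.B d (m + 1) := φ
    have hφ' : ∀ i, φ' (TLaux.gen d m i) = TLaux.gen d (m + 1) i.castSucc := fun i => hφ i
    refine TLaux.top_of_gen (LinearMap.eqLocus φ'.toLinearMap (TLaux.inc d m).toLinearMap) ?_ ?_
    · change φ' 1 = TLaux.inc d m 1
      rw [map_one, map_one]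
    · intro j w hw
      have hw' : φ' w = TLaux.inc d m w := hw
      change φ' _ = TLaux.inc d m _
      rw [map_mul, map_mul, hw', hφ', TLaux.inc_gen]
  intro x y hxy
  apply TLaux.inc_injective d m
  rw [← key, ← key]
  exact hxy
end

section
/- For every d ∈ ℂ there exists a unique family of ℂ-linear functionals Tr_n : TL_n(d) → ℂ (n ≥ 1) such that: (i) Tr_1(1) = d; (ii) Tr_{n+1}(ι_n(x)) = d·Tr_n(x) for all x ∈ TL_n(d); and (iii) Tr_{n+1}(ι_n(x)·h_n·ι_n(y)) = Tr_n(x·y) for all x, y ∈ TL_n(d), where ι_n : TL_n(d) → TL_{n+1}(d) is the algebra map sending h_i to h_i. Moreover each Tr_n is tracial: Tr_n(ab) = Tr_n(ba) for all a, b ∈ TL_n(d). -/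
section TLproof

/-- inclusion of the generator indices -/
def TLinc (n : ℕ) (i : Fin ((n + 1) - 1)) : Fin ((n + 2) - 1) :=
  ⟨i, lt_trans i.2 (Nat.lt_succ_self n)⟩

lemma TL_subalg_top (d : ℂ) (n : ℕ) (S : Subalgebra ℂ (TL d n))
    (h : ∀ i, TLgen d n i ∈ S) (x : TL d n) : x ∈ S := by
  obtain ⟨y, rfl⟩ := RingQuot.mkAlgHom_surjective ℂ (TLRel d (n - 1)) x
  induction y using FreeAlgebra.induction with
  | grade0 r => rw [AlgHom.commutes]; exact S.algebraMap_mem r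
  | grade1 i => exact h i
  | mul a b ha hb => rw [map_mul]; exact S.mul_mem ha hb
  | add a b ha hb => rw [map_add]; exact S.add_mem ha hb

lemma TL_hom_ext (d : ℂ) (n : ℕ) {A : Type*} [Ring A] [Algebra ℂ A] (f g : TL d n →ₐ[ℂ] A)
    (h : ∀ i, f (TLgen d n i) = g (TLgen d n i)) (x : TL d n) : f x = g x :=
  TL_subalg_top d n (AlgHom.equalizer f g) h x

lemma TLgen_sq (d : ℂ) (n : ℕ) (i : Fin (n - 1)) :
    TLgen d n i * TLgen d n i = d • TLgen d n i := by
  have := RingQuot.mkAlgHom_rel ℂ (TLRel.sq (d := d) i)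
  simpa [TLgen] using this

lemma TLgen_comm (d : ℂ) (n : ℕ) (i j : Fin (n - 1))
    (h : (i : ℕ) + 2 ≤ (j : ℕ) ∨ (j : ℕ) + 2 ≤ (i : ℕ)) :
    TLgen d n i * TLgen d n j = TLgen d n j * TLgen d n i := by
  have := RingQuot.mkAlgHom_rel ℂ (TLRel.comm (d := d) i j h)
  simpa [TLgen] using this

lemma TLgen_hook (d : ℂ) (n : ℕ) (i j : Fin (n - 1))
    (h : (i : ℕ) + 1 = (j : ℕ) ∨ (j : ℕ) + 1 = (i : ℕ)) :
    TLgen d n i * TLgen d n j * TLgen d n i = TLgen d n i := by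
  have := RingQuot.mkAlgHom_rel ℂ (TLRel.hook (d := d) i j h)
  simpa [TLgen] using this

lemma TLh_last (d : ℂ) (n : ℕ) :
    TLh d (n + 2) (n + 1) = TLgen d (n + 2) (Fin.last n) := by
  unfold TLh
  rw [dif_pos (by omega)]
  rfl

/-- states -/
def TLV : ℕ → Type
  | 0 => Unit
  | n + 1 => TLV n × Bool

instance TLV.fintype : ∀ n, Fintype (TLV n)
  | 0 => inferInstanceAs (Fintype Unit)
  | n + 1 => letI := TLV.fintype n; inferInstanceAs (Fintype (TLV n × Bool))

instance TLV.deceq : ∀ n, DecidableEq (TLV n)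
  | 0 => inferInstanceAs (DecidableEq Unit)
  | n + 1 => letI := TLV.deceq n; inferInstanceAs (DecidableEq (TLV n × Bool))

/-- cup vector -/
noncomputable def TLu (s : ℂ) : Bool → Bool → ℂ
  | false, true => s
  | true, false => s⁻¹
  | _, _ => 0

/-- weights -/
noncomputable def TLk (s : ℂ) : Bool → ℂ
  | false => s * s
  | true => s⁻¹ * s⁻¹

/-- the last generator -/
noncomputable def TLlast {X : Type} [DecidableEq X] (s : ℂ) :
    Matrix ((X × Bool) × Bool) ((X × Bool) × Bool) ℂ :=
  Matrix.of fun p q => if p.1.1 = q.1.1 then TLu s p.1.2 p.2 * TLu s q.1.2 q.2 else 0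

/-- tensoring with the identity -/
noncomputable def TLten {X : Type} [Fintype X] [DecidableEq X] :
    Matrix X X ℂ →ₐ[ℂ] Matrix (X × Bool) (X × Bool) ℂ where
  toFun A := Matrix.of fun p q => if p.2 = q.2 then A p.1 q.1 else 0
  map_one' := by
    ext ⟨a, b⟩ ⟨c, e⟩
    simp only [Matrix.of_apply, Matrix.one_apply, Prod.mk.injEq]
    by_cases h : a = c <;> by_cases h' : b = e <;> simp [h, h']
  map_mul' A B := by
    ext ⟨a, b⟩ ⟨c, e⟩
    simp only [Matrix.of_apply, Matrix.mul_apply, Fintype.sum_prod_type, Fintype.sum_bool]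
    cases b <;> cases e <;> simp
  map_zero' := by ext; simp
  map_add' A B := by
    ext ⟨a, b⟩ ⟨c, e⟩
    simp only [Matrix.of_apply, Matrix.add_apply]
    split_ifs <;> simp
  commutes' r := by
    ext ⟨a, b⟩ ⟨c, e⟩
    simp only [Matrix.of_apply, Matrix.algebraMap_matrix_apply, Prod.mk.injEq]
    by_cases h : a = c <;> by_cases h' : b = e <;> simp [h, h']

lemma TLten_apply {X : Type} [Fintype X] [DecidableEq X] (A : Matrix X X ℂ) (a c : X) (b e : Bool) :
    TLten A (a, b) (c, e) = if b = e then A a c else 0 := rfl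

lemma TLlast_apply {X : Type} [DecidableEq X] (s : ℂ) (x y : X) (a b c e : Bool) :
    TLlast s ((x, a), b) ((y, c), e) = if x = y then TLu s a b * TLu s c e else 0 := rfl

section
variable {X : Type} [Fintype X] [DecidableEq X] (s : ℂ)

lemma TLlast_sq {d : ℂ} (hd : s * s + s⁻¹ * s⁻¹ = d) :
    TLlast (X := X) s * TLlast s = d • TLlast s := by
  subst hd
  ext ⟨⟨x, a⟩, b⟩ ⟨⟨y, c⟩, e⟩
  simp only [Matrix.mul_apply, Fintype.sum_prod_type, Fintype.sum_bool, TLlast_apply,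
    Matrix.smul_apply, smul_eq_mul]
  simp only [TLu, mul_zero, zero_mul, ite_self, zero_add, add_zero, ite_mul, mul_ite,
    Finset.sum_add_distrib, Finset.sum_ite_eq, Finset.sum_ite_eq', Finset.mem_univ, if_true]
  split_ifs <;> ring

lemma TLlast_comm (A : Matrix X X ℂ) :
    TLlast s * TLten (TLten A) = TLten (TLten A) * TLlast s := by
  ext ⟨⟨x, a⟩, b⟩ ⟨⟨y, c⟩, e⟩
  simp only [Matrix.mul_apply, Fintype.sum_prod_type, Fintype.sum_bool, TLlast_apply, TLten_apply]
  simp only [ite_mul, mul_ite, zero_mul, mul_zero, Finset.sum_add_distrib]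
  cases a <;> cases b <;> cases c <;> cases e <;> simp [TLu, mul_comm]

lemma TLlast_hook1 (hs : s ≠ 0) :
    TLlast (X := X × Bool) s * TLten (TLlast s) * TLlast s = TLlast s := by
  ext ⟨⟨⟨x, a⟩, b⟩, c⟩ ⟨⟨⟨y, a'⟩, b'⟩, c'⟩
  simp only [Matrix.mul_apply, Fintype.sum_prod_type, Fintype.sum_bool, TLlast_apply, TLten_apply]
  cases a <;> cases b <;> cases c <;> cases a' <;> cases b' <;> cases c' <;>
    simp [TLu, hs, ite_mul, mul_ite] <;>
    (split_ifs <;> first | rfl | (field_simp))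

lemma TLlast_hook2 (hs : s ≠ 0) :
    TLten (TLlast (X := X) s) * TLlast s * TLten (TLlast s) = TLten (TLlast s) := by
  ext ⟨⟨⟨x, a⟩, b⟩, c⟩ ⟨⟨⟨y, a'⟩, b'⟩, c'⟩
  simp only [Matrix.mul_apply, Fintype.sum_prod_type, Fintype.sum_bool, TLlast_apply, TLten_apply]
  cases a <;> cases b <;> cases c <;> cases a' <;> cases b' <;> cases c' <;>
    simp [TLu, hs, ite_mul, mul_ite] <;>
    (split_ifs <;> first | rfl | (field_simp))

/-- weighted trace -/
noncomputable def TLwt (K : X → ℂ) : Matrix X X ℂ →ₗ[ℂ] ℂ :=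
  (Matrix.traceLinearMap X ℂ ℂ).comp (LinearMap.mulRight ℂ (Matrix.diagonal K))

lemma TLwt_apply (K : X → ℂ) (A : Matrix X X ℂ) : TLwt K A = ∑ x, A x x * K x := by
  simp [TLwt, Matrix.trace]

lemma TLwt_ten (K : X → ℂ) {d : ℂ} (hd : s * s + s⁻¹ * s⁻¹ = d) (A : Matrix X X ℂ) :
    TLwt (fun p : X × Bool => K p.1 * TLk s p.2) (TLten A) = d * TLwt K A := by
  subst hd
  simp only [TLwt_apply, Fintype.sum_prod_type, Fintype.sum_bool, TLten_apply, if_true, TLk,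
    Finset.mul_sum]
  exact Finset.sum_congr rfl fun _ _ => by ring

lemma TLwt_last (hs : s ≠ 0) (K : X × Bool → ℂ) (A B : Matrix (X × Bool) (X × Bool) ℂ) :
    TLwt (fun p : (X × Bool) × Bool => K p.1 * TLk s p.2) (TLten A * TLlast s * TLten B)
      = TLwt K (A * B) := by
  have key : ∀ w w' : X × Bool, ∑ b, TLlast s (w, b) (w', b) * TLk s b = if w = w' then 1 else 0 := by
    rintro ⟨x, a⟩ ⟨y, c⟩
    simp only [Fintype.sum_bool, TLlast_apply]
    by_cases h : x = y <;> cases a <;> cases c <;> simp [TLu, TLk, hs, h] <;> field_simp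
  have e1 : ∀ (v v' : X × Bool) (b b' : Bool),
      (TLten A * TLlast s * TLten B : Matrix ((X × Bool) × Bool) ((X × Bool) × Bool) ℂ) (v, b) (v', b')
      = ∑ w', (∑ w, A v w * TLlast s (w, b) (w', b')) * B w' v' := by
    intro v v' b b'
    rw [Matrix.mul_apply, Fintype.sum_prod_type (α₁ := X × Bool)]
    refine Finset.sum_congr rfl fun w' _ => ?_
    simp only [TLten_apply, mul_ite, mul_zero, Finset.sum_ite_eq', Finset.mem_univ, if_true]
    rw [Matrix.mul_apply, Fintype.sum_prod_type (α₁ := X × Bool)]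
    simp only [TLten_apply, ite_mul, zero_mul, Finset.sum_ite_eq, Finset.mem_univ, if_true]
  simp only [TLwt_apply]
  rw [Fintype.sum_prod_type (α₁ := X × Bool)]
  refine Finset.sum_congr rfl fun v _ => ?_
  simp only [e1]
  calc _ = ∑ w', ∑ w, A v w * B w' v * K v * ∑ b, TLlast s (w, b) (w', b) * TLk s b := by
        simp only [Finset.sum_mul, Finset.mul_sum]
        rw [Finset.sum_comm]
        refine Finset.sum_congr rfl fun w' _ => ?_
        rw [Finset.sum_comm]
        refine Finset.sum_congr rfl fun w _ => Finset.sum_congr rfl fun b _ => by ring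
    _ = _ := by
        simp only [key, mul_ite, mul_one, mul_zero, Finset.sum_ite_eq', Finset.mem_univ, if_true,
          Matrix.mul_apply, Finset.sum_mul]

lemma TLten_K (K : X → ℂ) (A : Matrix X X ℂ)
    (h : A * Matrix.diagonal K = Matrix.diagonal K * A) :
    TLten A * Matrix.diagonal (fun p : X × Bool => K p.1 * TLk s p.2)
      = Matrix.diagonal (fun p : X × Bool => K p.1 * TLk s p.2) * TLten A := by
  ext ⟨p, a⟩ ⟨q, b⟩
  have := congrFun (congrFun h p) q
  rw [Matrix.mul_diagonal, Matrix.diagonal_mul] at this ⊢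
  rw [TLten_apply]
  split_ifs with hab
  · subst hab
    simp only
    linear_combination TLk s a * this
  · simp

lemma TLlast_K (hs : s ≠ 0) (K : X → ℂ) :
    TLlast s * Matrix.diagonal (fun p : (X × Bool) × Bool => K p.1.1 * TLk s p.1.2 * TLk s p.2)
      = Matrix.diagonal (fun p : (X × Bool) × Bool => K p.1.1 * TLk s p.1.2 * TLk s p.2)
        * TLlast s := by
  ext ⟨⟨p, a⟩, b⟩ ⟨⟨q, a'⟩, b'⟩
  rw [Matrix.mul_diagonal, Matrix.diagonal_mul]
  rw [TLlast_apply]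
  split_ifs with hab
  · subst hab
    cases a <;> cases b <;> cases a' <;> cases b' <;> simp [TLu, TLk] <;> field_simp
  · simp

end

/-- `TLten` on the state spaces -/
noncomputable def TLtenV (n : ℕ) :
    Matrix (TLV n) (TLV n) ℂ →ₐ[ℂ] Matrix (TLV (n + 1)) (TLV (n + 1)) ℂ :=
  TLten (X := TLV n)

/-- `TLlast` on the state spaces -/
noncomputable def TLlastV (s : ℂ) (n : ℕ) : Matrix (TLV (n + 2)) (TLV (n + 2)) ℂ :=
  TLlast (X := TLV n) s

/-- generators -/
noncomputable def TLE (s : ℂ) : (n : ℕ) → ℕ → Matrix (TLV n) (TLV n) ℂ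
  | 0, _ => 0
  | 1, _ => 0
  | n + 2, i => if i = n then TLlastV s n else TLtenV (n + 1) (TLE s (n + 1) i)

/-- weights -/
noncomputable def TLK (s : ℂ) : (n : ℕ) → TLV n → ℂ
  | 0 => fun _ => 1
  | n + 1 => fun p => TLK s n p.1 * TLk s p.2

lemma TLE_last (s : ℂ) (n : ℕ) : TLE s (n + 2) n = TLlastV s n := by simp [TLE]

lemma TLE_lt (s : ℂ) (n i : ℕ) (h : i < n) :
    TLE s (n + 2) i = TLtenV (n + 1) (TLE s (n + 1) i) := by
  simp [TLE, h.ne]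

lemma TLE_sq (s d : ℂ) (hd : s * s + s⁻¹ * s⁻¹ = d) : ∀ (n i : ℕ), i < n →
    TLE s (n + 1) i * TLE s (n + 1) i = d • TLE s (n + 1) i := by
  intro n
  induction n with
  | zero => intro i h; omega
  | succ n ih =>
    intro i h
    rcases Nat.lt_succ_iff_lt_or_eq.1 h with h | rfl
    · rw [TLE_lt s n i h]
      refine (map_mul (TLtenV _) _ _).symm.trans ?_
      rw [ih i h, map_smul]
    · rw [TLE_last]
      exact TLlast_sq s hd

lemma TLE_comm (s : ℂ) : ∀ (n i j : ℕ), j < n → i + 2 ≤ j →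
    TLE s (n + 1) i * TLE s (n + 1) j = TLE s (n + 1) j * TLE s (n + 1) i := by
  intro n
  induction n with
  | zero => intro i j h; omega
  | succ n ih =>
    intro i j h h2
    rcases Nat.lt_succ_iff_lt_or_eq.1 h with h | rfl
    · rw [TLE_lt s n i (by omega), TLE_lt s n j h]
      refine (map_mul (TLtenV _) _ _).symm.trans ?_
      rw [ih i j h h2]
      exact map_mul (TLtenV _) _ _
    · obtain ⟨m, rfl⟩ : ∃ m, j = m + 1 := ⟨j - 1, by omega⟩
      rw [TLE_last, TLE_lt s _ i (by omega), TLE_lt s _ i (by omega)]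
      exact (TLlast_comm s _).symm

lemma TLE_hook1 (s : ℂ) (hs : s ≠ 0) : ∀ (n i : ℕ), i + 1 < n →
    TLE s (n + 1) i * TLE s (n + 1) (i + 1) * TLE s (n + 1) i = TLE s (n + 1) i := by
  intro n
  induction n with
  | zero => intro i h; omega
  | succ n ih =>
    intro i h
    rcases Nat.lt_succ_iff_lt_or_eq.1 h with h | rfl
    · rw [TLE_lt s n i (by omega), TLE_lt s n _ h]
      refine Eq.trans ?_ (congrArg (TLtenV _) (ih i h))
      rw [map_mul, map_mul]
    · rw [TLE_last, TLE_lt s _ i (by omega), TLE_last]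
      exact TLlast_hook2 s hs

lemma TLE_hook2 (s : ℂ) (hs : s ≠ 0) : ∀ (n i : ℕ), i + 1 < n →
    TLE s (n + 1) (i + 1) * TLE s (n + 1) i * TLE s (n + 1) (i + 1) = TLE s (n + 1) (i + 1) := by
  intro n
  induction n with
  | zero => intro i h; omega
  | succ n ih =>
    intro i h
    rcases Nat.lt_succ_iff_lt_or_eq.1 h with h | rfl
    · rw [TLE_lt s n i (by omega), TLE_lt s n _ h]
      refine Eq.trans ?_ (congrArg (TLtenV _) (ih i h))
      rw [map_mul, map_mul]
    · rw [TLE_last, TLE_lt s _ i (by omega), TLE_last]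
      exact TLlast_hook1 s hs

lemma TLE_K (s : ℂ) (hs : s ≠ 0) : ∀ (n i : ℕ), i < n →
    TLE s (n + 1) i * Matrix.diagonal (TLK s (n + 1))
      = Matrix.diagonal (TLK s (n + 1)) * TLE s (n + 1) i := by
  intro n
  induction n with
  | zero => intro i h; omega
  | succ n ih =>
    intro i h
    rcases Nat.lt_succ_iff_lt_or_eq.1 h with h | rfl
    · rw [TLE_lt s n i h]
      exact TLten_K s (TLK s (n + 1)) (TLE s (n + 1) i) (ih i h)
    · rw [TLE_last]
      exact TLlast_K (X := TLV i) s hs (TLK s i)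

/-- the representation -/
noncomputable def TLrho (s d : ℂ) (hs : s ≠ 0) (hd : s * s + s⁻¹ * s⁻¹ = d) (n : ℕ) :
    TL d (n + 1) →ₐ[ℂ] Matrix (TLV (n + 1)) (TLV (n + 1)) ℂ :=
  RingQuot.liftAlgHom ℂ ⟨FreeAlgebra.lift ℂ fun i => TLE s (n + 1) i, by
    intro x y h
    induction h with
    | sq i =>
      simp only [map_mul, map_smul, FreeAlgebra.lift_ι_apply]
      exact TLE_sq s d hd n i i.2
    | comm i j h =>
      simp only [map_mul, FreeAlgebra.lift_ι_apply]
      rcases h with h | h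
      · exact TLE_comm s n i j j.2 h
      · exact (TLE_comm s n j i i.2 h).symm
    | hook i j h =>
      simp only [map_mul, FreeAlgebra.lift_ι_apply]
      rcases h with h | h
      · rw [← h]; exact TLE_hook1 s hs n i (h ▸ j.2)
      · rw [← h]; exact TLE_hook2 s hs n j (h ▸ i.2)⟩

lemma TLrho_gen (s d : ℂ) (hs : s ≠ 0) (hd : s * s + s⁻¹ * s⁻¹ = d) (n : ℕ) (i : Fin (n + 1 - 1)) :
    TLrho s d hs hd n (TLgen d (n + 1) i) = TLE s (n + 1) i := by
  unfold TLrho TLgen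
  erw [RingQuot.liftAlgHom_mkAlgHom_apply]
  simp

lemma TL_exists_s (d : ℂ) : ∃ s : ℂ, s ≠ 0 ∧ s * s + s⁻¹ * s⁻¹ = d := by
  obtain ⟨r, hr⟩ := IsAlgClosed.exists_eq_mul_self (d ^ 2 - 4)
  have hq : (d + r) / 2 ≠ 0 := by
    intro h
    have : r = -d := by linear_combination 2 * h
    rw [this] at hr
    exact absurd (by linear_combination -hr : (4 : ℂ) = 0) (by norm_num)
  obtain ⟨s, hs⟩ := IsAlgClosed.exists_eq_mul_self ((d + r) / 2)
  have h0 : s ≠ 0 := by rintro rfl; simp [hs] at hq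
  refine ⟨s, h0, ?_⟩
  rw [← mul_inv]
  rw [← hs]
  field_simp
  have h2 : d + r ≠ 0 := fun h => hq (by simp [h])
  field_simp
  linear_combination -hr

/-- the trace -/
noncomputable def TLtr (s d : ℂ) (hs : s ≠ 0) (hd : s * s + s⁻¹ * s⁻¹ = d) (n : ℕ) :
    TL d (n + 1) →ₗ[ℂ] ℂ :=
  (TLwt (TLK s (n + 1))).comp (TLrho s d hs hd n).toLinearMap

lemma TLtr_tracial (s d : ℂ) (hs : s ≠ 0) (hd : s * s + s⁻¹ * s⁻¹ = d) (n : ℕ)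
    (a b : TL d (n + 1)) : TLtr s d hs hd n (a * b) = TLtr s d hs hd n (b * a) := by
  have hc : TLrho s d hs hd n a * Matrix.diagonal (TLK s (n + 1))
      = Matrix.diagonal (TLK s (n + 1)) * TLrho s d hs hd n a := by
    have := TL_subalg_top d (n + 1)
      ((Subalgebra.centralizer ℂ {Matrix.diagonal (TLK s (n + 1))}).comap (TLrho s d hs hd n))
      (fun i => by
        rw [Subalgebra.mem_comap, Subalgebra.mem_centralizer_iff]
        rintro _ rfl
        rw [TLrho_gen]
        exact (TLE_K s hs n i i.2).symm) a
    rw [Subalgebra.mem_comap, Subalgebra.mem_centralizer_iff] at this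
    exact (this _ rfl).symm
  simp only [TLtr, TLwt, LinearMap.comp_apply, AlgHom.toLinearMap_apply, map_mul,
    LinearMap.mulRight_apply, Matrix.traceLinearMap_apply]
  rw [mul_assoc, Matrix.trace_mul_comm, mul_assoc, ← hc, mul_assoc]

/-- the Jones span lemma -/
lemma TL_span (d : ℂ)
    (ι : ∀ n : ℕ, TL d (n + 1) →ₐ[ℂ] TL d (n + 2))
    (hι : ∀ (n : ℕ) (i : Fin ((n + 1) - 1)),
      ι n (TLgen d (n + 1) i) = TLgen d (n + 2) (TLinc n i)) (n : ℕ) :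
    ∀ z : TL d (n + 2), z ∈ LinearMap.range (ι n).toLinearMap ⊔
      Submodule.span ℂ {w | ∃ x y, w = ι n x * TLgen d (n + 2) (Fin.last n) * ι n y} := by
  have closure : ∀ n : ℕ,
      (∀ x : TL d (n + 1), TLgen d (n + 2) (Fin.last n) * ι n x * TLgen d (n + 2) (Fin.last n) ∈
        Submodule.span ℂ {w | ∃ x y, w = ι n x * TLgen d (n + 2) (Fin.last n) * ι n y}) →
      ∀ z : TL d (n + 2), z ∈ LinearMap.range (ι n).toLinearMap ⊔
      Submodule.span ℂ {w | ∃ x y, w = ι n x * TLgen d (n + 2) (Fin.last n) * ι n y} := by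
    intro n hh
    set h := TLgen d (n + 2) (Fin.last n) with hdef
    set P := Submodule.span ℂ {w | ∃ x y, w = ι n x * h * ι n y} with hP
    have hPr : ∀ w ∈ P, ∀ y, w * ι n y ∈ P := by
      intro w hw y
      induction hw using Submodule.span_induction with
      | mem w hw =>
        obtain ⟨a, b, rfl⟩ := hw
        exact Submodule.subset_span ⟨a, b * y, by rw [map_mul, mul_assoc _ _ (ι n y)]⟩
      | zero => simp
      | add a b _ _ ha hb => rw [add_mul]; exact P.add_mem ha hb
      | smul c a _ ha => rw [smul_mul_assoc]; exact P.smul_mem c ha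
    have hPl : ∀ w ∈ P, ∀ y, ι n y * w ∈ P := by
      intro w hw y
      induction hw using Submodule.span_induction with
      | mem w hw =>
        obtain ⟨a, b, rfl⟩ := hw
        exact Submodule.subset_span ⟨y * a, b, by simp only [map_mul, mul_assoc]⟩
      | zero => simp
      | add a b _ _ ha hb => rw [mul_add]; exact P.add_mem ha hb
      | smul c a _ ha => rw [mul_smul_comm]; exact P.smul_mem c ha
    have hPh : ∀ w ∈ P, h * w ∈ P := by
      intro w hw
      induction hw using Submodule.span_induction with
      | mem w hw =>
        obtain ⟨a, b, rfl⟩ := hw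
        have := hPr _ (hh a) b
        simpa only [mul_assoc] using this
      | zero => simp
      | add a b _ _ ha hb => rw [mul_add]; exact P.add_mem ha hb
      | smul c a _ ha => rw [mul_smul_comm]; exact P.smul_mem c ha
    set S := LinearMap.range (ι n).toLinearMap ⊔ P with hS
    -- elements stabilising S
    let N : Subalgebra ℂ (TL d (n + 2)) :=
      { carrier := {g | ∀ z ∈ S, g * z ∈ S}
        mul_mem' := fun {a b} ha hb z hz => by rw [mul_assoc]; exact ha _ (hb _ hz)
        add_mem' := fun {a b} ha hb z hz => by rw [add_mul]; exact S.add_mem (ha _ hz) (hb _ hz)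
        algebraMap_mem' := fun r z hz => by
          rw [← Algebra.smul_def]; exact S.smul_mem r hz }
    have hN : ∀ i, TLgen d (n + 2) i ∈ N := by
      intro i z hz
      obtain ⟨u, ⟨x, rfl⟩, w, hw, rfl⟩ := Submodule.mem_sup.1 hz
      rw [mul_add]
      by_cases hi : (i : ℕ) < n
      · have : TLgen d (n + 2) i = ι n (TLgen d (n + 1) ⟨i, hi⟩) := by
          rw [hι]; rfl
        rw [this]
        refine S.add_mem (Submodule.mem_sup_left ⟨TLgen d (n + 1) ⟨i, hi⟩ * x, ?_⟩)
          (Submodule.mem_sup_right (hPl _ hw _))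
        simp
      · have : i = Fin.last n := by
          apply Fin.ext
          have := i.2
          simp only [Fin.val_last]
          omega
        rw [this]
        refine S.add_mem (Submodule.mem_sup_right (Submodule.subset_span ⟨1, x, ?_⟩))
          (Submodule.mem_sup_right (hPh _ hw))
        simp [hdef]
    intro z
    have := TL_subalg_top d (n + 2) N hN z 1 (Submodule.mem_sup_left ⟨1, by simp⟩)
    simpa using this
  induction n with
  | zero =>
    apply closure
    intro x
    obtain ⟨c, rfl⟩ : ∃ c, algebraMap ℂ (TL d 1) c = x := by
      have := TL_subalg_top d 1 ⊥ (fun i => i.elim0) x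
      exact Algebra.mem_bot.1 this
    rw [AlgHom.commutes, ← Algebra.commutes, mul_assoc, TLgen_sq, ← Algebra.smul_def]
    refine Submodule.smul_mem _ _ (Submodule.smul_mem _ _ (Submodule.subset_span ⟨1, 1, by simp⟩))
  | succ n ih =>
    apply closure
    have hcomm : ∀ a, TLgen d (n + 3) (Fin.last (n + 1)) * ι (n + 1) (ι n a)
        = ι (n + 1) (ι n a) * TLgen d (n + 3) (Fin.last (n + 1)) := by
      intro a
      have := TL_subalg_top d (n + 1)
        ((Subalgebra.centralizer ℂ {TLgen d (n + 3) (Fin.last (n + 1))}).comap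
          ((ι (n + 1)).comp (ι n)))
        (fun i => by
          rw [Subalgebra.mem_comap, Subalgebra.mem_centralizer_iff]
          rintro _ rfl
          rw [AlgHom.comp_apply, hι, hι]
          apply TLgen_comm
          right
          have := i.2
          simp only [TLinc, Fin.val_last]
          omega) a
      rw [Subalgebra.mem_comap, Subalgebra.mem_centralizer_iff] at this
      exact this _ rfl
    intro x
    obtain ⟨u, ⟨a, rfl⟩, w, hw, rfl⟩ := Submodule.mem_sup.1 (ih x)
    rw [map_add, mul_add, add_mul]
    refine Submodule.add_mem _ ?_ ?_
    · rw [AlgHom.toLinearMap_apply, hcomm, mul_assoc, TLgen_sq, mul_smul_comm]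
      exact Submodule.smul_mem _ _ (Submodule.subset_span ⟨ι n a, 1, by simp⟩)
    · induction hw using Submodule.span_induction with
      | mem w hw =>
        obtain ⟨a, b, rfl⟩ := hw
        refine Submodule.subset_span ⟨ι n a, ι n b, ?_⟩
        have hk : TLgen d (n + 3) (Fin.last (n + 1)) * ι (n + 1) (TLgen d (n + 2) (Fin.last n))
            * TLgen d (n + 3) (Fin.last (n + 1)) = TLgen d (n + 3) (Fin.last (n + 1)) := by
          rw [hι]
          apply TLgen_hook
          right
          simp [TLinc]
        rw [map_mul, map_mul]
        calc _ = (TLgen d (n + 3) (Fin.last (n + 1)) * ι (n + 1) (ι n a))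
              * ι (n + 1) (TLgen d (n + 2) (Fin.last n))
              * (ι (n + 1) (ι n b) * TLgen d (n + 3) (Fin.last (n + 1))) := by
              simp only [mul_assoc]
          _ = ι (n + 1) (ι n a) * (TLgen d (n + 3) (Fin.last (n + 1))
              * ι (n + 1) (TLgen d (n + 2) (Fin.last n))
              * TLgen d (n + 3) (Fin.last (n + 1))) * ι (n + 1) (ι n b) := by
              rw [hcomm, ← hcomm b]
              simp only [mul_assoc]
          _ = _ := by rw [hk]
      | zero => simp
      | add a b _ _ ha hb =>
        rw [map_add, mul_add, add_mul]; exact Submodule.add_mem _ ha hb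
      | smul c a _ ha =>
        rw [map_smul, mul_smul_comm, smul_mul_assoc]; exact Submodule.smul_mem _ c ha

lemma TL_unique (d : ℂ)
    (ι : ∀ n : ℕ, TL d (n + 1) →ₐ[ℂ] TL d (n + 2))
    (hι : ∀ (n : ℕ) (i : Fin ((n + 1) - 1)),
      ι n (TLgen d (n + 1) i) = TLgen d (n + 2) (TLinc n i))
    (T T' : ∀ n : ℕ, TL d (n + 1) →ₗ[ℂ] ℂ)
    (h : (T 0 1 = d) ∧
      (∀ (n : ℕ) (x : TL d (n + 1)), T (n + 1) (ι n x) = d * T n x) ∧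
      (∀ (n : ℕ) (x y : TL d (n + 1)),
        T (n + 1) (ι n x * TLh d (n + 2) (n + 1) * ι n y) = T n (x * y)))
    (h' : (T' 0 1 = d) ∧
      (∀ (n : ℕ) (x : TL d (n + 1)), T' (n + 1) (ι n x) = d * T' n x) ∧
      (∀ (n : ℕ) (x y : TL d (n + 1)),
        T' (n + 1) (ι n x * TLh d (n + 2) (n + 1) * ι n y) = T' n (x * y))) : T = T' := by
  funext n
  induction n with
  | zero =>
    refine LinearMap.ext fun x => ?_
    obtain ⟨c, rfl⟩ : ∃ c, algebraMap ℂ (TL d 1) c = x :=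
      Algebra.mem_bot.1 (TL_subalg_top d 1 ⊥ (fun i => i.elim0) x)
    rw [Algebra.algebraMap_eq_smul_one, map_smul, map_smul]
    exact congrArg (c • ·) (h.1.trans h'.1.symm)
  | succ n ih =>
    refine LinearMap.ext fun z => ?_
    obtain ⟨u, ⟨x, rfl⟩, w, hw, rfl⟩ := Submodule.mem_sup.1 (TL_span d ι hι n z)
    rw [map_add, map_add]
    congr 1
    · rw [AlgHom.toLinearMap_apply, h.2.1, h'.2.1, ih]
    · induction hw using Submodule.span_induction with
      | mem w hw =>
        obtain ⟨a, b, rfl⟩ := hw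
        rw [← TLh_last, h.2.2, h'.2.2, ih]
      | zero => simp
      | add a b _ _ ha hb => rw [map_add, map_add, ha, hb]
      | smul c a _ ha => rw [map_smul, map_smul, ha]

lemma TLtr_props (s d : ℂ) (hs : s ≠ 0) (hd : s * s + s⁻¹ * s⁻¹ = d)
    (ι : ∀ n : ℕ, TL d (n + 1) →ₐ[ℂ] TL d (n + 2))
    (hι : ∀ (n : ℕ) (i : Fin ((n + 1) - 1)),
      ι n (TLgen d (n + 1) i) = TLgen d (n + 2) (TLinc n i)) :
    (TLtr s d hs hd 0 1 = d) ∧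
      (∀ (n : ℕ) (x : TL d (n + 1)), TLtr s d hs hd (n + 1) (ι n x) = d * TLtr s d hs hd n x) ∧
      (∀ (n : ℕ) (x y : TL d (n + 1)),
        TLtr s d hs hd (n + 1) (ι n x * TLh d (n + 2) (n + 1) * ι n y)
          = TLtr s d hs hd n (x * y)) := by
  have hten : ∀ (n : ℕ) (x : TL d (n + 1)),
      TLrho s d hs hd (n + 1) (ι n x) = TLtenV (n + 1) (TLrho s d hs hd n x) := by
    intro n x
    refine TL_hom_ext d (n + 1) ((TLrho s d hs hd (n + 1)).comp (ι n))
      ((TLtenV (n + 1)).comp (TLrho s d hs hd n)) (fun i => ?_) x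
    rw [AlgHom.comp_apply, AlgHom.comp_apply, hι, TLrho_gen]
    erw [TLrho_gen]
    exact TLE_lt s n i i.2
  refine ⟨?_, ?_, ?_⟩
  · change TLwt (TLK s 1) (TLrho s d hs hd 0 1) = d
    rw [map_one, TLwt_apply]
    change ∑ x : Unit × Bool, (1 : Matrix (Unit × Bool) (Unit × Bool) ℂ) x x * (1 * TLk s x.2) = d
    rw [← hd]
    simp [Fintype.sum_prod_type, TLk, add_comm]
  · intro n x
    change TLwt (TLK s (n + 2)) (TLrho s d hs hd (n + 1) (ι n x)) = _
    rw [hten]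
    exact TLwt_ten (X := TLV (n + 1)) s (TLK s (n + 1)) hd (TLrho s d hs hd n x)
  · intro n x y
    change TLwt (TLK s (n + 2)) (TLrho s d hs hd (n + 1) _) = TLwt _ (TLrho s d hs hd n (x * y))
    rw [map_mul (TLrho s d hs hd (n + 1)), map_mul (TLrho s d hs hd (n + 1)),
      map_mul (TLrho s d hs hd n), hten, hten, TLh_last]
    have : TLrho s d hs hd (n + 1) (TLgen d (n + 2) (Fin.last n)) = TLlastV s n :=
      (TLrho_gen s d hs hd (n + 1) (Fin.last n)).trans (TLE_last s n)
    rw [this]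
    exact TLwt_last (X := TLV n) s hs (TLK s (n + 1)) (TLrho s d hs hd n x) (TLrho s d hs hd n y)

end TLproof

/-- For every `d ∈ ℂ` there exists a unique family of `ℂ`-linear functionals
`Tr_n : TL_n(d) → ℂ` (`n ≥ 1`; here `T m` stands for `Tr_{m+1}`) such that:
(i) `Tr_1(1) = d`; (ii) `Tr_{n+1}(ι_n(x)) = d·Tr_n(x)`; and
(iii) `Tr_{n+1}(ι_n(x)·h_n·ι_n(y)) = Tr_n(x·y)`, where `ι_n : TL_n(d) → TL_{n+1}(d)`
is the algebra map sending `h_i` to `h_i` (given here as the family `ι` with its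
defining property `hι`).  Moreover each `Tr_n` is tracial: `Tr_n(ab) = Tr_n(ba)`. -/
theorem stmt8 (d : ℂ)
    (ι : ∀ n : ℕ, TL d (n + 1) →ₐ[ℂ] TL d (n + 2))
    (hι : ∀ (n : ℕ) (i : Fin ((n + 1) - 1)),
      ι n (TLgen d (n + 1) i) = TLgen d (n + 2) (Fin.castLE (by omega) i)) :
    (∃! T : ∀ n : ℕ, TL d (n + 1) →ₗ[ℂ] ℂ,
      (T 0 1 = d) ∧
      (∀ (n : ℕ) (x : TL d (n + 1)), T (n + 1) (ι n x) = d * T n x) ∧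
      (∀ (n : ℕ) (x y : TL d (n + 1)),
        T (n + 1) (ι n x * TLh d (n + 2) (n + 1) * ι n y) = T n (x * y))) ∧
    (∀ T : ∀ n : ℕ, TL d (n + 1) →ₗ[ℂ] ℂ,
      ((T 0 1 = d) ∧
       (∀ (n : ℕ) (x : TL d (n + 1)), T (n + 1) (ι n x) = d * T n x) ∧
       (∀ (n : ℕ) (x y : TL d (n + 1)),
         T (n + 1) (ι n x * TLh d (n + 2) (n + 1) * ι n y) = T n (x * y))) →
      ∀ (n : ℕ) (a b : TL d (n + 1)), T n (a * b) = T n (b * a)) := by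
  obtain ⟨s, hs, hd⟩ := TL_exists_s d
  have hp := TLtr_props s d hs hd ι hι
  refine ⟨⟨TLtr s d hs hd, hp, fun T hT => TL_unique d ι hι _ _ hT hp⟩, fun T hT n a b => ?_⟩
  rw [TL_unique d ι hι T _ hT hp]
  exact TLtr_tracial s d hs hd n a b
end

section
/- Let q ∈ ℂ, q ≠ 0, d = q + q⁻¹, and let n ≥ 1. Assume the quantum integers [k]_q are nonzero for all 1 ≤ k ≤ n. Then the Temperley-Lieb algebra TL_n(d) is a semisimple ring. -/
namespace TLproof

/-- A family satisfying the Temperley-Lieb relations for indices below `N`. -/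
structure Sys {A : Type*} [Ring A] [Algebra ℂ A] (d : ℂ) (N : ℕ) (h : ℕ → A) : Prop where
  sq : ∀ i, h i * h i = d • h i
  comm : ∀ i j, i + 2 ≤ j → h i * h j = h j * h i
  hook1 : ∀ i, i + 1 < N → h i * h (i + 1) * h i = h i
  hook2 : ∀ i, i + 1 < N → h (i + 1) * h i * h (i + 1) = h (i + 1)

section sys

variable {A : Type*} [Ring A] [Algebra ℂ A]

/-- The subspace underlying the subalgebra generated by the first `k` generators. -/
def M (h : ℕ → A) (k : ℕ) : Submodule ℂ A :=
  Subalgebra.toSubmodule (Algebra.adjoin ℂ (h '' {i | i < k}))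

/-- The line spanned by a generator. -/
def H (h : ℕ → A) (k : ℕ) : Submodule ℂ A := Submodule.span ℂ {h k}

lemma M_mul (h : ℕ → A) (k : ℕ) : M h k * M h k = M h k := by
  exact (Subalgebra.isIdempotentElem_toSubmodule _).eq

lemma one_le_M (h : ℕ → A) (k : ℕ) : 1 ≤ M h k := by
  rw [Submodule.one_le]
  exact (Algebra.adjoin ℂ (h '' {i | i < k})).one_mem

lemma M_mono (h : ℕ → A) {k l : ℕ} (hkl : k ≤ l) : M h k ≤ M h l := by
  have : Algebra.adjoin ℂ (h '' {i | i < k}) ≤ Algebra.adjoin ℂ (h '' {i | i < l}) :=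
    Algebra.adjoin_mono (Set.image_mono fun i hi => lt_of_lt_of_le hi hkl)
  exact this

lemma M_zero (h : ℕ → A) : M h 0 = 1 := by
  simp [M, Algebra.toSubmodule_bot]

variable {d : ℂ} {N : ℕ} {h : ℕ → A}

lemma commute_M (hs : Sys d N h) {k : ℕ} {x : A} (hx : x ∈ M h k) {j : ℕ} (hj : k + 1 ≤ j) :
    h j * x = x * h j := by
  have hx' : x ∈ Algebra.adjoin ℂ (h '' {i | i < k}) := hx
  clear hx
  induction hx' using Algebra.adjoin_induction with
  | mem x hx =>
    obtain ⟨i, hi, rfl⟩ := hx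
    have hi : i < k := hi
    exact (hs.comm i j (by omega)).symm
  | algebraMap r => exact (Algebra.commutes r _).symm
  | add x y _ _ h1 h2 => rw [mul_add, add_mul, h1, h2]
  | mul x y _ _ h1 h2 => rw [← mul_assoc, h1, mul_assoc, h2, mul_assoc]

lemma H_mul_M (hs : Sys d N h) {k j : ℕ} (hj : k + 1 ≤ j) : H h j * M h k = M h k * H h j := by
  ext x
  constructor
  · intro hx
    induction hx using Submodule.mul_induction_on' with
    | mem_mul_mem a ha b hb =>
      obtain ⟨c, rfl⟩ := Submodule.mem_span_singleton.1 ha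
      rw [smul_mul_assoc, commute_M hs hb hj]
      exact Submodule.smul_mem _ _ (Submodule.mul_mem_mul hb (Submodule.mem_span_singleton_self _))
    | add x _ y _ h1 h2 => exact add_mem h1 h2
  · intro hx
    induction hx using Submodule.mul_induction_on' with
    | mem_mul_mem a ha b hb =>
      obtain ⟨c, rfl⟩ := Submodule.mem_span_singleton.1 hb
      rw [mul_smul_comm, ← commute_M hs ha hj]
      exact Submodule.smul_mem _ _ (Submodule.mul_mem_mul (Submodule.mem_span_singleton_self _) ha)
    | add x _ y _ h1 h2 => exact add_mem h1 h2

lemma H_sq (hs : Sys d N h) (k : ℕ) : H h k * H h k ≤ H h k := by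
  rw [H, Submodule.span_mul_span, Submodule.span_le]
  simp only [Set.singleton_mul_singleton, Set.singleton_subset_iff, SetLike.mem_coe]
  rw [hs.sq]
  exact Submodule.smul_mem _ _ (Submodule.mem_span_singleton_self _)

lemma H_hook (hs : Sys d N h) (k : ℕ) (hk : k + 1 < N) :
    H h (k+1) * H h k * H h (k+1) = H h (k+1) := by
  simp only [H, Submodule.span_mul_span, Set.singleton_mul_singleton, hs.hook2 k hk]

lemma key (hs : Sys d N h) (k : ℕ) (hk : k < N) :
    M h (k+1) ≤ M h k ⊔ M h k * H h k * M h k ∧ H h k * M h k * H h k ≤ M h (k-1) * H h k := by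
  have main : ∀ k, H h k * M h k * H h k ≤ M h (k-1) * H h k →
      M h (k+1) ≤ M h k ⊔ M h k * H h k * M h k := by
    intro k hH
    set S := M h k ⊔ M h k * H h k * M h k with hS
    have h1 : (1 : A) ∈ S := Submodule.one_le.1 ((one_le_M h k).trans le_sup_left)
    have hSS : S * S ≤ S := by
      have e1 : M h k * (M h k * H h k * M h k) = M h k * H h k * M h k := by
        rw [← mul_assoc, ← mul_assoc, M_mul]
      have e2 : (M h k * H h k * M h k) * M h k = M h k * H h k * M h k := by
        rw [mul_assoc, M_mul]
      have e3 : (M h k * H h k * M h k) * (M h k * H h k * M h k) ≤ M h k * H h k * M h k := by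
        calc (M h k * H h k * M h k) * (M h k * H h k * M h k)
            = M h k * (H h k * (M h k * M h k) * H h k) * M h k := by simp only [mul_assoc]
          _ ≤ M h k * (M h (k-1) * H h k) * M h k := by rw [M_mul]; gcongr
          _ ≤ M h k * (M h k * H h k) * M h k := by
              gcongr
              exact M_mono h (by omega)
          _ = M h k * H h k * M h k := by rw [← mul_assoc (M h k), M_mul]
      rw [hS, Submodule.sup_mul, Submodule.mul_sup, Submodule.mul_sup, M_mul, e1, e2]
      refine sup_le le_rfl (sup_le le_sup_right (e3.trans le_sup_right))
    have : Algebra.adjoin ℂ (h '' {i | i < k+1}) ≤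
        S.toSubalgebra h1 (fun x y hx hy => hSS (Submodule.mul_mem_mul hx hy)) := by
      rw [Algebra.adjoin_le_iff]
      rintro _ ⟨i, hi, rfl⟩
      have hi : i < k + 1 := hi
      change h i ∈ S
      rcases Nat.lt_succ_iff_lt_or_eq.1 hi with h2 | rfl
      · exact (le_sup_left : M h k ≤ S) (Algebra.subset_adjoin ⟨i, h2, rfl⟩)
      · refine (le_sup_right : _ ≤ S) ?_
        have := Submodule.mul_mem_mul (Submodule.mul_mem_mul (Submodule.one_le.1 (one_le_M h i))
          (Submodule.mem_span_singleton_self (h i) : h i ∈ H h i)) (Submodule.one_le.1 (one_le_M h i))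
        rwa [one_mul, mul_one] at this
    exact this
  induction k with
  | zero =>
    have : H h 0 * M h 0 * H h 0 ≤ M h (0-1) * H h 0 := by
      simpa [M_zero] using H_sq hs 0
    exact ⟨main _ this, this⟩
  | succ k ih =>
    have ih := (ih (by omega)).1
    have : H h (k+1) * M h (k+1) * H h (k+1) ≤ M h (k+1-1) * H h (k+1) := by
      rw [Nat.add_sub_cancel]
      calc _ ≤ H h (k+1) * (M h k ⊔ M h k * H h k * M h k) * H h (k+1) := by gcongr
        _ = H h (k+1) * M h k * H h (k+1) ⊔ (H h (k+1) * M h k) * H h k * (M h k * H h (k+1)) := by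
          rw [Submodule.mul_sup, Submodule.sup_mul]; simp only [mul_assoc]
        _ = M h k * (H h (k+1) * H h (k+1)) ⊔ M h k * (H h (k+1) * H h k * H h (k+1)) * M h k := by
          rw [← H_mul_M hs le_rfl]
          nth_rw 1 [H_mul_M hs le_rfl]
          nth_rw 1 [H_mul_M hs le_rfl]
          simp only [mul_assoc]
        _ ≤ M h k * H h (k+1) ⊔ M h k * H h (k+1) * M h k := by
          rw [H_hook hs k hk]
          gcongr
          exact H_sq hs _
        _ ≤ _ := by
          rw [mul_assoc (M h k), H_mul_M hs le_rfl, ← mul_assoc, M_mul, sup_idem]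
    exact ⟨main _ this, this⟩

lemma M_fg (hs : Sys d N h) (k : ℕ) (hk : k ≤ N) : (M h k).FG := by
  induction k with
  | zero => rw [M_zero, Submodule.one_eq_span]; exact Submodule.fg_span_singleton _
  | succ k ih =>
    have ih := ih (by omega)
    have hH : (H h k).FG := Submodule.fg_span_singleton _
    have h2 := ih.sup ((ih.mul hH).mul ih)
    have : FiniteDimensional ℂ ↥(M h k ⊔ M h k * H h k * M h k) := Module.Finite.iff_fg.2 h2
    exact Module.Finite.iff_fg.1 (Submodule.finiteDimensional_of_le (key hs k (by omega)).1)

lemma corner (hs : Sys d N h) (k : ℕ) (hk : k < N) :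
    H h k * M h (k+1) * H h k ≤ M h (k-1) * H h k := by
  have h2 := (key hs k hk).2
  have hc : M h (k-1) * H h k * (M h k * H h k) ≤ M h (k-1) * H h k := by
    calc _ = M h (k-1) * (H h k * M h k * H h k) := by simp only [mul_assoc]
      _ ≤ M h (k-1) * (M h (k-1) * H h k) := by gcongr
      _ = _ := by rw [← mul_assoc, M_mul]
  calc _ ≤ H h k * (M h k ⊔ M h k * H h k * M h k) * H h k := by
        gcongr; exact (key hs k hk).1
    _ = H h k * M h k * H h k ⊔ (H h k * M h k * H h k) * (M h k * H h k) := by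
        rw [Submodule.mul_sup, Submodule.sup_mul]; simp only [mul_assoc]
    _ ≤ M h (k-1) * H h k ⊔ (M h (k-1) * H h k) * (M h k * H h k) := by gcongr
    _ ≤ _ := sup_le le_rfl hc

/-- Quantum integers by recursion. -/
def U (d : ℂ) : ℕ → ℂ
  | 0 => 0
  | 1 => 1
  | (n+2) => d * U d (n+1) - U d n

/-- Jones-Wenzl elements: `P h k` uses the first `k` generators. -/
noncomputable def P (d : ℂ) (h : ℕ → A) : ℕ → A
  | 0 => 1
  | (k+1) => P d h k - (U d (k+1) / U d (k+2)) • (P d h k * h k * P d h k)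

lemma P_mem (d : ℂ) (h : ℕ → A) (k : ℕ) : P d h k ∈ Algebra.adjoin ℂ (h '' {i | i < k}) := by
  induction k with
  | zero => exact one_mem _
  | succ k ih =>
    have ih' : P d h k ∈ Algebra.adjoin ℂ (h '' {i | i < k + 1}) :=
      Algebra.adjoin_mono (Set.image_mono fun i hi => Nat.lt_succ_of_lt hi) ih
    exact sub_mem ih' (Subalgebra.smul_mem _
      (mul_mem (mul_mem ih' (Algebra.subset_adjoin ⟨k, Nat.lt_succ_self k, rfl⟩)) ih') _)

lemma P_comm (hs : Sys d N h) (k j : ℕ) (hj : k + 1 ≤ j) : h j * P d h k = P d h k * h j :=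
  commute_M hs (P_mem d h k) hj

lemma P_props (hs : Sys d N h) (k : ℕ) (hk : k ≤ N) (hU : ∀ j, 1 ≤ j → j ≤ k + 1 → U d j ≠ 0) :
    P d h k * P d h k = P d h k ∧ (∀ i < k, h i * P d h k = 0 ∧ P d h k * h i = 0) ∧
    (k < N → (h k * P d h k * h k) = (U d (k+2) / U d (k+1)) • (h k * P d h (k-1)))
    ∧ P d h (k-1) * P d h k = P d h k ∧ P d h k * P d h (k-1) = P d h k := by
  induction k with
  | zero => simp [P, hs.sq, U]
  | succ k ih =>
    obtain ⟨i1, i2, i3, i4, i5⟩ := ih (by omega) (fun j h1 h2 => hU j h1 (by omega))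
    have i3 := i3 (by omega)
    have u1 := hU (k+1) (by omega) (by omega)
    have u2 := hU (k+2) (by omega) (by omega)
    set p := P d h k with hp
    set c := U d (k+1) / U d (k+2) with hc
    have hP : P d h (k+1) = p - c • (p * h k * p) := rfl
    have hcc : c * (U d (k+2) / U d (k+1)) = 1 := by rw [hc]; field_simp
    have hpc : h k * P d h (k-1) * p = h k * p := by rw [mul_assoc, i4]
    have hcomm : P d h (k-1) * h k = h k * P d h (k-1) := by
      rcases k with _ | k
      · simp [P]
      · exact (P_comm hs _ _ (by simp)).symm
    have a1 : h k * P d h (k+1) = 0 := by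
      rw [hP, mul_sub, mul_smul_comm, ← mul_assoc, ← mul_assoc, i3, smul_mul_assoc, smul_smul, hcc,
        one_smul, hpc, sub_self]
    have a2 : P d h (k+1) * h k = 0 := by
      have : p * h k * p * h k = (U d (k+2) / U d (k+1)) • (p * h k) := by
        rw [mul_assoc, mul_assoc, ← mul_assoc (h k), i3, mul_smul_comm, ← hcomm, ← mul_assoc, i5]
      rw [hP, sub_mul, smul_mul_assoc, this, smul_smul, hcc, one_smul, sub_self]
    have b1 : p * P d h (k+1) = P d h (k+1) := by
      rw [hP, mul_sub, mul_smul_comm, i1, ← mul_assoc, ← mul_assoc, i1]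
    have b2 : P d h (k+1) * p = P d h (k+1) := by
      rw [hP, sub_mul, smul_mul_assoc, i1, mul_assoc, i1]
    refine ⟨?_, ?_, ?_, b1, b2⟩
    · nth_rw 1 [hP]
      rw [sub_mul, b1, smul_mul_assoc, mul_assoc, b1, mul_assoc, a1]
      simp
    · intro i hi
      rcases Nat.lt_succ_iff_lt_or_eq.1 hi with hi | rfl
      · obtain ⟨z1, z2⟩ := i2 i hi
        constructor
        · rw [← b1, ← mul_assoc, z1, zero_mul]
        · rw [← b2, mul_assoc, z2, mul_zero]
      · exact ⟨a1, a2⟩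
    · intro hkN
      have hc1 : h (k+1) * p = p * h (k+1) := P_comm hs _ _ le_rfl
      have : h (k+1) * (p * h k * p) * h (k+1) = h (k+1) * p := by
        calc h (k+1) * (p * h k * p) * h (k+1) = (h (k+1) * p) * h k * (p * h (k+1)) := by
              simp only [mul_assoc]
          _ = p * (h (k+1) * h k * h (k+1)) * p := by
              rw [← hc1]; nth_rw 1 [hc1]; simp only [mul_assoc]
          _ = _ := by rw [hs.hook2 k hkN, ← hc1, mul_assoc, i1]
      have h2 : h (k+1) * p * h (k+1) = d • (h (k+1) * p) := by
        rw [mul_assoc, ← hc1, ← mul_assoc, hs.sq, smul_mul_assoc]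
      rw [hP, mul_sub, sub_mul, mul_smul_comm, smul_mul_assoc, this, h2, ← sub_smul]
      congr 1
      rw [show U d (k+1+2) = d * U d (k+2) - U d (k+1) from rfl, hc]
      change _ = _ / U d (k+2)
      field_simp

/-- A two-sided ideal given by a predicate, containing the last generator, contains `1 - P`. -/
lemma one_sub_P (hs : Sys d N h) (hN : 0 < N) (Q : A → Prop) (h0 : Q (h (N-1)))
    (hadd : ∀ x y, Q x → Q y → Q (x + y)) (hl : ∀ a x, Q x → Q (a * x))
    (hr : ∀ a x, Q x → Q (x * a)) : Q (1 - P d h N) := by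
  have hall : ∀ j, ∀ i, i + j + 1 = N → Q (h i) := by
    intro j
    induction j with
    | zero => intro i hi; rwa [show i = N - 1 by omega]
    | succ j ih =>
      intro i hi
      rw [← hs.hook1 i (by omega)]
      exact hr _ _ (hl _ _ (ih (i+1) (by omega)))
  have : ∀ k, k ≤ N → Q (1 - P d h k) := by
    intro k
    induction k with
    | zero => intro _; simpa [P] using hl 0 _ h0
    | succ k ih =>
      intro hk
      have e : 1 - P d h (k+1) = (1 - P d h k) +
          algebraMap ℂ A (U d (k+1) / U d (k+2)) * (P d h k * h k * P d h k) := by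
        rw [← Algebra.smul_def]
        change 1 - (_ - _) = _
        abel
      rw [e]
      exact hadd _ _ (ih (by omega)) (hl _ _ (hr _ _ (hl _ _ (hall (N - k - 1) k (by omega)))))
  exact this N le_rfl

lemma idem_jac {x : A} (hx : x ∈ Ring.jacobson A) (hi : x * x = x) : x = 0 := by
  rw [← Ideal.jacobson_bot, Ideal.mem_jacobson_iff] at hx
  obtain ⟨z, hz⟩ := hx (-1)
  rw [Ideal.mem_bot] at hz
  have h1 : z * (1 - x) = 1 := by
    rw [← sub_eq_zero, ← hz]; noncomm_ring
  calc x = z * (1 - x) * x := by rw [h1, one_mul]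
    _ = 0 := by rw [mul_assoc, sub_mul, hi, one_mul, sub_self, mul_zero]

/-- Main inductive step. -/
lemma step {B : Type*} [Ring B] [Algebra ℂ B] [IsSemisimpleRing B] (f : B →ₐ[ℂ] A)
    (hs : Sys d N h) (hN : 0 < N) (hU : ∀ j, 1 ≤ j → j ≤ N + 1 → U d j ≠ 0)
    (htop : M h N = ⊤) (hf : ∀ x ∈ M h (N - 1 - 1), ∃ b, f b = x)
    (hfc : ∀ b, h (N-1) * f b = f b * h (N-1)) : IsSemisimpleRing A := by
  have hfin : Module.Finite ℂ A := ⟨htop ▸ M_fg hs N le_rfl⟩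
  have hart : IsArtinianRing A := IsArtinianRing.of_finite ℂ A
  obtain ⟨p1, p2, -, -, -⟩ := P_props hs N le_rfl hU
  have hd : d ≠ 0 := by
    have := hU 2 (by omega) (by omega)
    simpa [U] using this
  set p := P d h N with hp
  set e := h (N-1) with he
  have hee : e * e = d • e := hs.sq _
  rw [IsArtinianRing.isSemisimpleRing_iff_jacobson, eq_bot_iff]
  have hJr : ∀ a j, j ∈ Ring.jacobson A → j * a ∈ Ring.jacobson A := fun a j hj =>
    Ideal.mul_mem_right _ _ hj
  have hJl : ∀ a j, j ∈ Ring.jacobson A → a * j ∈ Ring.jacobson A := fun a j hj =>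
    Ideal.mul_mem_left _ _ hj
  -- the corner
  have hcor : ∀ x, ∃ b, e * x * e = f b * e := by
    intro x
    have : e * x * e ∈ M h (N-1-1) * H h (N-1) := by
      apply corner hs (N-1) (by omega)
      rw [show N - 1 + 1 = N by omega, htop]
      exact Submodule.mul_mem_mul (Submodule.mul_mem_mul (Submodule.mem_span_singleton_self _)
        trivial) (Submodule.mem_span_singleton_self _)
    rw [H, Submodule.mem_mul_span_singleton] at this
    obtain ⟨y, hy, hy2⟩ := this
    obtain ⟨b, rfl⟩ := hf y hy
    exact ⟨b, hy2.symm⟩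
  have hJe : ∀ j ∈ Ring.jacobson A, e * j * e = 0 := by
    let K : Ideal B :=
      { carrier := {b | f b * e ∈ Ring.jacobson A}
        add_mem' := by
          intro a b ha hb
          simp only [Set.mem_ofPred_eq, map_add, add_mul] at *
          exact add_mem ha hb
        zero_mem' := by simp
        smul_mem' := by
          intro c x hx
          simp only [Set.mem_ofPred_eq, smul_eq_mul, map_mul, mul_assoc] at *
          exact hJl _ _ hx }
    obtain ⟨u, hu, hK⟩ := IsSemisimpleRing.ideal_eq_span_idempotent K
    have huK : f u * e ∈ Ring.jacobson A := by
      have : u ∈ K := hK ▸ Ideal.subset_span rfl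
      exact this
    have hz : f u * e = 0 := by
      have : d⁻¹ • (f u * e) = 0 := by
        apply idem_jac
        · rw [Algebra.smul_def]; exact hJl _ _ huK
        · have : f u * e * (f u * e) = d • (f u * e) := by
            rw [mul_assoc, ← mul_assoc e, hfc, mul_assoc, hee, ← mul_assoc, ← map_mul, hu.eq,
              mul_smul_comm]
          rw [smul_mul_assoc, mul_smul_comm, this, smul_smul d⁻¹ d, inv_mul_cancel₀ hd, one_smul]
      rwa [smul_eq_zero_iff_right (inv_ne_zero hd)] at this
    intro j hj
    obtain ⟨b, hb⟩ := hcor j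
    have hbK : b ∈ K := by
      change f b * e ∈ Ring.jacobson A
      rw [← hb]
      exact hJr _ _ (hJl _ _ hj)
    rw [hK, Ideal.mem_span_singleton'] at hbK
    obtain ⟨a, rfl⟩ := hbK
    rw [hb, map_mul, mul_assoc, hz, mul_zero]
  have s1 : ∀ j ∈ Ring.jacobson A, e * j * (1 - p) = 0 := by
    refine one_sub_P hs hN (fun x => ∀ j ∈ Ring.jacobson A, e * j * x = 0) hJe ?_ ?_ ?_
    · intro x y hx hy j hj; rw [mul_add, hx j hj, hy j hj, add_zero]
    · intro a x hx j hj; rw [← mul_assoc, mul_assoc e]; exact hx _ (hJr _ _ hj)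
    · intro a x hx j hj; rw [← mul_assoc, hx j hj, zero_mul]
  have s2 : ∀ j ∈ Ring.jacobson A, (1 - p) * j * (1 - p) = 0 := by
    refine one_sub_P hs hN (fun x => ∀ j ∈ Ring.jacobson A, x * j * (1 - p) = 0) s1 ?_ ?_ ?_
    · intro x y hx hy j hj; rw [add_mul, add_mul, hx j hj, hy j hj, add_zero]
    · intro a x hx j hj; rw [mul_assoc, mul_assoc, ← mul_assoc x, hx j hj, mul_zero]
    · intro a x hx j hj; rw [mul_assoc x]; exact hx _ (hJl _ _ hj)
  have hsc : ∀ x : A, ∃ c : ℂ, p * x = c • p ∧ x * p = c • p := by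
    intro x
    have hx : x ∈ Algebra.adjoin ℂ (h '' {i | i < N}) := by
      have : x ∈ M h N := htop ▸ trivial
      exact this
    induction hx using Algebra.adjoin_induction with
    | mem x hx =>
      obtain ⟨i, hi, rfl⟩ := hx
      exact ⟨0, by simp [(p2 i hi).2], by simp [(p2 i hi).1]⟩
    | algebraMap r => exact ⟨r, by rw [Algebra.smul_def, Algebra.commutes], by rw [Algebra.smul_def]⟩
    | add x y _ _ h1 h2 =>
      obtain ⟨a, a1, a2⟩ := h1
      obtain ⟨b, b1, b2⟩ := h2
      exact ⟨a + b, by rw [mul_add, a1, b1, add_smul], by rw [add_mul, a2, b2, add_smul]⟩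
    | mul x y _ _ h1 h2 =>
      obtain ⟨a, a1, a2⟩ := h1
      obtain ⟨b, b1, b2⟩ := h2
      exact ⟨a * b, by rw [← mul_assoc, a1, smul_mul_assoc, b1, smul_smul],
        by rw [mul_assoc, b2, mul_smul_comm, a2, smul_smul, mul_comm]⟩
  intro j hj
  obtain ⟨c, c1, c2⟩ := hsc j
  have hjc : j = c • p := by
    have := s2 j hj
    rw [sub_mul, one_mul, mul_sub, mul_one, sub_mul, c1, c2, smul_mul_assoc, p1] at this
    simpa [sub_eq_zero] using this
  rw [Ideal.mem_bot]
  by_cases hc : c = 0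
  · rw [hjc, hc, zero_smul]
  · have : p ∈ Ring.jacobson A := by
      have h3 : p = algebraMap ℂ A c⁻¹ * j := by
        rw [← Algebra.smul_def, hjc, smul_smul, inv_mul_cancel₀ hc, one_smul]
      rw [h3]; exact hJl _ _ hj
    rw [hjc, idem_jac this p1, smul_zero]

end sys

/-- Generators extended by zero. -/
noncomputable def g (d : ℂ) (N : ℕ) (i : ℕ) : RingQuot (TLRel d N) :=
  if hi : i < N then RingQuot.mkAlgHom ℂ (TLRel d N) (FreeAlgebra.ι ℂ ⟨i, hi⟩) else 0

lemma g_sys (d : ℂ) (N : ℕ) : Sys d N (g d N) where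
  sq i := by
    by_cases hi : i < N
    · simp only [g, hi, dif_pos]
      rw [← map_mul, RingQuot.mkAlgHom_rel ℂ (TLRel.sq ⟨i, hi⟩), map_smul]
    · simp [g, hi]
  comm i j hij := by
    by_cases hj : j < N
    · have hi : i < N := by omega
      simp only [g, hi, hj, dif_pos]
      rw [← map_mul, RingQuot.mkAlgHom_rel ℂ (TLRel.comm ⟨i, hi⟩ ⟨j, hj⟩ (Or.inl hij)), map_mul]
    · simp [g, hj]
  hook1 i hj := by
    have hi : i < N := by omega
    simp only [g, hi, hj, dif_pos]
    rw [← map_mul, ← map_mul, RingQuot.mkAlgHom_rel ℂ (TLRel.hook ⟨i, hi⟩ ⟨i+1, hj⟩ (Or.inl rfl))]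
  hook2 i hj := by
    have hi : i < N := by omega
    simp only [g, hi, hj, dif_pos]
    rw [← map_mul, ← map_mul, RingQuot.mkAlgHom_rel ℂ (TLRel.hook ⟨i+1, hj⟩ ⟨i, hi⟩ (Or.inr rfl))]

lemma g_top (d : ℂ) (N : ℕ) : Algebra.adjoin ℂ (g d N '' {i | i < N}) = ⊤ := by
  have h1 : g d N '' {i | i < N} =
      RingQuot.mkAlgHom ℂ (TLRel d N) '' Set.range (FreeAlgebra.ι ℂ) := by
    ext x
    constructor
    · rintro ⟨i, hi, rfl⟩
      have hi : i < N := hi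
      exact ⟨_, ⟨⟨i, hi⟩, rfl⟩, by simp [g, hi]⟩
    · rintro ⟨_, ⟨i, rfl⟩, rfl⟩
      exact ⟨i, i.2, by simp [g]⟩
  rw [h1, ← AlgHom.map_adjoin, FreeAlgebra.adjoin_range_ι, Algebra.map_top]
  exact (AlgHom.range_eq_top _).2 (RingQuot.mkAlgHom_surjective ℂ _)

/-- Lifting a system to an algebra map. -/
lemma exists_lift {A : Type*} [Ring A] [Algebra ℂ A] {d : ℂ} {N K : ℕ} {h : ℕ → A}
    (hs : Sys d N h) (hK : K ≤ N) :
    ∃ f : RingQuot (TLRel d K) →ₐ[ℂ] A, ∀ i < K, f (g d K i) = h i := by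
  refine ⟨RingQuot.liftAlgHom ℂ ⟨FreeAlgebra.lift ℂ fun i : Fin K => h i, ?_⟩, ?_⟩
  · intro x y hxy
    cases hxy with
    | sq i => simp [hs.sq]
    | comm i j hij =>
      rcases hij with hij | hij
      · simp [hs.comm _ _ hij]
      · simp [hs.comm _ _ hij]
    | hook i j hij =>
      rcases hij with hij | hij
      · simp [← hij, hs.hook1 i (by omega)]
      · simp [← hij, hs.hook2 j (by omega)]
  · intro i hi
    simp [g, hi]

theorem main (d : ℂ) (N : ℕ) (hU : ∀ j, 1 ≤ j → j ≤ N + 1 → U d j ≠ 0) :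
    IsSemisimpleRing (RingQuot (TLRel d N)) := by
  induction N using Nat.strong_induction_on with
  | _ N ih =>
  rcases Nat.eq_zero_or_pos N with rfl | hN
  · have ht := g_top d 0
    have hsur : Function.Surjective (algebraMap ℂ (RingQuot (TLRel d 0))) := by
      intro x
      have : x ∈ Algebra.adjoin ℂ (g d 0 '' {i | i < 0}) := ht ▸ trivial
      simpa [Algebra.mem_bot] using this
    exact RingHom.isSemisimpleRing_of_surjective _ hsur
  · have := ih (N-1-1) (by omega) (fun j h1 h2 => hU j h1 (by omega))
    obtain ⟨f, hf⟩ := exists_lift (g_sys d N) (K := N-1-1) (by omega)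
    have himg : (Algebra.adjoin ℂ (g d N '' {i | i < N-1-1})) = f.range := by
      rw [← Algebra.map_top, ← g_top, AlgHom.map_adjoin, Set.image_image]
      congr 1
      exact Set.image_congr fun i hi => (hf i hi).symm
    refine step f (g_sys d N) hN hU ?_ ?_ ?_
    · rw [M, g_top]; rfl
    · intro x hx
      have hx : x ∈ Algebra.adjoin ℂ (g d N '' {i | i < N-1-1}) := hx
      rw [himg] at hx
      exact hx
    · intro b
      rcases Nat.lt_or_ge N 2 with h2 | h2
      · obtain rfl : N = 1 := by omega
        have : b ∈ Algebra.adjoin ℂ (g d 0 '' {i | i < 0}) := g_top d 0 ▸ trivial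
        have : ∃ c, algebraMap ℂ _ c = b := by simpa [Algebra.mem_bot] using this
        obtain ⟨c, rfl⟩ := this
        rw [AlgHom.commutes, Algebra.commutes]
      · refine commute_M (k := N-1-1) (g_sys d N) ?_ (by omega)
        change f b ∈ Algebra.adjoin ℂ _
        rw [himg]
        exact ⟨b, rfl⟩

lemma qInt_eq (q : ℂ) (hq : q ≠ 0) (k : ℕ) : qInt q k = U (q + q⁻¹) k := by
  induction k using Nat.twoStepInduction with
  | zero => simp [qInt, U]
  | one =>
    rw [qInt, U]
    split_ifs with h
    · simp
    · have : q - q⁻¹ ≠ 0 := by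
        intro h0
        apply h
        field_simp at h0
        linear_combination h0
      simp [div_self this]
  | more k h1 h2 =>
    rw [U, ← h1, ← h2]
    simp only [qInt]
    split_ifs with h
    · have hi : q⁻¹ = q := by
        exact inv_eq_of_mul_eq_one_left (by rw [← sq]; exact h)
      rw [hi]
      rcases k with _ | k
      · simp; ring
      · simp only [Nat.add_sub_cancel]
        push_cast
        change (_ : ℂ) * q ^ (k + 2) = _
        linear_combination (-(k + 1) * q ^ k) * h
    · rw [← mul_div_assoc, ← sub_div]
      congr 1
      have : q * q⁻¹ = 1 := mul_inv_cancel₀ hq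
      linear_combination (q ^ k - q⁻¹ ^ k) * (-this)

end TLproof

/-- Let `q ∈ ℂ`, `q ≠ 0`, `d = q + q⁻¹`, `n ≥ 1`.  If the quantum integers `[k]_q` are
nonzero for all `1 ≤ k ≤ n`, then the Temperley-Lieb algebra `TL_n(d)` is a
semisimple ring. -/
theorem stmt9 (q : ℂ) (hq : q ≠ 0) (n : ℕ) (hn : 1 ≤ n)
    (hk : ∀ k : ℕ, 1 ≤ k → k ≤ n → qInt q k ≠ 0) :
    IsSemisimpleRing (TL (q + q⁻¹) n) := by
  obtain ⟨m, rfl⟩ : ∃ m, n = m + 1 := ⟨n - 1, by omega⟩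
  refine TLproof.main (q + q⁻¹) m fun j h1 h2 => ?_
  rw [← TLproof.qInt_eq q hq]
  exact hk j h1 h2
end
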